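/- For each integer c > 0 such that q₁q₂ | c, there exists an integer a with gcd(a, c) = 1 such that S_{χ₁,χ₂}(a, c) ≠ 0. -/

import Mathlib

open scoped MatrixGroups
open CongruenceSubgroup Matrix

/-- The first Bernoulli function `B₁(x)`: equal to `x - ⌊x⌋ - 1/2` for non-integral `x`
and `0` for integral `x`. -/
noncomputable def B1 (x : ℝ) : ℝ := if Int.fract x = 0 then 0 else Int.fract x - 1/2

/-- The newform Dedekind sum `S_{χ₁,χ₂}(a, c)`. -/
noncomputable def ded {q₁ q₂ : ℕ} (χ₁ : DirichletCharacter ℂ q₁)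
    (χ₂ : DirichletCharacter ℂ q₂) (a c : ℤ) : ℂ :=
  ∑ j ∈ Finset.range c.toNat, ∑ n ∈ Finset.range q₁,
    (starRingEnd ℂ) (χ₂ (j : ZMod q₂)) * (starRingEnd ℂ) (χ₁ (n : ZMod q₁)) *
      ((B1 ((j : ℝ) / (c : ℝ)) * B1 ((n : ℝ) / (q₁ : ℝ) + (a : ℝ) * (j : ℝ) / (c : ℝ)) : ℝ) : ℂ)

section
open Complex Filter Topology

lemma rpow_diff_aux {x y s : ℝ} (hx : 1 ≤ x) (hxy : x ≤ y) (hy : y ≤ x + 1) (hs : 1 ≤ s) (hs2 : s ≤ 2) :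
    |x ^ (-s) - y ^ (-s)| ≤ 2 / x ^ 2 := by
  have hx0 : 0 < x := by linarith
  have hy0 : 0 < y := by linarith
  have h1 : y ^ (-s) = x ^ (-s) * (x / y) ^ s := by
    rw [Real.div_rpow hx0.le hy0.le, Real.rpow_neg hx0.le, Real.rpow_neg hy0.le]
    have := (Real.rpow_pos_of_pos hx0 s).ne'
    field_simp
  have h2 : (x / y) ^ s ≤ 1 := Real.rpow_le_one (by positivity) ((div_le_one hy0).2 hxy) (by linarith)
  have h3 : (x / y) ^ (2:ℝ) ≤ (x / y) ^ s :=
    Real.rpow_le_rpow_of_exponent_ge (by positivity) ((div_le_one hy0).2 hxy) hs2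
  rw [Real.rpow_two] at h3
  have h4 : x ^ (-s) ≤ x⁻¹ := by
    rw [← Real.rpow_neg_one]
    exact Real.rpow_le_rpow_of_exponent_le hx (by linarith)
  have h5 : 0 < x ^ (-s) := Real.rpow_pos_of_pos hx0 _
  rw [h1, abs_of_nonneg (by nlinarith)]
  have h6 : 1 - (x / y) ^ 2 ≤ 2 / x := by
    have : x / y ≥ 1 - 1 / x := by
      rw [ge_iff_le, sub_le_iff_le_add, div_add_div _ _ hy0.ne' hx0.ne', le_div_iff₀ (by positivity)]
      nlinarith
    have h7 : 0 < x / y := by positivity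
    have h8 : 1 / x ≤ 1 := by rw [div_le_one hx0]; exact hx
    have h9 : 2 / x = 2 * (1 / x) := by ring
    rw [h9]; nlinarith
  calc x ^ (-s) - x ^ (-s) * (x / y) ^ s = x ^ (-s) * (1 - (x/y)^s) := by ring
    _ ≤ x⁻¹ * (2 / x) := by
        apply mul_le_mul h4 (by linarith) (by linarith) (by positivity)
    _ = 2 / x ^ 2 := by field_simp

lemma rpow_diff_aux2 {x y m s : ℝ} (hm : 1 ≤ m) (hx : m ≤ x) (hy : m ≤ y) (hxy : |x - y| ≤ 1) (hs : 1 ≤ s) (hs2 : s ≤ 2) :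
    |x ^ (-s) - y ^ (-s)| ≤ 2 / m ^ 2 := by
  rw [abs_le] at hxy
  rcases le_total x y with h | h
  · refine (rpow_diff_aux (by linarith) h (by linarith) hs hs2).trans ?_
    gcongr
  · rw [abs_sub_comm]
    refine (rpow_diff_aux (by linarith) h (by linarith) hs hs2).trans ?_
    gcongr

lemma hurwitzOdd_one {a : ℝ} (ha : 0 < a) (ha1 : a < 1) :
    HurwitzZeta.hurwitzZetaOdd (a : UnitAddCircle) 1 = (Real.pi : ℂ) / 2 * Complex.cot (Real.pi * a) := by
  set f : ℕ → ℝ → ℝ := fun n s => (((n:ℝ) + a) ^ (-s) - ((n:ℝ) + 1 - a) ^ (-s)) / 2 with hf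
  have hA (n : ℕ) : 0 < (n:ℝ) + a := by positivity
  have hB (n : ℕ) : 0 < (n:ℝ) + 1 - a := by
    have : (0:ℝ) ≤ n := by positivity
    linarith
  have hsum : ∀ s : ℝ, 1 < s → HasSum (fun n => f n s) (HurwitzZeta.hurwitzZetaOdd (a : UnitAddCircle) s).re := by
    intro s hs
    have := HurwitzZeta.hasSum_nat_hurwitzZetaOdd_of_mem_Icc (a := a) ⟨ha.le, ha1.le⟩ (s := s) (by simpa using hs)
    have h2 := Complex.hasSum_re this
    convert h2 using 2 with n
    simp only [hf]
    have e1 : (n + a : ℂ) = ((n + a : ℝ) : ℂ) := by push_cast; rfl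
    have e2 : (n + 1 - a : ℂ) = ((n + 1 - a : ℝ) : ℂ) := by push_cast; rfl
    rw [e1, e2, ← Complex.ofReal_cpow (hA n).le, ← Complex.ofReal_cpow (hB n).le,
      Real.rpow_neg (hA n).le, Real.rpow_neg (hB n).le]
    norm_cast
    simp
  have him : ∀ s : ℝ, 1 < s → (HurwitzZeta.hurwitzZetaOdd (a : UnitAddCircle) s).im = 0 := by
    intro s hs
    have := HurwitzZeta.hasSum_nat_hurwitzZetaOdd_of_mem_Icc (a := a) ⟨ha.le, ha1.le⟩ (s := s) (by simpa using hs)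
    have h2 := Complex.hasSum_im this
    refine h2.unique ?_
    convert hasSum_zero using 2 with n
    have e1 : (n + a : ℂ) = ((n + a : ℝ) : ℂ) := by push_cast; rfl
    have e2 : (n + 1 - a : ℂ) = ((n + 1 - a : ℝ) : ℂ) := by push_cast; rfl
    rw [e1, e2, ← Complex.ofReal_cpow (hA n).le, ← Complex.ofReal_cpow (hB n).le]
    norm_cast
  set bound : ℕ → ℝ := fun n => (if n = 0 then a ^ (-2:ℝ) + (1 - a) ^ (-2:ℝ) else 0) + 2 * (1 / (n:ℝ) ^ 2) with hbound
  have hbs : Summable bound := by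
    refine Summable.add (summable_of_ne_finset_zero (s := {0}) ?_) ?_
    · intro b hb; simp at hb; simp [hb]
    · exact (Real.summable_one_div_nat_pow.2 (by norm_num)).mul_left 2
  have hbd : ∀ s : ℝ, 1 ≤ s → s ≤ 2 → ∀ n, ‖f n s‖ ≤ bound n := by
    intro s hs hs2 n
    simp only [hf, hbound, Real.norm_eq_abs, abs_div]
    rw [abs_of_pos (by norm_num : (0:ℝ) < 2)]
    rcases Nat.eq_zero_or_pos n with rfl | hn
    · simp only [Nat.cast_zero, zero_add, if_true]
      have h1 : a ^ (-s) ≤ a ^ (-2:ℝ) := Real.rpow_le_rpow_of_exponent_ge ha ha1.le (by linarith)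
      have h2 : (1-a) ^ (-s) ≤ (1-a) ^ (-2:ℝ) := Real.rpow_le_rpow_of_exponent_ge (by linarith) (by linarith) (by linarith)
      have h3 : 0 < a ^ (-s) := Real.rpow_pos_of_pos ha _
      have h4 : 0 < (1-a) ^ (-s) := Real.rpow_pos_of_pos (by linarith) _
      have : |a ^ (-s) - (1-a) ^ (-s)| ≤ a ^ (-2:ℝ) + (1 - a) ^ (-2:ℝ) := by
        rw [abs_le]; constructor <;> linarith
      have h5 : 0 ≤ |a ^ (-s) - (1-a) ^ (-s)| := abs_nonneg _
      norm_num at *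
      linarith
    · have hn1 : (1:ℝ) ≤ n := by exact_mod_cast hn
      rw [if_neg hn.ne']
      have := rpow_diff_aux2 (x := n + a) (y := n + 1 - a) (m := n) hn1 (by linarith) (by linarith)
        (by rw [abs_le]; constructor <;> linarith) hs hs2
      have h5 := abs_nonneg (((n:ℝ) + a) ^ (-s) - ((n:ℝ) + 1 - a) ^ (-s))
      rw [show 2 * (1 / (n:ℝ)^2) = 2 / (n:ℝ)^2 by ring]
      linarith
  have hlim : Tendsto (fun s => ∑' n, f n s) (𝓝[>] (1:ℝ)) (𝓝 (∑' n, f n 1)) := by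
    refine tendsto_tsum_of_dominated_convergence hbs ?_ ?_
    · intro n
      have : Continuous (f n) := by
        simp only [hf]
        have := fun b : ℝ => fun hb : 0 < b => (Real.continuous_const_rpow hb.ne').comp continuous_neg
        exact ((this _ (hA n)).sub (this _ (hB n))).div_const 2
      exact (this.tendsto 1).mono_left nhdsWithin_le_nhds
    · have : Set.Ioo (1:ℝ) 2 ∈ 𝓝[>] (1:ℝ) := Ioo_mem_nhdsGT (by norm_num)
      filter_upwards [this] with s hs
      exact hbd s hs.1.le hs.2.le
  have hcont : Tendsto (fun s : ℝ => HurwitzZeta.hurwitzZetaOdd (a : UnitAddCircle) s) (𝓝[>] (1:ℝ))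
      (𝓝 (HurwitzZeta.hurwitzZetaOdd (a : UnitAddCircle) 1)) := by
    have h := (HurwitzZeta.differentiable_hurwitzZetaOdd (a : UnitAddCircle)).continuous.comp Complex.continuous_ofReal
    have := h.tendsto 1
    simp only [Function.comp_def, Complex.ofReal_one] at this
    exact this.mono_left nhdsWithin_le_nhds
  have hval : HurwitzZeta.hurwitzZetaOdd (a : UnitAddCircle) 1 = ((∑' n, f n 1 : ℝ) : ℂ) := by
    refine tendsto_nhds_unique hcont ?_
    have h2 := (Complex.continuous_ofReal.tendsto _).comp hlim
    refine h2.congr' ?_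
    filter_upwards [self_mem_nhdsWithin] with s hs
    simp only [Function.comp]
    rw [(hsum s hs).tsum_eq]
    apply Complex.ext <;> simp [him s hs]
  rw [hval]
  have hs1 : Summable (fun n => f n 1) := Summable.of_norm_bounded hbs (hbd 1 le_rfl one_le_two)
  have ht1 : Tendsto (fun M => ∑ n ∈ Finset.range M, ((f n 1 : ℝ) : ℂ)) atTop (𝓝 ((∑' n, f n 1 : ℝ) : ℂ)) := by
    have := (Complex.continuous_ofReal.tendsto _).comp hs1.hasSum.tendsto_sum_nat
    simpa [Function.comp_def] using this
  have hz : (a : ℂ) ∈ Complex.integerComplement := by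
    rw [Complex.mem_integerComplement_iff]
    rintro ⟨n, hn⟩
    have : (n : ℝ) = a := by exact_mod_cast hn
    rw [← this] at ha ha1
    norm_cast at ha ha1
    omega
  have ht2 := tendsto_logDeriv_euler_cot_sub hz
  have ht3 : Tendsto (fun M : ℕ => (1 / (2 * (M + 1 - a)) : ℝ)) atTop (𝓝 0) := by
    simp only [one_div]
    refine Tendsto.inv_tendsto_atTop ?_
    refine Tendsto.const_mul_atTop (by norm_num) ?_
    have : Tendsto (fun M : ℕ => (M:ℝ) + (1 - a)) atTop atTop :=
      tendsto_atTop_add_const_right _ _ tendsto_natCast_atTop_atTop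
    simpa [add_sub_assoc] using this
  have ht4 := (Complex.continuous_ofReal.tendsto _).comp ht3
  have ht5 := (ht1.comp (tendsto_add_atTop_nat 1)).add ht4
  have ht6 := ((ht2.add_const (1 / (a:ℂ))).div_const 2)
  have hf1 (n : ℕ) : ((f n 1 : ℝ) : ℂ) = (1 / ((n:ℂ) + a) - 1 / ((n:ℂ) + 1 - a)) / 2 := by
    simp only [hf, Real.rpow_neg_one]
    push_cast
    simp
  have hB' (n : ℕ) : (n:ℂ) + 1 - a ≠ 0 := by
    have := (hB n).ne'
    exact_mod_cast this
  have key : ∀ M : ℕ, (∑ n ∈ Finset.range M, cotTerm (a:ℂ) n + 1 / (a:ℂ)) / 2 =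
      ∑ n ∈ Finset.range (M+1), ((f n 1 : ℝ) : ℂ) + ((1 / (2 * (M + 1 - a)) : ℝ) : ℂ) := by
    intro M
    induction M with
    | zero =>
      simp [hf1]
      have := hB' 0
      simp at this
      ring
    | succ k ih =>
      rw [Finset.sum_range_succ _ (k+1), Finset.sum_range_succ _ k]
      have e : (∑ n ∈ Finset.range k, cotTerm (a:ℂ) n + cotTerm (a:ℂ) k + 1 / (a:ℂ)) / 2
        = (∑ n ∈ Finset.range k, cotTerm (a:ℂ) n + 1 / (a:ℂ)) / 2 + cotTerm (a:ℂ) k / 2 := by ring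
      rw [e, ih, hf1]
      simp only [cotTerm]
      push_cast
      have h0 := hB' k
      have h1 := hB' (k+1)
      push_cast at h1
      have h2 : (a:ℂ) - (k + 1) = - ((k:ℂ) + 1 - a) := by ring
      rw [h2]
      field_simp
      ring
  have h7 : ((∑' n, f n 1 : ℝ) : ℂ) + ((0:ℝ):ℂ) = (↑Real.pi * Complex.cot (Real.pi * a) - 1 / (a:ℂ) + 1 / a) / 2 := by
    refine tendsto_nhds_unique ht5 (ht6.congr fun M => ?_)
    rw [key M]
    simp
  simp only [Complex.ofReal_zero, add_zero] at h7
  rw [h7]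
  ring

end

section
open Complex

noncomputable def E (x : ℂ) : ℂ := Complex.exp (2 * Real.pi * Complex.I * x)

lemma E_add (x y : ℂ) : E (x + y) = E x * E y := by
  simp only [E, mul_add, Complex.exp_add]

lemma E_int (n : ℤ) : E n = 1 := by
  rw [E, mul_comm, Complex.exp_int_mul, Complex.exp_two_pi_mul_I, _root_.one_zpow]

lemma E_nat (n : ℕ) : E n = 1 := by exact_mod_cast E_int n

lemma E_zero : E 0 = 1 := by simp [E]

lemma E_ne_zero (x : ℂ) : E x ≠ 0 := Complex.exp_ne_zero _

lemma E_nat_mul (n : ℕ) (x : ℂ) : E (n * x) = E x ^ n := by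
  rw [E, E, ← Complex.exp_nat_mul]; ring_nf

lemma E_neg (x : ℂ) : E (-x) = (E x)⁻¹ := by
  simp only [E, mul_neg, Complex.exp_neg]

lemma E_eq_one_iff (x : ℂ) : E x = 1 ↔ ∃ n : ℤ, x = n := by
  rw [E, Complex.exp_eq_one_iff]
  have : (2 * Real.pi * Complex.I : ℂ) ≠ 0 := Complex.two_pi_I_ne_zero
  constructor
  · rintro ⟨n, hn⟩
    exact ⟨n, mul_left_cancel₀ this (by rw [hn]; ring)⟩
  · rintro ⟨n, rfl⟩; exact ⟨n, by ring⟩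

lemma sum_range_mul' (f : ℕ → ℂ) (e n : ℕ) :
    ∑ j ∈ Finset.range (e * n), f j = ∑ i ∈ Finset.range e, ∑ x ∈ Finset.range n, f (x + n * i) := by
  induction e with
  | zero => simp
  | succ e ih =>
    rw [Finset.sum_range_succ, ← ih, Nat.succ_mul, Finset.sum_range_add]
    congr 1
    refine Finset.sum_congr rfl fun x _ => ?_
    congr 1; ring

lemma B1_nat {c j : ℕ} (hj : j < c) : B1 ((j:ℝ) / c) = if j = 0 then 0 else (j:ℝ)/c - 1/2 := by
  have hc : (0:ℝ) < c := by exact_mod_cast (by omega : 0 < c)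
  have hfr : Int.fract ((j:ℝ)/c) = (j:ℝ)/c := by
    rw [Int.fract_eq_self]
    exact ⟨by positivity, by rw [div_lt_one hc]; exact_mod_cast hj⟩
  rw [B1, hfr]
  have : ((j:ℝ)/c = 0) ↔ j = 0 := by
    rw [div_eq_zero_iff]; simp [hc.ne']
  simp only [this]

lemma B1_add_nat (x : ℝ) (n : ℕ) : B1 (x + n) = B1 x := by
  simp [B1, Int.fract_add_natCast]

noncomputable def BB (c : ℕ) (f : ℕ → ℂ) : ℂ := ∑ j ∈ Finset.range c, f j * (B1 ((j:ℝ)/c) : ℂ)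

noncomputable def FT (c : ℕ) (f : ℕ → ℂ) (m : ℕ) : ℂ :=
  ∑ k ∈ Finset.range c, f k * E (-((m:ℂ) * k / c))

noncomputable def LL (c : ℕ) (f : ℕ → ℂ) : ℂ := BB c (FT c f)

lemma B1_distr {e n x : ℕ} (he : 0 < e) (hx : x < n) :
    ∑ i ∈ Finset.range e, B1 (((x + n * i : ℕ) : ℝ) / ((e * n : ℕ))) = B1 ((x:ℝ)/n) := by
  have hn : (0:ℝ) < n := by exact_mod_cast (by omega : 0 < n)
  have hlt : ∀ i ∈ Finset.range e, x + n * i < e * n := by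
    intro i hi
    have hi := Finset.mem_range.1 hi
    nlinarith [Nat.mul_le_mul_left n (Nat.succ_le_of_lt hi)]
  have hsum : ∀ e : ℕ, ∑ i ∈ Finset.range e, (i:ℝ) = e * (e - 1) / 2 := by
    intro e
    induction e with
    | zero => simp
    | succ k ih => rw [Finset.sum_range_succ, ih]; push_cast; ring
  have he' : (0:ℝ) < e := by exact_mod_cast he
  have e1 : ∑ i ∈ Finset.range e, ((((x + n * i : ℕ) : ℝ) / ((e * n : ℕ))) - 1/2) = (x:ℝ)/n - 1/2 := by
    have : ∀ i ∈ Finset.range e, (((x + n * i : ℕ) : ℝ) / ((e * n : ℕ))) - 1/2 =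
      ((x:ℝ)/(e*n) - 1/2) + (i:ℝ) / e := by
      intro i _
      push_cast
      field_simp
      ring
    rw [Finset.sum_congr rfl this, Finset.sum_add_distrib, ← Finset.sum_div, hsum]
    simp only [Finset.sum_const, Finset.card_range, nsmul_eq_mul]
    field_simp
    ring
  rw [B1_nat hx]
  rw [Finset.sum_congr rfl (fun i hi => B1_nat (hlt i hi))]
  split_ifs with h0
  · subst h0
    obtain ⟨e, rfl⟩ : ∃ e', e = e' + 1 := ⟨e - 1, by omega⟩
    rw [Finset.sum_range_succ'] at e1 ⊢
    simp only [Nat.cast_zero, mul_zero, add_zero, zero_div] at e1 ⊢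
    simp only [if_true, add_zero]
    have e2 : ∑ k ∈ Finset.range e, (((0 + n * (k + 1) : ℕ) : ℝ) / (((e + 1) * n : ℕ) : ℝ) - 1 / 2) = 0 := by
      linarith
    refine Eq.trans ?_ e2
    refine Finset.sum_congr rfl fun i _ => ?_
    rw [if_neg]
    have : 0 < n := by exact_mod_cast hn
    positivity
  · rw [← e1]
    refine Finset.sum_congr rfl fun i _ => ?_
    rw [if_neg (by omega)]

lemma per_mul {f : ℕ → ℂ} {n : ℕ} (hf : Function.Periodic f n) (x i : ℕ) : f (x + n * i) = f x := by
  rw [mul_comm]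
  exact hf.nat_mul i x

lemma BB_enlarge {f : ℕ → ℂ} {n : ℕ} (hf : Function.Periodic f n) {e : ℕ} (he : 0 < e) :
    BB (e * n) f = BB n f := by
  rw [BB, sum_range_mul', Finset.sum_comm, BB]
  refine Finset.sum_congr rfl fun x hx => ?_
  rw [← B1_distr he (Finset.mem_range.1 hx)]
  simp only [per_mul hf]
  push_cast
  rw [Finset.mul_sum]

lemma sum_dvd (g : ℕ → ℂ) {e : ℕ} (he : 0 < e) (n : ℕ) :
    ∑ j ∈ Finset.range (e * n), (if e ∣ j then g j else 0) = ∑ x ∈ Finset.range n, g (e * x) := by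
  rw [mul_comm, sum_range_mul']
  refine Finset.sum_congr rfl fun i _ => ?_
  rw [Finset.sum_eq_single 0]
  · simp
  · intro b hb hb0
    rw [if_neg]
    rw [← Nat.dvd_add_iff_left (dvd_mul_right e i)]
    intro h
    have := Nat.le_of_dvd (by omega) h
    have := Finset.mem_range.1 hb
    omega
  · intro h; simp at h; omega

lemma BB_dvd (f : ℕ → ℂ) {e : ℕ} (he : 0 < e) (n : ℕ) :
    BB (e * n) (fun j => if e ∣ j then f j else 0) = BB n (fun x => f (e * x)) := by
  rw [BB, BB]
  have := sum_dvd (fun j => f j * (B1 ((j:ℝ)/((e * n : ℕ))) : ℂ)) he n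
  simp only [ite_mul, zero_mul]
  rw [this]
  refine Finset.sum_congr rfl fun x _ => ?_
  have he' : (e:ℝ) ≠ 0 := by positivity
  congr 3
  push_cast
  rw [mul_div_mul_left _ _ he']

lemma FT_periodic (f : ℕ → ℂ) {c : ℕ} (hc : 0 < c) : Function.Periodic (FT c f) c := by
  intro m
  have hc' : (c:ℂ) ≠ 0 := by exact_mod_cast hc.ne'
  refine Finset.sum_congr rfl fun k _ => ?_
  congr 1
  rw [show -(((m + c : ℕ) : ℂ) * k / c) = -((m:ℂ) * k / c) + ((-(k:ℤ) : ℤ) : ℂ) by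
    push_cast; field_simp; ring, E_add, E_int, mul_one]

lemma geom_E {e : ℕ} (he : 0 < e) (m : ℕ) :
    ∑ i ∈ Finset.range e, E (-((m:ℂ) * i / e)) = if e ∣ m then (e:ℂ) else 0 := by
  have he' : (e:ℂ) ≠ 0 := by exact_mod_cast he.ne'
  have h1 : ∀ i : ℕ, E (-((m:ℂ) * i / e)) = E (-((m:ℂ)/e)) ^ i := by
    intro i; rw [← E_nat_mul]; congr 1; ring
  simp only [h1]
  split_ifs with h
  · obtain ⟨d, rfl⟩ := h
    have : E (-(((e * d : ℕ):ℂ)/e)) = 1 := by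
      rw [show -(((e * d : ℕ):ℂ)/e) = ((-(d:ℤ) : ℤ) : ℂ) by push_cast; field_simp, E_int]
    simp only [this, one_pow, Finset.sum_const, Finset.card_range, nsmul_eq_mul, mul_one]
  · have hne : E (-((m:ℂ)/e)) ≠ 1 := by
      rw [Ne, E_eq_one_iff]
      rintro ⟨n, hn⟩
      apply h
      have : (m:ℂ) = ((-(n * e) : ℤ) : ℂ) := by
        push_cast; rw [← neg_mul, ← hn]; field_simp
      have h2 : (m:ℤ) = -(n * e) := by exact_mod_cast this
      have : (e:ℤ) ∣ m := ⟨-n, by rw [h2]; ring⟩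
      exact_mod_cast this
    rw [geom_sum_eq hne, ← E_nat_mul]
    rw [show (e:ℂ) * -((m:ℂ)/e) = ((-(m:ℤ) : ℤ) : ℂ) by push_cast; field_simp, E_int]
    simp

lemma LL_enlarge {f : ℕ → ℂ} {n : ℕ} (hn : 0 < n) (hf : Function.Periodic f n) {e : ℕ} (he : 0 < e) :
    LL (e * n) f = e * LL n f := by
  have he' : (e:ℂ) ≠ 0 := by exact_mod_cast he.ne'
  have hn' : (n:ℂ) ≠ 0 := by exact_mod_cast hn.ne'
  have h : FT (e * n) f = fun m => if e ∣ m then (e:ℂ) * FT n f (m / e) else 0 := by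
    ext m
    rw [FT, sum_range_mul', Finset.sum_comm]
    have : ∀ x i : ℕ, f (x + n * i) * E (-((m:ℂ) * ((x + n * i : ℕ):ℂ) / ((e * n : ℕ):ℂ))) =
        f x * E (-((m:ℂ) * x / ((e * n : ℕ):ℂ))) * E (-((m:ℂ) * i / e)) := by
      intro x i
      rw [per_mul hf, mul_assoc, ← E_add]
      congr 2
      push_cast
      field_simp
      ring
    simp only [this, ← Finset.mul_sum, geom_E he]
    split_ifs with h
    · obtain ⟨d, rfl⟩ := h
      rw [Nat.mul_div_cancel_left _ he, FT, Finset.mul_sum]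
      refine Finset.sum_congr rfl fun x _ => ?_
      rw [mul_comm, show (((e * d : ℕ):ℂ) * x / ((e * n : ℕ):ℂ)) = (d:ℂ) * x / n by push_cast; field_simp]
    · simp
  rw [LL, h, BB_dvd (fun m => (e:ℂ) * FT n f (m / e)) he n]
  simp only [Nat.mul_div_cancel_left _ he]
  rw [LL, BB, BB, Finset.mul_sum]
  simp only [mul_assoc]

lemma LL_dvd (f : ℕ → ℂ) {e : ℕ} (he : 0 < e) {n : ℕ} (hn : 0 < n) :
    LL (e * n) (fun j => if e ∣ j then f j else 0) = LL n (fun x => f (e * x)) := by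
  have he' : (e:ℂ) ≠ 0 := by exact_mod_cast he.ne'
  have h : FT (e * n) (fun j => if e ∣ j then f j else 0) = FT n (fun x => f (e * x)) := by
    ext m
    rw [FT, FT]
    have := sum_dvd (fun k => f k * E (-((m:ℂ) * k / ((e * n : ℕ):ℂ)))) he n
    simp only [ite_mul, zero_mul]
    rw [this]
    refine Finset.sum_congr rfl fun x _ => ?_
    congr 2
    push_cast
    field_simp
  rw [LL, h, BB_enlarge (FT_periodic _ hn) he, LL]

lemma BB_ind {f : ℕ → ℂ} {c e : ℕ} (hc : 0 < c) (hec : e ∣ c) (hf : Function.Periodic f c) {α : ℂ}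
    (hα : ∀ x, f (e * x) = α * f x) : BB c (fun j => if e ∣ j then f j else 0) = α * BB c f := by
  have he : 0 < e := Nat.pos_of_dvd_of_pos hec hc
  have hp : Function.Periodic (fun j => if e ∣ j then f j else 0) c := by
    intro x
    simp only [hf x, ← Nat.dvd_add_iff_left hec]
  rw [← BB_enlarge hp he, BB_dvd _ he, BB, BB, Finset.mul_sum]
  simp only [hα, mul_assoc]

lemma LL_const_mul (c : ℕ) (α : ℂ) (f : ℕ → ℂ) : LL c (fun x => α * f x) = α * LL c f := by
  simp only [LL, BB, FT, Finset.mul_sum, Finset.sum_mul, mul_assoc]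

lemma LL_add (c : ℕ) (f g : ℕ → ℂ) : LL c (fun x => f x + g x) = LL c f + LL c g := by
  simp only [LL, BB, FT, Finset.sum_mul, add_mul, Finset.sum_add_distrib]

lemma LL_sub (c : ℕ) (f g : ℕ → ℂ) : LL c (fun x => f x - g x) = LL c f - LL c g := by
  simp only [LL, BB, FT, Finset.sum_mul, sub_mul, Finset.sum_sub_distrib]

lemma BB_const_mul (c : ℕ) (α : ℂ) (f : ℕ → ℂ) : BB c (fun x => α * f x) = α * BB c f := by
  simp only [BB, Finset.mul_sum, mul_assoc]

lemma BB_add (c : ℕ) (f g : ℕ → ℂ) : BB c (fun x => f x + g x) = BB c f + BB c g := by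
  simp only [BB, add_mul, Finset.sum_add_distrib]

lemma BB_sub (c : ℕ) (f g : ℕ → ℂ) : BB c (fun x => f x - g x) = BB c f - BB c g := by
  simp only [BB, sub_mul, Finset.sum_sub_distrib]

lemma LL_ind {f : ℕ → ℂ} {c e : ℕ} (hc : 0 < c) (hec : e ∣ c) (hf : Function.Periodic f c) {α : ℂ}
    (hα : ∀ x, f (e * x) = α * f x) :
    e * LL c (fun j => if e ∣ j then f j else 0) = α * LL c f := by
  have he : 0 < e := Nat.pos_of_dvd_of_pos hec hc
  have hp : Function.Periodic (fun j => if e ∣ j then f j else 0) c := by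
    intro x
    simp only [hf x, ← Nat.dvd_add_iff_left hec]
  rw [← LL_enlarge hc hp he, LL_dvd _ he hc]
  simp only [hα, LL_const_mul]

lemma sum_zmod {N : ℕ} [NeZero N] (F : ZMod N → ℂ) :
    ∑ j ∈ Finset.range N, F (j : ZMod N) = ∑ x : ZMod N, F x := by
  refine Finset.sum_bij' (fun j _ => (j : ZMod N)) (fun x _ => x.val) ?_ ?_ ?_ ?_ ?_
  · simp
  · intro x _; simp [ZMod.val_lt]
  · intro j hj; exact ZMod.val_cast_of_lt (Finset.mem_range.1 hj)
  · intro x _; simp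
  · simp

lemma FT_inv {c : ℕ} (hc : 0 < c) {f : ℕ → ℂ} (y : ℕ) (hy : y < c) :
    f y = (1 / (c:ℂ)) * ∑ k ∈ Finset.range c, FT c f k * E ((k:ℂ) * y / c) := by
  have hc' : (c:ℂ) ≠ 0 := by exact_mod_cast hc.ne'
  simp only [FT, Finset.sum_mul]
  rw [Finset.sum_comm]
  have : ∀ m ∈ Finset.range c, ∑ k ∈ Finset.range c, f m * E (-((k:ℂ) * m / c)) * E ((k:ℂ) * y / c)
      = if m = y then f m * c else 0 := by
    intro m hm
    have hm := Finset.mem_range.1 hm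
    have h1 : ∀ k : ℕ, E (-((k:ℂ) * m / c)) * E ((k:ℂ) * y / c) = E (-(((m + (c - y) : ℕ):ℂ) * k / c)) := by
      intro k
      rw [← E_add, show -(((m + (c - y) : ℕ):ℂ) * k / c) = (-((k:ℂ) * m / c) + (k:ℂ) * y / c) + ((-(k:ℤ):ℤ):ℂ) by
        rw [Nat.cast_add, Nat.cast_sub hy.le]; push_cast; field_simp; ring, E_add _ ((-(k:ℤ):ℤ):ℂ), E_int, mul_one]
    simp only [mul_assoc, h1, ← Finset.mul_sum, geom_E hc]
    have : c ∣ m + (c - y) ↔ m = y := by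
      constructor
      · rintro ⟨d, hd⟩
        have : d < 2 := by
          by_contra h
          have : c * 2 ≤ c * d := Nat.mul_le_mul_left _ (by omega)
          omega
        interval_cases d <;> omega
      · rintro rfl; exact ⟨1, by omega⟩
    simp [this]
  rw [Finset.sum_congr rfl this]
  rw [Finset.sum_ite_eq' ]
  simp [hy]
  field_simp

/-- Fourier expansion of `B1`. -/
lemma B1_fourier {c : ℕ} (hc : 0 < c) (y : ℕ) :
    (B1 ((y:ℝ)/c) : ℂ) = (1 / (c:ℂ)) * ∑ k ∈ Finset.range c,
      FT c (fun j => (B1 ((j:ℝ)/c) : ℂ)) k * E ((k:ℂ) * y / c) := by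
  have hc' : (c:ℂ) ≠ 0 := by exact_mod_cast hc.ne'
  have hcr : (c:ℝ) ≠ 0 := by exact_mod_cast hc.ne'
  have h1 : (B1 ((y:ℝ)/c) : ℂ) = (B1 (((y % c : ℕ):ℝ)/c) : ℂ) := by
    congr 1
    rw [← B1_add_nat (((y % c : ℕ):ℝ)/c) (y / c)]
    congr 1
    have : (y:ℝ) = (y % c : ℕ) + c * (y / c : ℕ) := by exact_mod_cast (Nat.mod_add_div y c).symm
    conv_lhs => rw [this]
    field_simp
  rw [h1, FT_inv hc (f := fun j => (B1 ((j:ℝ)/c) : ℂ)) (y % c) (Nat.mod_lt _ hc)]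
  congr 1
  refine Finset.sum_congr rfl fun k _ => ?_
  congr 1
  have : (y:ℂ) = (y % c : ℕ) + c * (y / c : ℕ) := by exact_mod_cast (Nat.mod_add_div y c).symm
  conv_rhs => rw [this]
  rw [show (k:ℂ) * (((y % c : ℕ):ℂ) + c * (y / c : ℕ)) / c = (k:ℂ) * ((y % c : ℕ):ℂ) / c + ((k * (y / c) : ℕ):ℂ) by
    push_cast; field_simp, E_add, E_nat, mul_one]

lemma LL_eq (c : ℕ) (f : ℕ → ℂ) :
    LL c f = ∑ k ∈ Finset.range c, FT c (fun j => (B1 ((j:ℝ)/c) : ℂ)) k * f k := by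
  simp only [LL, BB, FT, Finset.sum_mul]
  rw [Finset.sum_comm]
  refine Finset.sum_congr rfl fun k _ => Finset.sum_congr rfl fun m _ => ?_
  rw [show (k:ℂ) * m / c = (m:ℂ) * k / c by ring]
  ring

end

section
open Complex

lemma beta_eq {N k : ℕ} (hk : 0 < k) (hkN : k < N) :
    FT N (fun j => (B1 ((j:ℝ)/N) : ℂ)) k = Complex.I / 2 * Complex.cot (Real.pi * ((k:ℝ)/N : ℝ)) := by
  have hN : 0 < N := by omega
  have hN' : (N:ℂ) ≠ 0 := by exact_mod_cast hN.ne'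
  set z := E (-((k:ℂ)/N)) with hz
  have hzm : ∀ m : ℕ, E (-((k:ℂ) * m / N)) = z ^ m := by
    intro m; rw [hz, ← E_nat_mul]; congr 1; ring
  have hz1 : z ≠ 1 := by
    rw [hz, Ne, E_eq_one_iff]
    rintro ⟨n, hn⟩
    have : (k:ℂ) = ((-(n * N) : ℤ) : ℂ) := by
      push_cast; rw [← neg_mul, ← hn]; field_simp
    have h2 : (k:ℤ) = -(n * N) := by exact_mod_cast this
    have h3 : (N:ℤ) ∣ k := ⟨-n, by rw [h2]; ring⟩
    have := Nat.le_of_dvd hk (by exact_mod_cast h3)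
    omega
  have hzN : z ^ N = 1 := by
    rw [← hzm, show -((k:ℂ) * N / N) = ((-(k:ℤ) : ℤ):ℂ) by push_cast; field_simp, E_int]
  have hg : ∑ m ∈ Finset.range N, z ^ m = 0 := by
    rw [geom_sum_eq hz1, hzN]; simp
  have hs : ∀ n : ℕ, (z - 1) * ∑ m ∈ Finset.range n, (m:ℂ) * z ^ m = n * z ^ n - z * ∑ m ∈ Finset.range n, z ^ m := by
    intro n
    induction n with
    | zero => simp
    | succ n ih => rw [Finset.sum_range_succ, Finset.sum_range_succ, mul_add, ih]; push_cast; ring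
  have hs' : ∑ m ∈ Finset.range N, (m:ℂ) * z ^ m = N / (z - 1) := by
    have := hs N
    rw [hzN, hg] at this
    have h0 : z - 1 ≠ 0 := sub_ne_zero.2 hz1
    field_simp
    rw [mul_comm, this]; ring
  have h1 : FT N (fun j => (B1 ((j:ℝ)/N) : ℂ)) k = 1 / (z - 1) + 1 / 2 := by
    rw [FT]
    have : ∀ m ∈ Finset.range N, (B1 ((m:ℝ)/N) : ℂ) * E (-((k:ℂ) * m / N)) =
        ((m:ℂ) * z ^ m) / N - (1/2) * z ^ m + (if m = 0 then 1/2 else 0) := by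
      intro m hm
      rw [hzm, B1_nat (Finset.mem_range.1 hm)]
      split_ifs with h
      · subst h; simp
      · push_cast; ring
    rw [Finset.sum_congr rfl this, Finset.sum_add_distrib, Finset.sum_sub_distrib, ← Finset.sum_div, hs',
      ← Finset.mul_sum, hg, Finset.sum_ite_eq']
    simp [hN]
    field_simp
  rw [h1, Complex.cot_eq_exp_ratio]
  have h2 : Complex.exp (2 * Complex.I * (Real.pi * (((k:ℝ)/N : ℝ):ℂ))) = z⁻¹ := by
    rw [hz, E_neg, inv_inv, E]; congr 1; push_cast; ring
  have hz0 : z ≠ 0 := E_ne_zero _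
  have h3 : z - 1 ≠ 0 := sub_ne_zero.2 hz1
  rw [h2, show 1 - z⁻¹ = (z - 1)/z by field_simp]
  field_simp
  ring

lemma LL_char_ne_zero {N : ℕ} [NeZero N] (ρ : DirichletCharacter ℂ N) (hρ : ρ (-1) = -1) :
    LL N (fun k => ρ (k : ZMod N)) ≠ 0 := by
  have hodd : ρ.Odd := hρ
  have hρ1 : ρ ≠ 1 := by
    rintro rfl
    have h : IsUnit (-1 : ZMod N) := isUnit_one.neg
    rw [MulChar.one_apply h] at hρ
    norm_num at hρ
  have hN1 : N ≠ 1 := by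
    rintro rfl
    exact hρ1 (DirichletCharacter.level_one ρ)
  have h0 : ρ 0 = 0 := by
    haveI : Nontrivial (ZMod N) := ZMod.nontrivial_iff.2 hN1
    exact MulChar.map_zero ρ
  have hL := DirichletCharacter.LFunction_apply_one_ne_zero hρ1
  rw [DirichletCharacter.LFunction, ZMod.LFunction_def_odd hodd.to_fun, ← sum_zmod] at hL
  intro h
  apply hL
  rw [LL_eq] at h
  have key : ∀ j ∈ Finset.range N, ρ (j : ZMod N) * HurwitzZeta.hurwitzZetaOdd (ZMod.toAddCircle (j : ZMod N)) 1
      = (Real.pi / Complex.I) * (FT N (fun j => (B1 ((j:ℝ)/N) : ℂ)) j * ρ (j : ZMod N)) := by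
    intro j hj
    have hj := Finset.mem_range.1 hj
    rcases Nat.eq_zero_or_pos j with rfl | hj0
    · simp [h0]
    · have hN : (0:ℝ) < N := by exact_mod_cast NeZero.pos N
      rw [beta_eq hj0 hj]
      have : ZMod.toAddCircle (j : ZMod N) = (((j:ℝ)/N : ℝ) : UnitAddCircle) := by
        have := ZMod.toAddCircle_natCast (N := N) j
        simpa using this
      rw [this, hurwitzOdd_one (by positivity) (by rw [div_lt_one hN]; exact_mod_cast hj)]
      field_simp
  rw [Finset.sum_congr rfl key, ← Finset.mul_sum, h]
  simp

lemma std_E {N : ℕ} [NeZero N] (j : ℤ) : ZMod.stdAddChar (j : ZMod N) = E ((j:ℂ)/N) := by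
  rw [ZMod.stdAddChar_coe, E]; congr 1; ring

lemma gauss_ne_zero {N : ℕ} [NeZero N] {χ : DirichletCharacter ℂ N} (hχ : χ.IsPrimitive) :
    gaussSum χ ZMod.stdAddChar ≠ 0 := by
  intro h
  have : ZMod.dft (χ : ZMod N → ℂ) = 0 := by
    ext k
    rw [hχ.fourierTransform_eq_inv_mul_gaussSum, h]
    simp
  have h2 := (LinearEquiv.map_eq_zero_iff _).1 this
  have := congrFun h2 1
  simp at this

lemma gauss_range {N : ℕ} [NeZero N] {χ : DirichletCharacter ℂ N} (hχ : χ.IsPrimitive) (x : ℤ) :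
    ∑ a ∈ Finset.range N, χ (a : ZMod N) * E ((a:ℂ) * x / N) = χ⁻¹ (x : ZMod N) * gaussSum χ ZMod.stdAddChar := by
  rw [← gaussSum_mulShift_of_isPrimitive _ hχ, gaussSum, ← sum_zmod]
  refine Finset.sum_congr rfl fun a _ => ?_
  rw [AddChar.mulShift_apply]
  have := std_E (N := N) (x * a)
  push_cast at this
  rw [this]
  congr 2
  ring

/-- for primitive odd character `η`, the generalized Bernoulli number is nonzero -/
lemma BB_prim_ne_zero {N : ℕ} [NeZero N] {η : DirichletCharacter ℂ N} (hη : η.IsPrimitive) (ho : η (-1) = -1) :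
    BB N (fun k => η (k : ZMod N)) ≠ 0 := by
  have hi : (η⁻¹).IsPrimitive := by
    rw [DirichletCharacter.isPrimitive_def] at hη ⊢
    exact (DirichletCharacter.conductor_inv η).trans hη
  have hio : η⁻¹ (-1) = -1 := by
    rw [MulChar.inv_apply_eq_inv', ho]; norm_num
  have h := LL_char_ne_zero η⁻¹ hio
  have e : FT N (fun k => η⁻¹ (k : ZMod N)) = fun m : ℕ => (-gaussSum η⁻¹ ZMod.stdAddChar) * η (m : ZMod N) := by
    ext m
    rw [FT]
    have := gauss_range hi (-(m:ℤ))
    rw [inv_inv] at this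
    have h3 : η (((-(m:ℤ) : ℤ)) : ZMod N) = - η (m : ZMod N) := by
      push_cast
      rw [neg_eq_neg_one_mul, map_mul, ho]; ring
    rw [h3] at this
    rw [neg_mul, ← mul_neg, mul_comm, ← this]
    refine Finset.sum_congr rfl fun a _ => ?_
    congr 2
    push_cast; ring
  rw [LL, e, BB_const_mul] at h
  exact right_ne_zero_of_mul h

end

section
open Complex

/-- local weight `A [p^e₁ ∣ x] + B [p^e₂ ∣ x]` -/
noncomputable def WW (A B : ℕ → ℂ) (e₁ e₂ : ℕ → ℕ) (p x : ℕ) : ℂ :=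
  A p * (if p ^ e₁ p ∣ x then 1 else 0) + B p * (if p ^ e₂ p ∣ x then 1 else 0)

lemma WW_coprime {A B : ℕ → ℂ} {e₁ e₂ : ℕ → ℕ} {p y x : ℕ} (h : Nat.Coprime p y) :
    WW A B e₁ e₂ p (y * x) = WW A B e₁ e₂ p x := by
  have : ∀ e, p ^ e ∣ y * x ↔ p ^ e ∣ x := fun e =>
    ⟨fun hh => (Nat.Coprime.pow_left e h).dvd_of_dvd_mul_left hh, fun hh => Dvd.dvd.mul_left hh y⟩
  simp only [WW, this]

lemma WW_periodic {A B : ℕ → ℂ} {e₁ e₂ : ℕ → ℕ} {p c : ℕ} (h1 : p ^ e₁ p ∣ c) (h2 : p ^ e₂ p ∣ c) (x : ℕ) :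
    WW A B e₁ e₂ p (x + c) = WW A B e₁ e₂ p x := by
  simp only [WW, ← Nat.dvd_add_iff_left h1, ← Nat.dvd_add_iff_left h2]

lemma prod_per {c : ℕ} {f : ℕ → ℂ} (hper : Function.Periodic f c)
    {A B : ℕ → ℂ} {e₁ e₂ : ℕ → ℕ} (T : Finset ℕ)
    (h1 : ∀ p ∈ T, p ^ e₁ p ∣ c) (h2 : ∀ p ∈ T, p ^ e₂ p ∣ c) :
    Function.Periodic (fun x => f x * ∏ p ∈ T, WW A B e₁ e₂ p x) c := by
  intro x
  simp only [hper x]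
  congr 1
  exact Finset.prod_congr rfl fun p hp => WW_periodic (h1 p hp) (h2 p hp) x

lemma prod_mult {f : ℕ → ℂ} (hmul : ∀ x y, f (x * y) = f x * f y)
    {A B : ℕ → ℂ} {e₁ e₂ : ℕ → ℕ} (T : Finset ℕ) (hT : ∀ p ∈ T, p.Prime) {p : ℕ} (hp : p.Prime) (hpT : p ∉ T)
    (i x : ℕ) : f (p ^ i * x) * ∏ q ∈ T, WW A B e₁ e₂ q (p ^ i * x) = f (p ^ i) * (f x * ∏ q ∈ T, WW A B e₁ e₂ q x) := by
  rw [hmul, mul_assoc]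
  congr 2
  refine Finset.prod_congr rfl fun q hq => WW_coprime ?_
  refine Nat.Coprime.pow_right _ ((Nat.coprime_primes (hT q hq) hp).2 ?_)
  rintro rfl; exact hpT hq

lemma prod_functional {c : ℕ} (Θ : (ℕ → ℂ) → ℂ) (γ : ℕ → ℂ)
    (hadd : ∀ (a b : ℂ) (f g : ℕ → ℂ), Θ (fun x => a * f x + b * g x) = a * Θ f + b * Θ g)
    (hind : ∀ (e : ℕ) (f : ℕ → ℂ) (α : ℂ), e ∣ c → Function.Periodic f c → (∀ x, f (e * x) = α * f x) →
      Θ (fun j => if e ∣ j then f j else 0) = α * γ e * Θ f)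
    {f : ℕ → ℂ} (hmul : ∀ x y, f (x * y) = f x * f y) (hper : Function.Periodic f c)
    (A B : ℕ → ℂ) (e₁ e₂ : ℕ → ℕ) (T : Finset ℕ) (hT : ∀ p ∈ T, p.Prime)
    (h1 : ∀ p ∈ T, p ^ e₁ p ∣ c) (h2 : ∀ p ∈ T, p ^ e₂ p ∣ c) :
    Θ (fun x => f x * ∏ p ∈ T, WW A B e₁ e₂ p x) =
      (∏ p ∈ T, (A p * (f (p ^ e₁ p) * γ (p ^ e₁ p)) + B p * (f (p ^ e₂ p) * γ (p ^ e₂ p)))) * Θ f := by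
  classical
  induction T using Finset.induction_on with
  | empty => simp
  | insert p T hpT ih =>
    have hT' : ∀ q ∈ T, q.Prime := fun q hq => hT q (Finset.mem_insert_of_mem hq)
    have h1' : ∀ q ∈ T, q ^ e₁ q ∣ c := fun q hq => h1 q (Finset.mem_insert_of_mem hq)
    have h2' : ∀ q ∈ T, q ^ e₂ q ∣ c := fun q hq => h2 q (Finset.mem_insert_of_mem hq)
    have ih := ih hT' h1' h2'
    have hp := hT p (Finset.mem_insert_self _ _)
    set g : ℕ → ℂ := fun x => f x * ∏ p ∈ T, WW A B e₁ e₂ p x with hg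
    have hgp : Function.Periodic g c := prod_per hper T h1' h2'
    have hgm : ∀ i x, g (p ^ i * x) = f (p ^ i) * g x := fun i x => prod_mult hmul T hT' hp hpT i x
    have e : (fun x => f x * ∏ q ∈ insert p T, WW A B e₁ e₂ q x) =
        fun x => A p * (if p ^ e₁ p ∣ x then g x else 0) + B p * (if p ^ e₂ p ∣ x then g x else 0) := by
      ext x
      rw [Finset.prod_insert hpT]
      simp only [hg, WW]
      split_ifs <;> ring
    rw [e, hadd, hind _ g _ (h1 p (Finset.mem_insert_self _ _)) hgp (hgm _),
      hind _ g _ (h2 p (Finset.mem_insert_self _ _)) hgp (hgm _), ih, Finset.prod_insert hpT]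
    ring

lemma BB_lin (c : ℕ) (a b : ℂ) (f g : ℕ → ℂ) : BB c (fun x => a * f x + b * g x) = a * BB c f + b * BB c g := by
  rw [BB_add, BB_const_mul, BB_const_mul]

lemma LL_lin (c : ℕ) (a b : ℂ) (f g : ℕ → ℂ) : LL c (fun x => a * f x + b * g x) = a * LL c f + b * LL c g := by
  rw [LL_add, LL_const_mul, LL_const_mul]

lemma LL_ind' {f : ℕ → ℂ} {c e : ℕ} (hc : 0 < c) (hec : e ∣ c) (hf : Function.Periodic f c) {α : ℂ}
    (hα : ∀ x, f (e * x) = α * f x) :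
    LL c (fun j => if e ∣ j then f j else 0) = α * (1 / (e:ℂ)) * LL c f := by
  have he : (e:ℂ) ≠ 0 := by exact_mod_cast (Nat.pos_of_dvd_of_pos hec hc).ne'
  have := LL_ind hc hec hf hα
  field_simp
  linear_combination this

lemma BB_prod {c : ℕ} (hc : 0 < c) {f : ℕ → ℂ} (hmul : ∀ x y, f (x * y) = f x * f y) (hper : Function.Periodic f c)
    (A B : ℕ → ℂ) (e₁ e₂ : ℕ → ℕ) (T : Finset ℕ) (hT : ∀ p ∈ T, p.Prime)
    (h1 : ∀ p ∈ T, p ^ e₁ p ∣ c) (h2 : ∀ p ∈ T, p ^ e₂ p ∣ c) :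
    BB c (fun x => f x * ∏ p ∈ T, WW A B e₁ e₂ p x) =
      (∏ p ∈ T, (A p * f (p ^ e₁ p) + B p * f (p ^ e₂ p))) * BB c f := by
  have := prod_functional (c := c) (BB c) (fun _ => 1) (BB_lin c)
    (fun e f α hec hf hα => by rw [BB_ind hc hec hf hα, mul_one]) hmul hper A B e₁ e₂ T hT h1 h2
  simpa using this

lemma LL_prod {c : ℕ} (hc : 0 < c) {f : ℕ → ℂ} (hmul : ∀ x y, f (x * y) = f x * f y) (hper : Function.Periodic f c)
    (A B : ℕ → ℂ) (e₁ e₂ : ℕ → ℕ) (T : Finset ℕ) (hT : ∀ p ∈ T, p.Prime)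
    (h1 : ∀ p ∈ T, p ^ e₁ p ∣ c) (h2 : ∀ p ∈ T, p ^ e₂ p ∣ c) :
    LL c (fun x => f x * ∏ p ∈ T, WW A B e₁ e₂ p x) =
      (∏ p ∈ T, (A p * (f (p ^ e₁ p) * (1 / ((p ^ e₁ p : ℕ) : ℂ))) +
        B p * (f (p ^ e₂ p) * (1 / ((p ^ e₂ p : ℕ) : ℂ))))) * LL c f :=
  prod_functional (c := c) (LL c) (fun e => 1 / (e:ℂ)) (LL_lin c)
    (fun e f α hec hf hα => LL_ind' hc hec hf hα) hmul hper A B e₁ e₂ T hT h1 h2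

lemma char_per {N c : ℕ} (χ : DirichletCharacter ℂ N) (h : N ∣ c) :
    Function.Periodic (fun x : ℕ => χ (x : ZMod N)) c := by
  intro x
  simp only
  rw [Nat.cast_add, (ZMod.natCast_eq_zero_iff c N).2 h, add_zero]

lemma char_ne_zero_iff {N : ℕ} (χ : DirichletCharacter ℂ N) (x : ℕ) : χ (x : ZMod N) ≠ 0 ↔ Nat.Coprime x N := by
  rw [← ZMod.isUnit_iff_coprime]
  constructor
  · intro h; by_contra h2; exact h (χ.map_nonunit h2)
  · intro h; exact (h.map χ).ne_zero

lemma char_congr {N : ℕ} (χ : DirichletCharacter ℂ N) {x y M : ℕ} (h : x ≡ y [MOD M]) (hN : N ∣ M) :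
    χ (x : ZMod N) = χ (y : ZMod N) := by
  congr 1
  exact (ZMod.natCast_eq_natCast_iff _ _ _).2 (h.of_dvd hN)

/-- nonvanishing of generalized Bernoulli numbers of possibly imprimitive characters -/
lemma BB_char_ne_zero {L : ℕ} [NeZero L] (η : DirichletCharacter ℂ L) (ho : η (-1) = -1)
    (hp : ∀ p : ℕ, p.Prime → p ∣ L → η.primitiveCharacter (p : ZMod η.conductor) ≠ 1) :
    BB L (fun k => η (k : ZMod L)) ≠ 0 := by
  have hcond : η.conductor ∣ L := DirichletCharacter.conductor_dvd_level η
  have hL : 0 < L := NeZero.pos L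
  haveI : NeZero η.conductor := ⟨(Nat.pos_of_dvd_of_pos hcond hL).ne'⟩
  set ηs := η.primitiveCharacter with hηs
  have hval : ∀ a : ℤ, IsCoprime a (L:ℤ) → ηs (a : ZMod η.conductor) = η (a : ZMod L) := by
    intro a ha
    exact DirichletCharacter.primitiveCharacter_apply_of_isCoprime η ha
  have hso : ηs (-1) = -1 := by
    have := hval (-1) (by simpa using (isCoprime_one_left (x := (L:ℤ))).neg_left)
    push_cast at this
    rw [this, ho]
  have hprim : ηs.IsPrimitive := DirichletCharacter.primitiveCharacter_isPrimitive η
  have hB := BB_prim_ne_zero hprim hso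
  have hper0 := char_per ηs (dvd_refl η.conductor)
  have hper := char_per ηs hcond
  obtain ⟨e, he⟩ := hcond
  have he0 : 0 < e := by
    rcases Nat.eq_zero_or_pos e with h | h
    · rw [h] at he; omega
    · exact h
  have hBL : BB L (fun k : ℕ => ηs (k : ZMod η.conductor)) ≠ 0 := by
    have h2 := BB_enlarge hper0 he0
    rw [mul_comm, ← he] at h2
    rwa [h2]
  have key := BB_prod hL (f := fun k : ℕ => ηs (k : ZMod η.conductor)) (fun x y => by push_cast; rw [map_mul]) hper
    (fun _ => 1) (fun _ => -1) (fun _ => 0) (fun _ => 1) L.primeFactors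
    (fun p hp => Nat.prime_of_mem_primeFactors hp) (fun p hp => by simp)
    (fun p hp => by simpa using Nat.dvd_of_mem_primeFactors hp)
  have e2 : (fun k : ℕ => η (k : ZMod L)) = fun x : ℕ => ηs (x : ZMod η.conductor) *
      ∏ p ∈ L.primeFactors, WW (fun _ => 1) (fun _ => -1) (fun _ => 0) (fun _ => 1) p x := by
    ext x
    by_cases hx : Nat.Coprime x L
    · have := hval x (Nat.isCoprime_iff_coprime.2 hx)
      push_cast at this
      rw [this, Finset.prod_eq_one, mul_one]
      intro p hp
      have hpx : ¬ p ∣ x := fun h => (Nat.prime_of_mem_primeFactors hp).one_lt.ne'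
        (Nat.dvd_one.1 (hx ▸ Nat.dvd_gcd h (Nat.dvd_of_mem_primeFactors hp)))
      simp [WW, hpx]
    · have h0 : η (x : ZMod L) = 0 := by
        by_contra h; exact hx ((char_ne_zero_iff η x).1 h)
      obtain ⟨p, hp, h1, h2⟩ := Nat.Prime.not_coprime_iff_dvd.1 hx
      rw [h0, Finset.prod_eq_zero (Nat.mem_primeFactors.2 ⟨hp, h2, hL.ne'⟩), mul_zero]
      simp [WW, h1]
  rw [e2, key]
  refine mul_ne_zero (Finset.prod_ne_zero_iff.2 fun p hpp => ?_) hBL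
  have := hp p (Nat.prime_of_mem_primeFactors hpp) (Nat.dvd_of_mem_primeFactors hpp)
  simp only [pow_zero, pow_one, Nat.cast_one, map_one, one_mul]
  intro h
  apply this
  linear_combination -h

end

section
open Complex

lemma crt_sum {M P : ℕ} (hM : 0 < M) (hP : 0 < P) (hco : Nat.Coprime M P) (F : ℕ → ℂ)
    (hF : Function.Periodic F (M * P)) :
    ∑ a ∈ Finset.range (M * P), F a =
      ∑ u ∈ Finset.range M, ∑ v ∈ Finset.range P, F (u * P + v * M) := by
  have hMP : 0 < M * P := Nat.mul_pos hM hP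
  rw [← Finset.sum_product']
  symm
  have hmaps : ∀ x ∈ Finset.range M ×ˢ Finset.range P, (x.1 * P + x.2 * M) % (M * P) ∈ Finset.range (M * P) :=
    fun x _ => Finset.mem_range.2 (Nat.mod_lt _ hMP)
  have hinj : Set.InjOn (fun x : ℕ × ℕ => (x.1 * P + x.2 * M) % (M * P))
      ((Finset.range M ×ˢ Finset.range P : Finset (ℕ × ℕ)) : Set (ℕ × ℕ)) := by
    rintro ⟨u, v⟩ h1 ⟨u', v'⟩ h2 h
    simp only [Finset.coe_product, Set.mem_prod, Finset.coe_range, Set.mem_Iio] at h1 h2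
    have h : u * P + v * M ≡ u' * P + v' * M [MOD M * P] := h
    have a1 : u * P ≡ u' * P [MOD M] := by
      have := h.of_dvd (Dvd.intro _ rfl : M ∣ M * P)
      simpa [Nat.ModEq, Nat.add_mul_mod_self_right] using this
    have a2 : v * M ≡ v' * M [MOD P] := by
      have := h.of_dvd (Dvd.intro_left _ rfl : P ∣ M * P)
      simpa [Nat.ModEq, Nat.mul_add_mod_self_right] using this
    have b1 := Nat.ModEq.cancel_right_of_coprime (hco) a1
    have b2 := Nat.ModEq.cancel_right_of_coprime (hco.symm) a2
    have c1 := b1.eq_of_lt_of_lt h1.1 h2.1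
    have c2 := b2.eq_of_lt_of_lt h1.2 h2.2
    rw [c1, c2]
  refine Finset.sum_nbij (fun x : ℕ × ℕ => (x.1 * P + x.2 * M) % (M * P)) hmaps hinj ?_ ?_
  · exact Finset.surjOn_of_injOn_of_card_le _ hmaps hinj (by simp)
  · rintro ⟨u, v⟩ _
    exact (hF.map_mod_nat _).symm

lemma E_crt {M P : ℕ} (hM : 0 < M) (hP : 0 < P) (u v x : ℕ) :
    E (((u * P + v * M : ℕ) : ℂ) * x / ((M * P : ℕ))) = E ((u:ℂ) * x / M) * E ((v:ℂ) * x / P) := by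
  have hM' : (M:ℂ) ≠ 0 := by exact_mod_cast hM.ne'
  have hP' : (P:ℂ) ≠ 0 := by exact_mod_cast hP.ne'
  rw [← E_add]
  congr 1
  push_cast
  field_simp

lemma E_per {c : ℕ} (hc : 0 < c) (x : ℕ) : Function.Periodic (fun a : ℕ => E ((a:ℂ) * x / c)) c := by
  intro a
  have hc' : (c:ℂ) ≠ 0 := by exact_mod_cast hc.ne'
  simp only
  rw [show (((a + c : ℕ) : ℂ) * x / c) = (a:ℂ) * x / c + (x:ℕ) by push_cast; field_simp, E_add, E_nat, mul_one]

lemma geom_E_pos {e : ℕ} (he : 0 < e) (m : ℕ) :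
    ∑ i ∈ Finset.range e, E ((i:ℂ) * m / e) = if e ∣ m then (e:ℂ) else 0 := by
  have he' : (e:ℂ) ≠ 0 := by exact_mod_cast he.ne'
  have h := geom_E he (e * m - m)
  have hle : m ≤ e * m := Nat.le_mul_of_pos_left m he
  have hd : e ∣ (e * m - m) ↔ e ∣ m :=
    ⟨fun h => by
      have := Nat.dvd_sub (Dvd.intro m rfl) h
      rwa [Nat.sub_sub_self hle] at this, fun h => Nat.dvd_sub (Dvd.intro m rfl) h⟩
  simp only [hd] at h
  rw [← h]
  refine Finset.sum_congr rfl fun i _ => ?_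
  have e1 : -(((e * m - m : ℕ) : ℂ) * i / e) = (i:ℂ) * m / e + ((-((i * m : ℕ) : ℤ) : ℤ) : ℂ) := by
    rw [Nat.cast_sub hle]; push_cast; field_simp; ring
  rw [e1, E_add, E_int, mul_one]

noncomputable def RS (m x : ℕ) : ℂ := ∑ a ∈ Finset.range m, if Nat.Coprime a m then E ((a:ℂ) * x / m) else 0

lemma RS_prime {p k : ℕ} (hp : p.Prime) (hk : 0 < k) (x : ℕ) :
    RS (p ^ k) x = (p:ℂ) ^ k * (if p ^ k ∣ x then 1 else 0) + -(p:ℂ) ^ (k - 1) * (if p ^ (k - 1) ∣ x then 1 else 0) := by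
  obtain ⟨k, rfl⟩ : ∃ l, k = l + 1 := ⟨k - 1, by omega⟩
  have hpos : 0 < p ^ (k + 1) := pow_pos hp.pos _
  have hpos' : 0 < p ^ k := pow_pos hp.pos _
  have hp' : (p:ℂ) ≠ 0 := by exact_mod_cast hp.pos.ne'
  have h1 := geom_E_pos hpos x
  have h2 := sum_dvd (fun a => E ((a:ℂ) * x / ((p ^ (k + 1) : ℕ)))) hp.pos (p ^ k)
  have h3 := geom_E_pos hpos' x
  have e3 : ∀ a : ℕ, E (((p * a : ℕ) : ℂ) * x / ((p ^ (k + 1) : ℕ))) = E ((a:ℂ) * x / ((p ^ k : ℕ))) := by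
    intro a
    congr 1
    push_cast
    rw [pow_succ]
    field_simp
  simp only [e3] at h2
  rw [h3, ← pow_succ'] at h2
  have : RS (p ^ (k + 1)) x = (if p ^ (k + 1) ∣ x then ((p ^ (k + 1) : ℕ) : ℂ) else 0) - (if p ^ k ∣ x then ((p ^ k : ℕ) : ℂ) else 0) := by
    rw [← h1, ← h2, RS, ← Finset.sum_sub_distrib]
    refine Finset.sum_congr rfl fun a _ => ?_
    have : Nat.Coprime a (p ^ (k + 1)) ↔ ¬ p ∣ a := by
      rw [Nat.coprime_pow_right_iff (by omega), Nat.coprime_comm, hp.coprime_iff_not_dvd]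
    simp only [this]
    split_ifs <;> simp_all
  rw [this, Nat.add_sub_cancel]
  push_cast
  split_ifs <;> ring

lemma RS_mul {M P : ℕ} (hM : 0 < M) (hP : 0 < P) (hco : Nat.Coprime M P) (x : ℕ) :
    RS (M * P) x = RS M x * RS P x := by
  have hMP := Nat.mul_pos hM hP
  rw [RS, crt_sum hM hP hco, RS, RS, Finset.sum_mul_sum]
  · refine Finset.sum_congr rfl fun u _ => Finset.sum_congr rfl fun v _ => ?_
    rw [E_crt hM hP]
    have h1 : Nat.Coprime (u * P + v * M) M ↔ Nat.Coprime u M := by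
      rw [Nat.coprime_add_mul_right_left, Nat.coprime_mul_iff_left]
      exact and_iff_left hco.symm
    have h2 : Nat.Coprime (u * P + v * M) P ↔ Nat.Coprime v P := by
      rw [Nat.coprime_mul_right_add_left, Nat.coprime_mul_iff_left]
      exact and_iff_left hco
    simp only [Nat.coprime_mul_iff_right, h1, h2]
    split_ifs <;> simp_all
  · intro a
    have := E_per hMP x a
    simp only at this
    simp only [this, Nat.coprime_add_self_left]

/-- local Ramanujan weight -/
noncomputable def KK (m p x : ℕ) : ℂ :=
  WW (fun p => (p:ℂ) ^ m.factorization p) (fun p => -(p:ℂ) ^ (m.factorization p - 1))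
    (fun p => m.factorization p) (fun p => m.factorization p - 1) p x

lemma RS_eq (m : ℕ) : 0 < m → ∀ x, RS m x = ∏ p ∈ m.primeFactors, KK m p x := by
  induction m using Nat.recOnPosPrimePosCoprime with
  | zero => simp
  | one => intro _ x; simp [RS, E_zero]
  | prime_pow p n hp hn =>
    intro _ x
    rw [RS_prime hp hn, Nat.primeFactors_prime_pow hn.ne' hp, Finset.prod_singleton, KK, WW]
    simp [hp.factorization_self, Nat.factorization_pow]
  | coprime a b ha hb hab iha ihb =>
    intro _ x
    rw [RS_mul (by omega) (by omega) hab, iha (by omega), ihb (by omega), hab.primeFactors_mul,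
      Finset.prod_union hab.disjoint_primeFactors]
    congr 1
    · refine Finset.prod_congr rfl fun p hp => ?_
      have : (a * b).factorization p = a.factorization p := Nat.factorization_eq_of_coprime_left hab (Nat.mem_primeFactors_iff_mem_primeFactorsList.1 hp)
      simp only [KK, WW, this]
    · refine Finset.prod_congr rfl fun p hp => ?_
      have : (a * b).factorization p = b.factorization p := Nat.factorization_eq_of_coprime_right hab (Nat.mem_primeFactors_iff_mem_primeFactorsList.1 hp)
      simp only [KK, WW, this]

/-- twisted exponential sum -/
lemma K_formula {f m : ℕ} (hf : 0 < f) (hm : 0 < m) (hco : Nat.Coprime f m) {Φ : DirichletCharacter ℂ f}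
    (hΦ : Φ.IsPrimitive) : ∃ C : ℂ, C ≠ 0 ∧ ∀ x : ℕ,
    ∑ a ∈ Finset.range (f * m), (if Nat.Coprime a m then Φ (a : ZMod f) else 0) * E ((a:ℂ) * x / ((f * m : ℕ)))
      = C * (Φ⁻¹ (x : ZMod f) * ∏ p ∈ m.primeFactors, KK m p x) := by
  haveI : NeZero f := ⟨hf.ne'⟩
  refine ⟨Φ (m : ZMod f) * gaussSum Φ (ZMod.stdAddChar), mul_ne_zero ((char_ne_zero_iff _ _).2 hco.symm) (gauss_ne_zero hΦ), fun x => ?_⟩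
  rw [crt_sum hf hm hco]
  · have hg := gauss_range hΦ (x : ℤ)
    rw [← RS_eq m hm, RS]
    push_cast at hg
    have e1 : ∀ u v : ℕ, (if Nat.Coprime (u * m + v * f) m then Φ ((u * m + v * f : ℕ) : ZMod f) else 0) *
        E (((u * m + v * f : ℕ) : ℂ) * x / ((f * m : ℕ))) = Φ (m : ZMod f) * ((Φ (u : ZMod f) * E ((u:ℂ) * x / f)) *
          (if Nat.Coprime v m then E ((v:ℂ) * x / m) else 0)) := by
      intro u v
      have h2 : Nat.Coprime (u * m + v * f) m ↔ Nat.Coprime v m := by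
        rw [Nat.coprime_mul_right_add_left, Nat.coprime_mul_iff_left]
        exact and_iff_left hco
      have h3 : Φ ((u * m + v * f : ℕ) : ZMod f) = Φ (u : ZMod f) * Φ (m : ZMod f) := by
        push_cast
        rw [ZMod.natCast_self, mul_zero, add_zero, map_mul]
      rw [E_crt hf hm, h3]
      simp only [h2]
      split_ifs <;> ring
    simp only [e1, ← Finset.mul_sum]
    rw [← Finset.sum_mul, hg]
    ring
  · intro a
    have h1 := E_per (Nat.mul_pos hf hm) x a
    have h2 := char_per Φ (Dvd.intro m rfl : f ∣ f * m) a
    have h3 : Nat.Coprime (a + f * m) m ↔ Nat.Coprime a m := by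
      rw [Nat.coprime_add_mul_right_left]
    simp only at h1 h2
    simp only [h1, h2, h3]

end

section
open Complex

lemma conj_char {N : ℕ} (χ : DirichletCharacter ℂ N) (x : ZMod N) : (starRingEnd ℂ) (χ x) = χ⁻¹ x :=
  MulChar.star_apply' χ x

/-- inner sum over `n` -/
lemma inner_n {q₁ c : ℕ} [NeZero q₁] (hc : 0 < c) (hq : q₁ ∣ c) {χ₁ : DirichletCharacter ℂ q₁} (h₁ : χ₁.IsPrimitive)
    (a j : ℕ) :
    ∑ n ∈ Finset.range q₁, χ₁⁻¹ (n : ZMod q₁) * (B1 ((n : ℝ) / (q₁ : ℝ) + (a : ℝ) * (j : ℝ) / (c : ℝ)) : ℂ) =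
      (1 / (c:ℂ)) * gaussSum χ₁⁻¹ ZMod.stdAddChar * ∑ k ∈ Finset.range c, FT c (fun j => (B1 ((j:ℝ)/c) : ℂ)) k * 
        (χ₁ (k : ZMod q₁) * E ((a:ℂ) * (j * k : ℕ) / c)) := by
  obtain ⟨d, rfl⟩ := hq
  have hq0 : 0 < q₁ := NeZero.pos q₁
  have hd0 : 0 < d := Nat.pos_of_mul_pos_left hc
  have hqR : (q₁:ℝ) ≠ 0 := by exact_mod_cast hq0.ne'
  have hdR : (d:ℝ) ≠ 0 := by exact_mod_cast hd0.ne'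
  have hqC : (q₁:ℂ) ≠ 0 := by exact_mod_cast hq0.ne'
  have hdC : (d:ℂ) ≠ 0 := by exact_mod_cast hd0.ne'
  have e1 : ∀ n : ℕ, (n : ℝ) / (q₁ : ℝ) + (a : ℝ) * (j : ℝ) / ((q₁ * d : ℕ) : ℝ) = ((n * d + a * j : ℕ) : ℝ) / ((q₁ * d : ℕ)) := by
    intro n; push_cast; field_simp
  have e1' : ∀ n : ℕ, (B1 ((n : ℝ) / (q₁ : ℝ) + (a : ℝ) * (j : ℝ) / ((q₁ * d : ℕ) : ℝ)) : ℂ) =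
      (1 / ((q₁ * d : ℕ):ℂ)) * ∑ k ∈ Finset.range (q₁ * d),
      FT (q₁ * d) (fun j => (B1 ((j:ℝ)/((q₁ * d : ℕ) : ℝ)) : ℂ)) k * E ((k:ℂ) * ((n * d + a * j : ℕ)) / ((q₁ * d : ℕ))) := by
    intro n; rw [e1, B1_fourier hc]
  simp only [e1']
  have h1' : (χ₁⁻¹).IsPrimitive := by
    rw [DirichletCharacter.IsPrimitive, DirichletCharacter.conductor_inv]; exact h₁
  have hg := fun k : ℕ => gauss_range h1' (k : ℤ)
  simp only [inv_inv] at hg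
  have e2 : ∀ n k : ℕ, E ((k:ℂ) * ((n * d + a * j : ℕ)) / ((q₁ * d : ℕ))) =
      E ((n:ℂ) * (k:ℤ) / q₁) * E ((a:ℂ) * (j * k : ℕ) / ((q₁ * d : ℕ))) := by
    intro n k
    rw [← E_add]
    congr 1
    push_cast
    field_simp
  simp only [e2]
  simp only [Finset.mul_sum]
  rw [Finset.sum_comm]
  refine Finset.sum_congr rfl fun k _ => ?_
  have := hg k
  push_cast at this
  calc _ = (1 / ((q₁ * d : ℕ):ℂ)) * FT (q₁ * d) (fun j => (B1 ((j:ℝ)/((q₁ * d : ℕ))) : ℂ)) k * E ((a:ℂ) * (j * k : ℕ) / ((q₁ * d : ℕ)))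
        * ∑ n ∈ Finset.range q₁, χ₁⁻¹ (n : ZMod q₁) * E ((n:ℂ) * k / q₁) := by
        rw [Finset.mul_sum]
        refine Finset.sum_congr rfl fun n _ => ?_
        push_cast
        ring
    _ = _ := by rw [this]; ring

lemma ded_sum {q₁ q₂ f m : ℕ} (hq1 : 0 < q₁) (hf : 0 < f) (hm : 0 < m) (hco : Nat.Coprime f m) (hq : q₁ ∣ f * m)
    {χ₁ : DirichletCharacter ℂ q₁} (h₁ : χ₁.IsPrimitive) (χ₂ : DirichletCharacter ℂ q₂)
    {Φ : DirichletCharacter ℂ f} (hΦ : Φ.IsPrimitive) : ∃ C : ℂ, C ≠ 0 ∧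
    ∑ a ∈ Finset.range (f * m), (if Nat.Coprime a m then Φ (a : ZMod f) else 0) * ded χ₁ χ₂ a ((f * m : ℕ) : ℤ) =
     C * BB (f * m) (fun j => χ₂⁻¹ (j : ZMod q₂) * LL (f * m) (fun k => χ₁ (k : ZMod q₁) * (Φ⁻¹ ((j * k : ℕ) : ZMod f) *
       ∏ p ∈ m.primeFactors, KK m p (j * k)))) := by
  haveI : NeZero q₁ := ⟨hq1.ne'⟩
  obtain ⟨C, hC, hK⟩ := K_formula hf hm hco hΦ
  have hc : 0 < f * m := Nat.mul_pos hf hm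
  have hcC : ((f * m : ℕ) : ℂ) ≠ 0 := by exact_mod_cast hc.ne'
  have h1' : (χ₁⁻¹).IsPrimitive := by
    rw [DirichletCharacter.IsPrimitive, DirichletCharacter.conductor_inv]; exact h₁
  refine ⟨(1 / ((f * m : ℕ):ℂ)) * gaussSum χ₁⁻¹ ZMod.stdAddChar * C,
    mul_ne_zero (mul_ne_zero (one_div_ne_zero hcC) (gauss_ne_zero h1')) hC, ?_⟩
  generalize hcc : f * m = c at *
  have hded : ∀ a : ℕ, ded χ₁ χ₂ a (c : ℤ) = ∑ j ∈ Finset.range c, χ₂⁻¹ (j : ZMod q₂) * (B1 ((j:ℝ)/c) : ℂ) * 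
      ((1 / (c:ℂ)) * gaussSum χ₁⁻¹ ZMod.stdAddChar * ∑ k ∈ Finset.range c, FT c (fun j => (B1 ((j:ℝ)/c) : ℂ)) k * 
        (χ₁ (k : ZMod q₁) * E ((a:ℂ) * (j * k : ℕ) / c))) := by
    intro a
    rw [ded, Int.toNat_natCast]
    refine Finset.sum_congr rfl fun j _ => ?_
    rw [← inner_n hc hq h₁, Finset.mul_sum]
    refine Finset.sum_congr rfl fun n _ => ?_
    rw [conj_char, conj_char]
    push_cast
    ring
  simp only [hded, BB, Finset.mul_sum]
  rw [Finset.sum_comm]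
  refine Finset.sum_congr rfl fun j _ => ?_
  rw [LL_eq]
  rw [Finset.sum_comm]
  simp only [Finset.mul_sum, Finset.sum_mul]
  refine Finset.sum_congr rfl fun k _ => ?_
  have := hK (j * k)
  calc _ = χ₂⁻¹ (j : ZMod q₂) * (B1 ((j:ℝ)/c) : ℂ) * ((1 / (c:ℂ)) * gaussSum χ₁⁻¹ ZMod.stdAddChar) * 
      FT c (fun j => (B1 ((j:ℝ)/c) : ℂ)) k * χ₁ (k : ZMod q₁) * 
      ∑ a ∈ Finset.range c, (if Nat.Coprime a m then Φ (a : ZMod f) else 0) * E ((a:ℂ) * ((j * k : ℕ)) / c) := by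
        rw [Finset.mul_sum]
        refine Finset.sum_congr rfl fun a _ => ?_
        ring
    _ = _ := by rw [this]; ring

end

section
open Complex

/-- product of two Dirichlet characters at the lcm level -/
noncomputable def PC {a b : ℕ} (χ : DirichletCharacter ℂ a) (ψ : DirichletCharacter ℂ b) :
    DirichletCharacter ℂ (Nat.lcm a b) :=
  DirichletCharacter.changeLevel (Nat.dvd_lcm_left a b) χ * DirichletCharacter.changeLevel (Nat.dvd_lcm_right a b) ψ

lemma PC_nat {a b : ℕ} (χ : DirichletCharacter ℂ a) (ψ : DirichletCharacter ℂ b) (x : ℕ) :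
    PC χ ψ (x : ZMod (Nat.lcm a b)) = χ (x : ZMod a) * ψ (x : ZMod b) := by
  by_cases hx : Nat.Coprime x (Nat.lcm a b)
  · have hu : IsUnit (x : ZMod (Nat.lcm a b)) := (ZMod.isUnit_iff_coprime _ _).2 hx
    obtain ⟨u, hu⟩ := hu
    rw [PC, MulChar.mul_apply, ← hu, DirichletCharacter.changeLevel_eq_cast_of_dvd,
      DirichletCharacter.changeLevel_eq_cast_of_dvd, hu, ZMod.cast_natCast (Nat.dvd_lcm_left a b),
      ZMod.cast_natCast (Nat.dvd_lcm_right a b)]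
  · have h0 : PC χ ψ (x : ZMod (Nat.lcm a b)) = 0 := by
      by_contra h; exact hx ((char_ne_zero_iff _ x).1 h)
    rw [h0]
    by_contra h
    have h := Ne.symm h
    have h1 := (char_ne_zero_iff _ _).1 (left_ne_zero_of_mul h)
    have h2 := (char_ne_zero_iff _ _).1 (right_ne_zero_of_mul h)
    exact hx (Nat.Coprime.of_dvd_right (Nat.lcm_dvd_mul a b) (Nat.Coprime.mul_right h1 h2))

lemma PC_neg_one {a b : ℕ} (χ : DirichletCharacter ℂ a) (ψ : DirichletCharacter ℂ b) :
    PC χ ψ (-1) = χ (-1) * ψ (-1) := by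
  have h : (-1 : ZMod (Nat.lcm a b)) = ((-1 : (ZMod (Nat.lcm a b))ˣ) : ZMod (Nat.lcm a b)) := by simp
  rw [PC, MulChar.mul_apply, h, DirichletCharacter.changeLevel_eq_cast_of_dvd,
      DirichletCharacter.changeLevel_eq_cast_of_dvd]
  simp [ZMod.cast_neg, ZMod.cast_one, Nat.dvd_lcm_left a b, Nat.dvd_lcm_right a b]

lemma char_norm {N : ℕ} [NeZero N] (χ : DirichletCharacter ℂ N) {x : ℕ} (h : Nat.Coprime x N) : ‖χ (x : ZMod N)‖ = 1 := by
  obtain ⟨u, hu⟩ := (ZMod.isUnit_iff_coprime _ _).2 h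
  rw [← hu]
  exact DirichletCharacter.unit_norm_eq_one χ u

lemma LLrho_ne {a b c : ℕ} (hc : 0 < c) (ha : a ∣ c) (hb : b ∣ c) (χ : DirichletCharacter ℂ a) (ψ : DirichletCharacter ℂ b)
    (ho : χ (-1) * ψ (-1) = -1) : LL c (fun k => χ (k : ZMod a) * ψ (k : ZMod b)) ≠ 0 := by
  have hL : Nat.lcm a b ∣ c := Nat.lcm_dvd ha hb
  have hL0 : 0 < Nat.lcm a b := Nat.pos_of_dvd_of_pos hL hc
  haveI : NeZero (Nat.lcm a b) := ⟨hL0.ne'⟩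
  have h := LL_char_ne_zero (PC χ ψ) (by rw [PC_neg_one, ho])
  obtain ⟨e, he⟩ := hL
  have he0 : 0 < e := Nat.pos_of_mul_pos_left (he ▸ hc)
  have h2 := LL_enlarge hL0 (char_per (PC χ ψ) (dvd_refl _)) he0
  simp only [PC_nat] at h h2
  rw [mul_comm, ← he] at h2
  rw [h2]
  exact mul_ne_zero (by exact_mod_cast he0.ne') h

lemma BBeta_ne {a b c : ℕ} (hc : 0 < c) (ha : a ∣ c) (hb : b ∣ c) (χ : DirichletCharacter ℂ a) (ψ : DirichletCharacter ℂ b)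
    (ho : χ (-1) * ψ (-1) = -1)
    (hH : ∀ p : ℕ, p.Prime → p ∣ Nat.lcm a b → ∃ w : ℕ, Nat.Coprime w (Nat.lcm a b) ∧
      (w ≡ 1 [MOD c / p ^ c.factorization p] ∨ w ≡ p [MOD c / p ^ c.factorization p]) ∧
      χ (w : ZMod a) * ψ (w : ZMod b) ≠ 1) :
    BB c (fun k => χ (k : ZMod a) * ψ (k : ZMod b)) ≠ 0 := by
  have hL : Nat.lcm a b ∣ c := Nat.lcm_dvd ha hb
  have hL0 : 0 < Nat.lcm a b := Nat.pos_of_dvd_of_pos hL hc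
  haveI : NeZero (Nat.lcm a b) := ⟨hL0.ne'⟩
  have h := BB_char_ne_zero (PC χ ψ) (by rw [PC_neg_one, ho]) (by
    intro p hp hpL h1
    obtain ⟨w, hw, hw1, hw2⟩ := hH p hp hpL
    have hcop : Nat.Coprime p (PC χ ψ).conductor := (char_ne_zero_iff _ _).1 (by rw [h1]; exact one_ne_zero)
    have hgc : (PC χ ψ).conductor ∣ c := (DirichletCharacter.conductor_dvd_level _).trans hL
    have hg : (PC χ ψ).conductor ∣ c / p ^ c.factorization p := by
      rw [← Nat.ordProj_mul_ordCompl_eq_self c p] at hgc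
      exact (Nat.Coprime.pow_right _ hcop.symm).dvd_of_dvd_mul_left hgc
    have hv := DirichletCharacter.primitiveCharacter_apply_of_isCoprime (PC χ ψ) (Nat.isCoprime_iff_coprime.2 hw)
    push_cast at hv
    rw [PC_nat] at hv
    apply hw2
    rw [← hv]
    rcases hw1 with hw1 | hw1
    · rw [char_congr _ hw1 hg]; simp
    · rw [char_congr _ hw1 hg, h1])
  obtain ⟨e, he⟩ := hL
  have he0 : 0 < e := Nat.pos_of_mul_pos_left (he ▸ hc)
  have h2 := BB_enlarge (char_per (PC χ ψ) (dvd_refl _)) he0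
  simp only [PC_nat] at h h2
  rw [mul_comm, ← he] at h2
  rw [h2]
  exact h

lemma two_factor_ne {x y : ℂ} (hx : ‖x‖ = 1) (hy : ‖y‖ = 1) : x + (1 - x) * (y - 1) ≠ 0 := by
  intro h
  have h1 : (1 - x) * y = 1 - 2 * x := by linear_combination h
  have h2 : ‖1 - x‖ ^ 2 = ‖1 - 2 * x‖ ^ 2 := by
    rw [← h1, norm_mul, hy, mul_one]
  have h3 : ‖x‖ ^ 2 = 1 := by rw [hx]; norm_num
  rw [← Complex.normSq_eq_norm_sq, Complex.normSq_apply] at h2 h3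
  rw [← Complex.normSq_eq_norm_sq, Complex.normSq_apply] at h2
  simp at h2 h3
  have h4 : x.re ≤ 1 := by
    have := Complex.abs_re_le_norm x
    rw [hx] at this
    exact (abs_le.1 this).2
  nlinarith

end

section
open Complex

lemma BBg_ne {m c : ℕ} (hc : 0 < c) (hmc : m ∣ c) {η : ℕ → ℂ} (hmul : ∀ x y, η (x * y) = η x * η y)
    (hper : Function.Periodic η c) (T : Finset ℕ) (hT : T ⊆ m.primeFactors) (hn : ∀ p ∈ T, ‖η p‖ = 1) (h1 : η 1 = 1)
    (h0 : BB c η ≠ 0) : BB c (fun j => η j * ∏ p ∈ T, KK m p j) ≠ 0 := by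
  have hpow : ∀ p n : ℕ, η (p ^ n) = η p ^ n := by
    intro p n
    induction n with
    | zero => simpa using h1
    | succ n ih => rw [pow_succ, hmul, ih, pow_succ]
  have hm0 : m ≠ 0 := fun h => by rw [h] at hmc; simp at hmc; omega
  simp only [KK]
  rw [BB_prod hc hmul hper _ _ _ _ T (fun p hp => Nat.prime_of_mem_primeFactors (hT hp))
    (fun p hp => (Nat.ordProj_dvd m p).trans hmc) (fun p hp => ((pow_dvd_pow p (Nat.sub_le _ _)).trans (Nat.ordProj_dvd m p)).trans hmc)]
  refine mul_ne_zero (Finset.prod_ne_zero_iff.2 fun p hp => ?_) h0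
  have hpp := Nat.prime_of_mem_primeFactors (hT hp)
  have hv : 0 < m.factorization p := hpp.factorization_pos_of_dvd hm0 (Nat.dvd_of_mem_primeFactors (hT hp))
  obtain ⟨v, hv⟩ : ∃ v, m.factorization p = v + 1 := ⟨m.factorization p - 1, by omega⟩
  simp only [hv, Nat.add_sub_cancel, hpow]
  have hη : η p ≠ 0 := by rw [← norm_pos_iff, hn p hp]; norm_num
  have hp0 : (p:ℂ) ≠ 0 := by exact_mod_cast hpp.pos.ne'
  have : (p:ℂ) ^ (v + 1) * η p ^ (v + 1) + -(p:ℂ) ^ v * η p ^ v = (p:ℂ) ^ v * η p ^ v * (p * η p - 1) := by ring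
  rw [this]
  refine mul_ne_zero (mul_ne_zero (pow_ne_zero _ hp0) (pow_ne_zero _ hη)) ?_
  intro h
  have h2 : ‖(p:ℂ) * η p‖ = 1 := by rw [sub_eq_zero.1 h]; simp
  rw [norm_mul, hn p hp, Complex.norm_natCast, mul_one] at h2
  have := hpp.one_lt
  have h3 : p = 1 := by exact_mod_cast h2
  omega

lemma LLh_ne {m c : ℕ} (hc : 0 < c) (hmc : m ∣ c) {ρ : ℕ → ℂ} (hmul : ∀ x y, ρ (x * y) = ρ x * ρ y)
    (hper : Function.Periodic ρ c) (T : Finset ℕ) (hT : T ⊆ m.primeFactors) (hn : ∀ p ∈ T, ρ p ≠ 0 ∧ ρ p ≠ 1) (h1 : ρ 1 = 1)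
    (h0 : LL c ρ ≠ 0) : LL c (fun j => ρ j * ∏ p ∈ T, KK m p j) ≠ 0 := by
  have hpow : ∀ p n : ℕ, ρ (p ^ n) = ρ p ^ n := by
    intro p n
    induction n with
    | zero => simpa using h1
    | succ n ih => rw [pow_succ, hmul, ih, pow_succ]
  have hm0 : m ≠ 0 := fun h => by rw [h] at hmc; simp at hmc; omega
  simp only [KK]
  rw [LL_prod hc hmul hper _ _ _ _ T (fun p hp => Nat.prime_of_mem_primeFactors (hT hp))
    (fun p hp => (Nat.ordProj_dvd m p).trans hmc) (fun p hp => ((pow_dvd_pow p (Nat.sub_le _ _)).trans (Nat.ordProj_dvd m p)).trans hmc)]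
  refine mul_ne_zero (Finset.prod_ne_zero_iff.2 fun p hp => ?_) h0
  have hpp := Nat.prime_of_mem_primeFactors (hT hp)
  have hv : 0 < m.factorization p := hpp.factorization_pos_of_dvd hm0 (Nat.dvd_of_mem_primeFactors (hT hp))
  obtain ⟨v, hv⟩ : ∃ v, m.factorization p = v + 1 := ⟨m.factorization p - 1, by omega⟩
  simp only [hv, Nat.add_sub_cancel, hpow]
  have hp0 : (p:ℂ) ≠ 0 := by exact_mod_cast hpp.pos.ne'
  have : (p:ℂ) ^ (v + 1) * (ρ p ^ (v + 1) * (1 / ((p ^ (v + 1) : ℕ) : ℂ))) + -(p:ℂ) ^ v * (ρ p ^ v * (1 / ((p ^ v : ℕ) : ℂ))) =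
      ρ p ^ v * (ρ p - 1) := by push_cast; field_simp; ring
  rw [this]
  exact mul_ne_zero (pow_ne_zero _ (hn p hp).1) (sub_ne_zero.2 (hn p hp).2)

lemma X_core {m c : ℕ} (hc : 0 < c) {g h : ℕ → ℂ} (hgp : Function.Periodic g c) (hhp : Function.Periodic h c)
    (hg : BB c g ≠ 0) (hh : LL c h ≠ 0) (Td : Finset ℕ)
    (hTd : Td = ∅ ∨ (Td = {2} ∧ m.factorization 2 = 1 ∧ 2 ∣ c ∧ ∃ x y : ℂ, ‖x‖ = 1 ∧ ‖y‖ = 1 ∧ 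
      (∀ z, g (2 * z) = x * g z) ∧ (∀ z, h (2 * z) = y * h z))) :
    BB c (fun j => LL c (fun k => g j * (h k * ∏ p ∈ Td, KK m p (j * k)))) ≠ 0 := by
  rcases hTd with rfl | ⟨rfl, hm, h2c, x, y, hx, hy, hgx, hhy⟩
  · simp only [Finset.prod_empty, mul_one, LL_const_mul]
    simp only [mul_comm _ (LL c h), BB_const_mul]
    exact mul_ne_zero hh hg
  · have e1 : ∀ j k : ℕ, g j * (h k * ∏ p ∈ ({2} : Finset ℕ), KK m p (j * k)) =
        (if 2 ∣ j then g j else 0) * h k + (g j - (if 2 ∣ j then g j else 0)) * (2 * (if 2 ∣ k then h k else 0) + (-1) * h k) := by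
      intro j k
      rw [Finset.prod_singleton, KK, WW]
      simp only [hm, Nat.prime_two.dvd_mul, Nat.sub_self, pow_zero, pow_one, isUnit_one, IsUnit.dvd]
      by_cases h1 : 2 ∣ j
      · simp only [h1, true_or, if_true]; ring
      · by_cases h3 : 2 ∣ k
        · simp only [h1, h3, or_true, if_true, if_false]; ring
        · simp [h1, h3]
    simp only [e1]
    have e2 : LL c (fun k => 2 * (if 2 ∣ k then h k else 0) + (-1) * h k) = (y - 1) * LL c h := by
      rw [LL_lin c 2 (-1) (fun k => if 2 ∣ k then h k else 0) h, LL_ind' hc h2c hhp hhy]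
      push_cast
      ring
    have e3 : ∀ j, LL c (fun k => (if 2 ∣ j then g j else 0) * h k + (g j - (if 2 ∣ j then g j else 0)) * (2 * (if 2 ∣ k then h k else 0) + (-1) * h k)) =
        (LL c h * (1 - (y - 1))) * (if 2 ∣ j then g j else 0) + (LL c h * (y - 1)) * g j := by
      intro j
      rw [LL_lin c _ _ h (fun k => 2 * (if 2 ∣ k then h k else 0) + (-1) * h k), e2]
      ring
    simp only [e3]
    rw [BB_lin c _ _ (fun j => if 2 ∣ j then g j else 0) g, BB_ind hc h2c hgp hgx]
    have : LL c h * (1 - (y - 1)) * (x * BB c g) + LL c h * (y - 1) * BB c g = LL c h * BB c g * (x + (1 - x) * (y - 1)) := by ring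
    rw [this]
    exact mul_ne_zero (mul_ne_zero hh hg) (two_factor_ne hx hy)

lemma X_ne {m c : ℕ} (hc : 0 < c) (hmc : m ∣ c) {η ρ : ℕ → ℂ} 
    (hmη : ∀ x y, η (x * y) = η x * η y) (hpη : Function.Periodic η c) (h1η : η 1 = 1) (hBη : BB c η ≠ 0)
    (hmρ : ∀ x y, ρ (x * y) = ρ x * ρ y) (hpρ : Function.Periodic ρ c) (h1ρ : ρ 1 = 1) (hLρ : LL c ρ ≠ 0)
    (Tb Tc Td : Finset ℕ) (hb : Tb ⊆ m.primeFactors) (hcc : Tc ⊆ m.primeFactors)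
    (hTb : ∀ p ∈ Tb, ρ p ≠ 0 ∧ ρ p ≠ 1) (hTc : ∀ p ∈ Tc, ‖η p‖ = 1)
    (hTd : Td = ∅ ∨ (Td = {2} ∧ m.factorization 2 = 1 ∧ 2 ∉ Tb ∧ 2 ∉ Tc ∧ ‖η 2‖ = 1 ∧ ‖ρ 2‖ = 1)) :
    BB c (fun j => LL c (fun k => (η j * ∏ p ∈ Tc, KK m p j) * ((ρ k * ∏ p ∈ Tb, KK m p k) * ∏ p ∈ Td, KK m p (j * k)))) ≠ 0 := by
  have hBg := BBg_ne hc hmc hmη hpη Tc hcc hTc h1η hBη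
  have hLh := LLh_ne hc hmc hmρ hpρ Tb hb hTb h1ρ hLρ
  have hd1 : ∀ p : ℕ, p ^ m.factorization p ∣ c := fun p => (Nat.ordProj_dvd m p).trans hmc
  have hd2 : ∀ p : ℕ, p ^ (m.factorization p - 1) ∣ c := fun p => 
    ((pow_dvd_pow p (Nat.sub_le _ _)).trans (Nat.ordProj_dvd m p)).trans hmc
  have hgp : Function.Periodic (fun j => η j * ∏ p ∈ Tc, KK m p j) c := prod_per hpη Tc (fun p _ => hd1 p) (fun p _ => hd2 p)
  have hhp : Function.Periodic (fun j => ρ j * ∏ p ∈ Tb, KK m p j) c := prod_per hpρ Tb (fun p _ => hd1 p) (fun p _ => hd2 p)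
  refine X_core hc hgp hhp hBg hLh Td ?_
  rcases hTd with h | ⟨h, hm, h2b, h2c, hη, hρ⟩
  · exact Or.inl h
  · refine Or.inr ⟨h, hm, ?_, η 2, ρ 2, hη, hρ, ?_, ?_⟩
    · have := hd1 2
      rwa [hm, pow_one] at this
    · intro z
      simpa [KK] using prod_mult hmη Tc (fun p hp => Nat.prime_of_mem_primeFactors (hcc hp)) Nat.prime_two h2c 1 z
    · intro z
      simpa [KK] using prod_mult hmρ Tb (fun p hp => Nat.prime_of_mem_primeFactors (hb hp)) Nat.prime_two h2b 1 z

lemma char_inv_norm {N : ℕ} (χ : DirichletCharacter ℂ N) (x : ZMod N) : χ⁻¹ x = (χ x)⁻¹ := MulChar.inv_apply_eq_inv' χ x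

lemma mainI {q₁ q₂ f m c : ℕ} (hq1 : 0 < q₁) (hq2 : 0 < q₂) (hf : 0 < f) (hm : 0 < m) (hco : Nat.Coprime f m) (hcfm : c = f * m)
    (hqc : q₁ * q₂ ∣ c)
    {χ₁ : DirichletCharacter ℂ q₁} (h₁ : χ₁.IsPrimitive) (χ₂ : DirichletCharacter ℂ q₂)
    (hpar : χ₁ (-1) * χ₂ (-1) = 1)
    {Φ : DirichletCharacter ℂ f} (hΦ : Φ.IsPrimitive)
    (hP : χ₂ (-1) * Φ (-1) = -1)
    (hii : ∀ p ∈ m.primeFactors, p ∣ q₁ → ¬ p ∣ q₂)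
    (hiii : ∀ p ∈ m.primeFactors, ¬ p ∣ q₁ → ¬ p ∣ q₂ → p = 2 ∧ m.factorization 2 = 1)
    (hiv : ∀ p ∈ m.primeFactors, p ∣ q₂ → Φ (p : ZMod f) ≠ χ₁ (p : ZMod q₁))
    (hH : ∀ p : ℕ, p.Prime → (p ∣ q₂ ∨ p ∣ f) → ∃ w : ℕ, Nat.Coprime w q₂ ∧ Nat.Coprime w f ∧
      (w ≡ 1 [MOD c / p ^ c.factorization p] ∨ w ≡ p [MOD c / p ^ c.factorization p]) ∧
      χ₂ (w : ZMod q₂) * Φ (w : ZMod f) ≠ 1) :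
    ∃ a : ℕ, Nat.Coprime a c ∧ ded χ₁ χ₂ a c ≠ 0 := by
  classical
  have hc : 0 < c := hcfm ▸ Nat.mul_pos hf hm
  have hfc : f ∣ c := ⟨m, hcfm⟩
  have hmc : m ∣ c := ⟨f, by rw [hcfm, mul_comm]⟩
  have hq1c : q₁ ∣ c := (Dvd.intro _ rfl).trans hqc
  have hq2c : q₂ ∣ c := (Dvd.intro_left _ rfl).trans hqc
  haveI : NeZero f := ⟨hf.ne'⟩
  haveI : NeZero q₁ := ⟨hq1.ne'⟩
  haveI : NeZero q₂ := ⟨hq2.ne'⟩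
  obtain ⟨C, hC, hsum⟩ := ded_sum hq1 hf hm hco (hcfm ▸ hq1c) h₁ χ₂ hΦ
  rw [← hcfm] at hsum
  set η : ℕ → ℂ := fun j => χ₂⁻¹ (j : ZMod q₂) * Φ⁻¹ (j : ZMod f) with hη
  set ρ : ℕ → ℂ := fun j => χ₁ (j : ZMod q₁) * Φ⁻¹ (j : ZMod f) with hρ
  have hpf : ∀ p ∈ m.primeFactors, Nat.Coprime p f := fun p hp => 
    (Nat.Coprime.coprime_dvd_right (Nat.dvd_of_mem_primeFactors hp) hco).symm
  have hcopr : ∀ p ∈ m.primeFactors, ∀ q, ¬ p ∣ q → Nat.Coprime p q := fun p hp q h => 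
    ((Nat.prime_of_mem_primeFactors hp).coprime_iff_not_dvd).2 h
  have hsq : χ₂ (-1) * χ₂ (-1) = 1 := by rw [← map_mul]; simp
  have hsqΦ : Φ (-1) * Φ (-1) = 1 := by rw [← map_mul]; simp
  have hΦi : Φ⁻¹ (-1) = Φ (-1) := by rw [char_inv_norm]; exact inv_eq_of_mul_eq_one_right hsqΦ
  have hχi : χ₂⁻¹ (-1) = χ₂ (-1) := by rw [char_inv_norm]; exact inv_eq_of_mul_eq_one_right hsq
  have hBη : BB c η ≠ 0 := by
    refine BBeta_ne hc hq2c hfc _ _ (by rw [hΦi, hχi, hP]) ?_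
    intro p hp hpL
    have : p ∣ q₂ ∨ p ∣ f := (Nat.Prime.dvd_mul hp).1 (hpL.trans (Nat.lcm_dvd_mul _ _))
    obtain ⟨w, h1, h2, h3, h4⟩ := hH p hp this
    refine ⟨w, Nat.Coprime.of_dvd_right (Nat.lcm_dvd_mul _ _) (Nat.Coprime.mul_right h1 h2), h3, ?_⟩
    rw [char_inv_norm, char_inv_norm, ← mul_inv]
    exact fun h => h4 (inv_eq_one.1 h)
  have hLρ : LL c ρ ≠ 0 := by
    refine LLrho_ne hc hq1c hfc _ _ ?_
    rw [hΦi]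
    have : χ₁ (-1) = χ₂ (-1) := by linear_combination χ₂ (-1) * hpar - χ₁ (-1) * hsq
    rw [this, hP]
  set T := m.primeFactors with hT
  set Tb := T.filter (fun p => p ∣ q₂) with hTb
  set Tc := T.filter (fun p => p ∣ q₁) with hTc
  set Td := T.filter (fun p => ¬ p ∣ q₁ ∧ ¬ p ∣ q₂) with hTd
  have hηn : ∀ p ∈ T, ¬ p ∣ q₂ → ‖η p‖ = 1 := by
    intro p hp h
    simp only [hη]
    rw [norm_mul, char_norm _ (hcopr p hp _ h), char_norm _ (hpf p hp), mul_one]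
  have hρn : ∀ p ∈ T, ¬ p ∣ q₁ → ‖ρ p‖ = 1 := by
    intro p hp h
    simp only [hρ]
    rw [norm_mul, char_norm _ (hcopr p hp _ h), char_norm _ (hpf p hp), mul_one]
  have hX := X_ne (m := m) hc hmc (η := η) (ρ := ρ) (fun x y => by simp only [hη]; push_cast; rw [map_mul, map_mul]; ring)
    ((char_per χ₂⁻¹ hq2c).mul (char_per Φ⁻¹ hfc)) (by simp [hη]) hBη
    (fun x y => by simp only [hρ]; push_cast; rw [map_mul, map_mul]; ring)
    ((char_per χ₁ hq1c).mul (char_per Φ⁻¹ hfc)) (by simp [hρ]) hLρ Tb Tc Td (Finset.filter_subset _ _) (Finset.filter_subset _ _)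
    (by
      intro p hp
      obtain ⟨hp, hp2⟩ := Finset.mem_filter.1 hp
      have hp1 : ¬ p ∣ q₁ := fun h => hii p hp h hp2
      refine ⟨by rw [← norm_pos_iff, hρn p hp hp1]; norm_num, ?_⟩
      intro h
      apply hiv p hp hp2
      have h0 : Φ (p : ZMod f) ≠ 0 := (char_ne_zero_iff _ _).2 (hpf p hp)
      simp only [hρ] at h
      rw [char_inv_norm] at h
      field_simp at h
      exact h.symm)
    (by
      intro p hp
      obtain ⟨hp, hp2⟩ := Finset.mem_filter.1 hp
      exact hηn p hp (hii p hp hp2))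
    (by
      by_cases h : Td = ∅
      · exact Or.inl h
      · obtain ⟨p, hp⟩ := Finset.nonempty_iff_ne_empty.2 h
        obtain ⟨hpT, hp1, hp2⟩ := Finset.mem_filter.1 hp
        obtain ⟨rfl, hm2⟩ := hiii p hpT hp1 hp2
        refine Or.inr ⟨?_, hm2, ?_, ?_, hηn 2 hpT hp2, hρn 2 hpT hp1⟩
        · ext r
          rw [Finset.mem_singleton]
          constructor
          · intro hr
            obtain ⟨hpT, hp1, hp2⟩ := Finset.mem_filter.1 hr
            exact (hiii r hpT hp1 hp2).1
          · rintro rfl; exact hp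
        · intro h; exact hp2 (Finset.mem_filter.1 h).2
        · intro h; exact hp1 (Finset.mem_filter.1 h).2)
  have hXeq : BB c (fun j => χ₂⁻¹ (j : ZMod q₂) * LL c (fun k => χ₁ (k : ZMod q₁) * (Φ⁻¹ ((j * k : ℕ) : ZMod f) *
       ∏ p ∈ T, KK m p (j * k)))) = BB c (fun j => LL c (fun k => (η j * ∏ p ∈ Tc, KK m p j) * ((ρ k * ∏ p ∈ Tb, KK m p k) * ∏ p ∈ Td, KK m p (j * k)))) := by
    congr 1
    ext j
    rw [← LL_const_mul]
    congr 1
    ext k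
    have hsplit : ∀ F : ℕ → ℂ, ∏ p ∈ T, F p = (∏ p ∈ Tc, F p) * ((∏ p ∈ Tb, F p) * ∏ p ∈ Td, F p) := by
      intro F
      rw [← Finset.prod_union, ← Finset.prod_union]
      · congr 1
        ext p
        simp only [hTc, hTb, hTd, Finset.mem_union, Finset.mem_filter]
        tauto
      · rw [Finset.disjoint_left]
        intro p hp
        simp only [hTc, hTb, hTd, Finset.mem_union, Finset.mem_filter] at hp ⊢
        have := hii p hp.1 hp.2
        tauto
      · rw [Finset.disjoint_left]
        intro p hp
        simp only [hTb, hTd, Finset.mem_filter] at hp ⊢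
        tauto
    rw [hsplit]
    by_cases hj : χ₂⁻¹ (j : ZMod q₂) = 0
    · simp only [hη, hj]; ring
    by_cases hk : χ₁ (k : ZMod q₁) = 0
    · simp only [hρ, hk]; ring
    have e1 : ∏ p ∈ Tc, KK m p (j * k) = ∏ p ∈ Tc, KK m p j := by
      refine Finset.prod_congr rfl fun p hp => ?_
      obtain ⟨hpT, hp1⟩ := Finset.mem_filter.1 hp
      rw [mul_comm]
      exact WW_coprime (Nat.Coprime.of_dvd_left hp1 ((char_ne_zero_iff _ _).1 hk).symm)
    have e2 : ∏ p ∈ Tb, KK m p (j * k) = ∏ p ∈ Tb, KK m p k := by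
      refine Finset.prod_congr rfl fun p hp => ?_
      obtain ⟨hpT, hp1⟩ := Finset.mem_filter.1 hp
      exact WW_coprime (Nat.Coprime.of_dvd_left hp1 ((char_ne_zero_iff _ _).1 hj).symm)
    rw [e1, e2]
    simp only [hη, hρ]
    push_cast
    rw [map_mul]
    ring
  rw [hXeq] at hsum
  have hne := mul_ne_zero hC hX
  rw [← hsum] at hne
  obtain ⟨a, _, ha⟩ := Finset.exists_ne_zero_of_sum_ne_zero hne
  have ha1 := left_ne_zero_of_mul ha
  have ha2 := right_ne_zero_of_mul ha
  refine ⟨a, ?_, by exact_mod_cast ha2⟩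
  split_ifs at ha1 with h
  · rw [hcfm]
    exact Nat.Coprime.mul_right ((char_ne_zero_iff _ _).1 ha1) h
  · exact absurd rfl ha1

end

section
open Complex

/-- CRT representative: `≡ x` mod `p`-part of `c`, `≡ y` mod the rest. -/
noncomputable def crt (c p x y : ℕ) : ℕ :=
  if h : Nat.Coprime (p ^ c.factorization p) (c / p ^ c.factorization p) then Nat.chineseRemainder h x y else 0

lemma cop_ord {c p : ℕ} (hp : p.Prime) (hc : c ≠ 0) : Nat.Coprime (p ^ c.factorization p) (c / p ^ c.factorization p) :=
  Nat.Coprime.pow_left _ (Nat.coprime_ordCompl hp hc)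

lemma crt_left {c p : ℕ} (hp : p.Prime) (hc : c ≠ 0) (x y : ℕ) : crt c p x y ≡ x [MOD p ^ c.factorization p] := by
  rw [crt, dif_pos (cop_ord hp hc)]
  exact (Nat.chineseRemainder (cop_ord hp hc) x y).2.1

lemma crt_right {c p : ℕ} (hp : p.Prime) (hc : c ≠ 0) (x y : ℕ) : crt c p x y ≡ y [MOD c / p ^ c.factorization p] := by
  rw [crt, dif_pos (cop_ord hp hc)]
  exact (Nat.chineseRemainder (cop_ord hp hc) x y).2.2

lemma cop_of_modEq {a b n : ℕ} (h : a ≡ b [MOD n]) (hb : Nat.Coprime b n) : Nat.Coprime a n := by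
  rw [Nat.Coprime, h.gcd_eq]; exact hb

lemma prim_crit {n : ℕ} [NeZero n] (χ : DirichletCharacter ℂ n) (h : ∀ p : ℕ, p.Prime → p ∣ n →
    ∃ u : ℕ, Nat.Coprime u n ∧ u ≡ 1 [MOD n / p] ∧ χ (u : ZMod n) ≠ 1) : χ.IsPrimitive := by
  by_contra hne
  have hd := DirichletCharacter.conductor_dvd_level χ
  have hn := NeZero.pos n
  obtain ⟨e, he⟩ := hd
  have he1 : e ≠ 1 := by rintro rfl; rw [mul_one] at he; exact hne he.symm
  have hp := Nat.minFac_prime he1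
  set p := e.minFac
  obtain ⟨e', he'⟩ := Nat.minFac_dvd e
  have hdp : χ.conductor ∣ n / p := by
    refine ⟨e', Nat.div_eq_of_eq_mul_left hp.pos ?_⟩
    rw [mul_assoc, mul_comm e' p, ← he', ← he]
  obtain ⟨u, hu1, hu2, hu3⟩ := h p hp (by rw [he, he']; exact Dvd.dvd.mul_left (Dvd.intro _ rfl) _)
  apply hu3
  have hv := DirichletCharacter.primitiveCharacter_apply_of_isCoprime χ (Nat.isCoprime_iff_coprime.2 hu1)
  push_cast at hv
  rw [← hv, char_congr _ hu2 hdp]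
  simp

lemma prim_exists {n : ℕ} [NeZero n] {χ : DirichletCharacter ℂ n} (hχ : χ.IsPrimitive) {p : ℕ} (hp : p.Prime) (hpn : p ∣ n) :
    ∃ u : ℕ, Nat.Coprime u n ∧ u ≡ 1 [MOD n / p] ∧ χ (u : ZMod n) ≠ 1 := by
  by_contra hcon
  push Not at hcon
  have hn := NeZero.pos n
  have hd : n / p ∣ n := Nat.div_dvd_of_dvd hpn
  haveI : NeZero (n / p) := ⟨(Nat.pos_of_dvd_of_pos hd hn).ne'⟩
  have hfac : χ.FactorsThrough (n / p) := by
    rw [DirichletCharacter.factorsThrough_iff_ker_unitsMap hd]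
    intro u hu
    rw [MonoidHom.mem_ker] at hu ⊢
    have hu' : ((u : ZMod n).cast : ZMod (n / p)) = 1 := by
      have := congrArg Units.val hu
      simpa [ZMod.unitsMap_def] using this
    have := hcon (u : ZMod n).val ((ZMod.isUnit_iff_coprime _ _).1 (by rw [ZMod.natCast_zmod_val]; exact u.isUnit)) (by
      rw [← ZMod.natCast_eq_natCast_iff, ZMod.natCast_val, hu', Nat.cast_one])
    rw [ZMod.natCast_zmod_val] at this
    ext
    simpa using this
  have h1 : χ.conductor ∣ n / p := by
    rw [← DirichletCharacter.mem_conductorSet_iff_conductor_dvd χ hd]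
    exact hfac
  rw [hχ] at h1
  have := Nat.le_of_dvd (Nat.pos_of_dvd_of_pos hd hn) h1
  exact absurd (Nat.div_lt_self hn hp.one_lt) (by omega)

lemma neg_one_cast {N c : ℕ} (hc : 0 < c) (h : N ∣ c) : ((c - 1 : ℕ) : ZMod N) = -1 := by
  rw [Nat.cast_sub hc, (ZMod.natCast_eq_zero_iff c N).2 h]; simp

noncomputable def extc (n : ℕ) {N : ℕ} (χ : DirichletCharacter ℂ N) : DirichletCharacter ℂ n :=
  if h : N ∣ n then DirichletCharacter.changeLevel h χ else 1

lemma extc_apply {n N : ℕ} (h : N ∣ n) (χ : DirichletCharacter ℂ N) {x : ℕ} (hx : Nat.Coprime x n) :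
    extc n χ (x : ZMod n) = χ (x : ZMod N) := by
  obtain ⟨u, hu⟩ := (ZMod.isUnit_iff_coprime _ _).2 hx
  rw [extc, dif_pos h, ← hu, DirichletCharacter.changeLevel_eq_cast_of_dvd, hu, ZMod.cast_natCast h]

lemma prod_char_apply {n : ℕ} (S : Finset ℕ) (F : ℕ → DirichletCharacter ℂ n) {x : ℕ} (hx : Nat.Coprime x n) :
    (∏ p ∈ S, F p) (x : ZMod n) = ∏ p ∈ S, F p (x : ZMod n) := by
  classical
  induction S using Finset.induction_on with
  | empty =>
    have := (ZMod.isUnit_iff_coprime _ _).2 hx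
    simp [MulChar.one_apply this]
  | insert p S hp ih => rw [Finset.prod_insert hp, Finset.prod_insert hp, MulChar.mul_apply, ih]

lemma crt_cop {c p : ℕ} (hp : p.Prime) (hc : c ≠ 0) {x y : ℕ} (hx : Nat.Coprime x (p ^ c.factorization p))
    (hy : Nat.Coprime y (c / p ^ c.factorization p)) : Nat.Coprime (crt c p x y) c := by
  have := Nat.Coprime.mul_right (cop_of_modEq (crt_left hp hc x y) hx) (cop_of_modEq (crt_right hp hc x y) hy)
  rwa [Nat.ordProj_mul_ordCompl_eq_self] at this

lemma crt_one {c p : ℕ} (hp : p.Prime) (hc : c ≠ 0) (hpc : p ∣ c) {x : ℕ} (hx : x ≡ 1 [MOD p ^ c.factorization p / p]) :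
    crt c p x 1 ≡ 1 [MOD c / p] := by
  have hv : 0 < c.factorization p := hp.factorization_pos_of_dvd hc hpc
  have hd : p ∣ p ^ c.factorization p := dvd_pow_self p hv.ne'
  have h1 : crt c p x 1 ≡ 1 [MOD p ^ c.factorization p / p] := ((crt_left hp hc x 1).of_dvd (Nat.div_dvd_of_dvd hd)).trans hx
  have h2 := crt_right hp hc x 1
  have hcop : Nat.Coprime (p ^ c.factorization p / p) (c / p ^ c.factorization p) :=
    Nat.Coprime.of_dvd_left (Nat.div_dvd_of_dvd hd) (cop_ord hp hc)
  have := (Nat.modEq_and_modEq_iff_modEq_mul hcop).1 ⟨h1, h2⟩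
  have e : p ^ c.factorization p / p * (c / p ^ c.factorization p) = c / p := by
    rw [Nat.div_mul_right_comm hd, Nat.ordProj_mul_ordCompl_eq_self]
  rwa [e] at this

lemma ordProj_dvd_ordCompl {c p q : ℕ} (hq : q.Prime) (hp : p.Prime) (hpq : q ≠ p) :
    q ^ c.factorization q ∣ c / p ^ c.factorization p := by
  have h := Nat.ordProj_dvd c q
  rw [← Nat.ordProj_mul_ordCompl_eq_self c p] at h
  rw [Nat.ordProj_mul_ordCompl_eq_self c p] at h
  have h' : q ^ c.factorization q ∣ p ^ c.factorization p * (c / p ^ c.factorization p) := by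
    rwa [Nat.ordProj_mul_ordCompl_eq_self c p]
  exact (Nat.Coprime.pow _ _ ((Nat.coprime_primes hq hp).2 hpq)).dvd_of_dvd_mul_left h'

open scoped Classical in
lemma buildPhi {c : ℕ} (hc : 0 < c) (θ : ∀ p : ℕ, DirichletCharacter ℂ (p ^ c.factorization p))
    (hA : ∀ p ∈ c.primeFactors, θ p = 1 ∨ (θ p).IsPrimitive) :
    ∃ (f m : ℕ) (Φ : DirichletCharacter ℂ f), 0 < f ∧ 0 < m ∧ Nat.Coprime f m ∧ c = f * m ∧ Φ.IsPrimitive ∧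
      (∀ p : ℕ, p.Prime → (p ∣ f ↔ p ∈ c.primeFactors ∧ θ p ≠ 1)) ∧
      (∀ p : ℕ, p.Prime → (p ∣ m ↔ p ∈ c.primeFactors ∧ θ p = 1)) ∧
      ∀ x : ℕ, Φ (x : ZMod f) = ∏ p ∈ c.primeFactors.filter (fun p => θ p ≠ 1), θ p (x : ZMod (p ^ c.factorization p)) := by
  classical
  set S := c.primeFactors.filter (fun p => θ p ≠ 1) with hS
  set S' := c.primeFactors.filter (fun p => ¬ θ p ≠ 1) with hS'
  have hprime : ∀ p ∈ c.primeFactors, p.Prime := fun p hp => Nat.prime_of_mem_primeFactors hp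
  have hSp : ∀ p ∈ S, p ∈ c.primeFactors := fun p hp => (Finset.mem_filter.1 hp).1
  have hSp' : ∀ p ∈ S', p ∈ c.primeFactors := fun p hp => (Finset.mem_filter.1 hp).1
  have hv : ∀ p ∈ c.primeFactors, 0 < c.factorization p := fun p hp =>
    (hprime p hp).factorization_pos_of_dvd hc.ne' (Nat.dvd_of_mem_primeFactors hp)
  set f := ∏ p ∈ S, p ^ c.factorization p with hf
  set m := ∏ p ∈ S', p ^ c.factorization p with hm
  have hcfm : c = f * m := by
    rw [hf, hm, Finset.prod_filter_mul_prod_filter_not]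
    exact (Nat.prod_factorization_pow_eq_self hc.ne').symm
  have hf0 : 0 < f := Nat.pos_of_mul_pos_right (hcfm ▸ hc)
  have hm0 : 0 < m := Nat.pos_of_mul_pos_left (hcfm ▸ hc)
  have hdiv : ∀ (U : Finset ℕ), (∀ p ∈ U, p ∈ c.primeFactors) → ∀ p : ℕ, p.Prime → (p ∣ ∏ q ∈ U, q ^ c.factorization q ↔ p ∈ U) := by
    intro U hU p hp
    rw [hp.prime.dvd_finset_prod_iff]
    constructor
    · rintro ⟨q, hq, hpq⟩
      have := (Nat.prime_dvd_prime_iff_eq hp (hprime q (hU q hq))).1 (hp.dvd_of_dvd_pow hpq)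
      rwa [this]
    · intro h
      exact ⟨p, h, dvd_pow_self p (hv p (hU p h)).ne'⟩
  have hpf : ∀ p : ℕ, p.Prime → (p ∣ f ↔ p ∈ S) := hdiv S hSp
  have hpm : ∀ p : ℕ, p.Prime → (p ∣ m ↔ p ∈ S') := hdiv S' hSp'
  have hco : Nat.Coprime f m := by
    refine Nat.coprime_of_dvd fun k hk h1 h2 => ?_
    have a1 := (Finset.mem_filter.1 ((hpf k hk).1 h1)).2
    have a2 := (Finset.mem_filter.1 ((hpm k hk).1 h2)).2
    exact a2 a1
  haveI : NeZero f := ⟨hf0.ne'⟩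
  have hNf : ∀ p ∈ S, p ^ c.factorization p ∣ f := fun p hp => Finset.dvd_prod_of_mem _ hp
  have hval : ∀ x : ℕ, (∏ p ∈ S, extc f (θ p)) (x : ZMod f) = ∏ p ∈ S, θ p (x : ZMod (p ^ c.factorization p)) := by
    intro x
    by_cases hx : Nat.Coprime x f
    · rw [prod_char_apply S (fun p => extc f (θ p)) hx]
      exact Finset.prod_congr rfl fun p hp => extc_apply (hNf p hp) _ hx
    · have h0 : (∏ p ∈ S, extc f (θ p)) (x : ZMod f) = 0 := by
        by_contra h; exact hx ((char_ne_zero_iff _ x).1 h)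
      rw [h0]
      obtain ⟨p, hp, h1, h2⟩ := Nat.Prime.not_coprime_iff_dvd.1 hx
      have hpS := (hpf p hp).1 h2
      symm
      refine Finset.prod_eq_zero hpS ?_
      by_contra h
      have := (char_ne_zero_iff _ _).1 h
      rw [Nat.coprime_pow_right_iff (hv p (hSp p hpS)), Nat.coprime_comm, hp.coprime_iff_not_dvd] at this
      exact this h1
  refine ⟨f, m, ∏ p ∈ S, extc f (θ p), hf0, hm0, hco, hcfm, ?_, ?_, ?_, hval⟩
  · refine prim_crit _ fun p hp hpf' => ?_
    have hpS := (hpf p hp).1 hpf'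
    have hpc := hSp p hpS
    have hprim : (θ p).IsPrimitive := (hA p hpc).resolve_left (Finset.mem_filter.1 hpS).2
    haveI : NeZero (p ^ c.factorization p) := ⟨(pow_pos hp.pos _).ne'⟩
    obtain ⟨u, hu1, hu2, hu3⟩ := prim_exists hprim hp (dvd_pow_self p (hv p hpc).ne')
    have hcop : Nat.Coprime (crt c p u 1) c := crt_cop hp hc.ne' hu1 (Nat.coprime_one_left _)
    refine ⟨crt c p u 1, Nat.Coprime.of_dvd_right ⟨m, hcfm⟩ hcop, ?_, ?_⟩
    · refine (crt_one hp hc.ne' (Nat.dvd_of_mem_primeFactors hpc) hu2).of_dvd ?_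
      refine ⟨m, ?_⟩
      rw [Nat.div_mul_right_comm hpf', ← hcfm]
    · rw [hval, Finset.prod_eq_single_of_mem p hpS]
      · rwa [char_congr (θ p) (crt_left hp hc.ne' u 1) (dvd_refl _)]
      · intro q hq hqp
        rw [char_congr (θ q) (crt_right hp hc.ne' u 1) (ordProj_dvd_ordCompl (hprime q (hSp q hq)) hp hqp)]
        simp
  · intro p hp
    rw [hpf p hp, hS, Finset.mem_filter]
  · intro p hp
    rw [hpm p hp, hS', Finset.mem_filter, not_not]

end

section
open Complex

/-- value away from `p` of the local family at `p` -/
noncomputable def vl (c : ℕ) (θ : ∀ p : ℕ, DirichletCharacter ℂ (p ^ c.factorization p)) (p : ℕ) : ℂ :=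
  ∏ q ∈ c.primeFactors.erase p, θ q (p : ZMod (q ^ c.factorization q))

/-- representative of `-1` at `p`, `1` elsewhere -/
noncomputable def up (c p : ℕ) : ℕ := crt c p (p ^ c.factorization p - 1) 1

/-- representative of `1` at `p`, `p` elsewhere -/
noncomputable def wp (c p : ℕ) : ℕ := crt c p 1 p

lemma cop_pow_sub_one {N : ℕ} (hN : 0 < N) : Nat.Coprime (N - 1) N := by
  have : N = (N - 1) + 1 := by omega
  conv_rhs => rw [this]
  simp

lemma mainII {q₁ q₂ c : ℕ} (hq1 : 0 < q₁) (hq2 : 0 < q₂) (hc : 0 < c) (hqc : q₁ * q₂ ∣ c)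
    {χ₁ : DirichletCharacter ℂ q₁} (h₁ : χ₁.IsPrimitive) {χ₂ : DirichletCharacter ℂ q₂} (h₂ : χ₂.IsPrimitive)
    (hpar : χ₁ (-1) * χ₂ (-1) = 1)
    (θ : ∀ p : ℕ, DirichletCharacter ℂ (p ^ c.factorization p))
    (hA : ∀ p ∈ c.primeFactors, θ p = 1 ∨ (θ p).IsPrimitive)
    (hP : χ₂ (-1) * ∏ p ∈ c.primeFactors, θ p (-1) = -1)
    (ha : ∀ p ∈ c.primeFactors, p ∣ q₁ → p ∣ q₂ → θ p ≠ 1)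
    (hd : ∀ p ∈ c.primeFactors, ¬ p ∣ q₁ → ¬ p ∣ q₂ → θ p ≠ 1 ∨ p ^ c.factorization p = 2)
    (hb : ∀ p ∈ c.primeFactors, ¬ p ∣ q₁ → p ∣ q₂ → (θ p = 1 ∧ vl c θ p ≠ χ₁ (p : ZMod q₁)) ∨
      (θ p ≠ 1 ∧ (θ p (-1) * χ₂ (up c p : ZMod q₂) = -1 ∨ vl c θ p * χ₂ (wp c p : ZMod q₂) ≠ 1))) :
    ∃ a : ℕ, Nat.Coprime a c ∧ ded χ₁ χ₂ a c ≠ 0 := by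
  classical
  obtain ⟨f, m, Φ, hf, hm, hco, hcfm, hΦ, hpf, hpm, hval⟩ := buildPhi hc θ hA
  have hprime : ∀ p ∈ c.primeFactors, p.Prime := fun p hp => Nat.prime_of_mem_primeFactors hp
  have hv : ∀ p ∈ c.primeFactors, 0 < c.factorization p := fun p hp =>
    (hprime p hp).factorization_pos_of_dvd hc.ne' (Nat.dvd_of_mem_primeFactors hp)
  have hfc : f ∣ c := ⟨m, hcfm⟩
  have hmc : m ∣ c := ⟨f, by rw [hcfm, mul_comm]⟩
  have hq1c : q₁ ∣ c := (Dvd.intro _ rfl).trans hqc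
  have hq2c : q₂ ∣ c := (Dvd.intro_left _ rfl).trans hqc
  haveI : NeZero f := ⟨hf.ne'⟩
  haveI : NeZero q₁ := ⟨hq1.ne'⟩
  haveI : NeZero q₂ := ⟨hq2.ne'⟩
  have htot : ∀ x : ℕ, Nat.Coprime x c → Φ (x : ZMod f) = ∏ p ∈ c.primeFactors, θ p (x : ZMod (p ^ c.factorization p)) := by
    intro x hx
    rw [hval]
    refine Finset.prod_subset (Finset.filter_subset _ _) ?_
    intro p hp hp2
    have : θ p = 1 := by
      by_contra h; exact hp2 (Finset.mem_filter.2 ⟨hp, h⟩)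
    rw [this]
    exact MulChar.one_apply ((ZMod.isUnit_iff_coprime _ _).2 (Nat.Coprime.of_dvd_right (Nat.ordProj_dvd c p) hx))
  -- evaluation at CRT points
  have hcrt1 : ∀ p ∈ c.primeFactors, ∀ x : ℕ, Nat.Coprime x (p ^ c.factorization p) →
      Φ (crt c p x 1 : ZMod f) = θ p (x : ZMod (p ^ c.factorization p)) := by
    intro p hp x hx
    have hpp := hprime p hp
    rw [htot _ (crt_cop hpp hc.ne' hx (Nat.coprime_one_left _)), Finset.prod_eq_single_of_mem p hp]
    · rw [char_congr (θ p) (crt_left hpp hc.ne' x 1) (dvd_refl _)]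
    · intro q hq hqp
      rw [char_congr (θ q) (crt_right hpp hc.ne' x 1) (ordProj_dvd_ordCompl (hprime q hq) hpp hqp)]
      simp
  have hcrt2 : ∀ p ∈ c.primeFactors, Φ (wp c p : ZMod f) = vl c θ p := by
    intro p hp
    have hpp := hprime p hp
    rw [wp, htot _ (crt_cop hpp hc.ne' (Nat.coprime_one_left _) (Nat.coprime_ordCompl hpp hc.ne')), vl,
      ← Finset.mul_prod_erase _ _ hp, char_congr (θ p) (crt_left hpp hc.ne' 1 p) (dvd_refl _)]
    rw [Nat.cast_one, map_one, one_mul]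
    refine Finset.prod_congr rfl fun q hq => ?_
    rw [Finset.mem_erase] at hq
    rw [char_congr (θ q) (crt_right hpp hc.ne' 1 p) (ordProj_dvd_ordCompl (hprime q hq.2) hpp hq.1)]
  have hmem : ∀ p ∈ m.primeFactors, p ∈ c.primeFactors ∧ θ p = 1 := fun p hp =>
    (hpm p (Nat.prime_of_mem_primeFactors hp)).1 (Nat.dvd_of_mem_primeFactors hp)
  have hmfac : ∀ p ∈ m.primeFactors, m.factorization p = c.factorization p := by
    intro p hp
    rw [hcfm]
    exact (Nat.factorization_eq_of_coprime_right hco (Nat.mem_primeFactors_iff_mem_primeFactorsList.1 hp)).symm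
  refine mainI hq1 hq2 hf hm hco hcfm hqc h₁ χ₂ hpar hΦ ?_ ?_ ?_ ?_ ?_
  · have h1 := htot (c - 1) (cop_pow_sub_one hc)
    rw [neg_one_cast hc hfc] at h1
    rw [h1, ← hP]
    congr 1
    refine Finset.prod_congr rfl fun p hp => ?_
    rw [neg_one_cast hc (Nat.ordProj_dvd c p)]
  · intro p hp h1 h2
    exact ha p (hmem p hp).1 h1 h2 (hmem p hp).2
  · intro p hp h1 h2
    have h3 := (hd p (hmem p hp).1 h1 h2).resolve_left (fun h => h (hmem p hp).2)
    have hpp := Nat.prime_of_mem_primeFactors hp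
    have h4 := hmfac p hp
    have h5 : p = 2 := (Nat.prime_dvd_prime_iff_eq hpp Nat.prime_two).1 (h3 ▸ dvd_pow_self p (hv p (hmem p hp).1).ne')
    subst h5
    refine ⟨rfl, ?_⟩
    rw [h4]
    exact Nat.pow_right_injective (le_refl 2) (by simpa using h3)
  · intro p hp h2
    obtain ⟨hpc, hθ⟩ := hmem p hp
    have hpp := hprime p hpc
    have h1 : ¬ p ∣ q₁ := fun h => ha p hpc h h2 hθ
    rcases hb p hpc h1 h2 with ⟨_, h⟩ | ⟨h, _⟩
    · convert h using 1
      rw [hval, vl]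
      refine Finset.prod_subset ?_ ?_
      · intro q hq
        rw [Finset.mem_filter] at hq
        rw [Finset.mem_erase]
        refine ⟨?_, hq.1⟩
        rintro rfl; exact hq.2 hθ
      · intro q hq hq2
        rw [Finset.mem_erase] at hq
        have : θ q = 1 := by
          by_contra h; exact hq2 (Finset.mem_filter.2 ⟨hq.2, h⟩)
        rw [this]
        refine MulChar.one_apply ((ZMod.isUnit_iff_coprime _ _).2 (Nat.Coprime.pow_right _ ?_))
        exact (Nat.coprime_primes hpp (hprime q hq.2)).2 (Ne.symm hq.1)
    · exact absurd hθ h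
  · intro p hpp hpor
    have hpc : p ∈ c.primeFactors := by
      rcases hpor with h | h
      · exact Nat.mem_primeFactors.2 ⟨hpp, h.trans hq2c, hc.ne'⟩
      · exact ((hpf p hpp).1 h).1
    have hpdc := Nat.dvd_of_mem_primeFactors hpc
    haveI : NeZero (p ^ c.factorization p) := ⟨(pow_pos hpp.pos _).ne'⟩
    -- common finishing data for `w` coprime to `c`
    by_cases hθ : θ p = 1
    · -- then `p ∣ q₂`
      have hp2 : p ∣ q₂ := hpor.resolve_right (fun h => ((hpf p hpp).1 h).2 hθ)
      obtain ⟨u, hu1, hu2, hu3⟩ := prim_exists h₂ hpp hp2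
      have hup : Nat.Coprime u (p ^ c.factorization p) := Nat.Coprime.pow_right _ (Nat.Coprime.of_dvd_right hp2 hu1)
      have hw := crt_cop hpp hc.ne' hup (Nat.coprime_one_left (c / p ^ c.factorization p))
      refine ⟨crt c p u 1, hw.of_dvd_right hq2c, hw.of_dvd_right hfc, Or.inl (crt_right hpp hc.ne' u 1), ?_⟩
      rw [hcrt1 p hpc u hup, hθ, MulChar.one_apply ((ZMod.isUnit_iff_coprime _ _).2 hup), mul_one]
      have : crt c p u 1 ≡ u [MOD q₂] := by
        have hcp : Nat.Coprime (p ^ q₂.factorization p) (q₂ / p ^ q₂.factorization p) := cop_ord hpp hq2.ne'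
        rw [← Nat.ordProj_mul_ordCompl_eq_self q₂ p, ← Nat.modEq_and_modEq_iff_modEq_mul hcp]
        constructor
        · exact (crt_left hpp hc.ne' u 1).of_dvd (pow_dvd_pow p ((Nat.factorization_le_iff_dvd hq2.ne' hc.ne').2 hq2c p))
        · have e1 : q₂ / p ^ q₂.factorization p ∣ c / p ^ c.factorization p := Nat.ordCompl_dvd_ordCompl_of_dvd hq2c p
          have e2 : q₂ / p ^ q₂.factorization p ∣ q₂ / p := by
            have hv2 : 0 < q₂.factorization p := hpp.factorization_pos_of_dvd hq2.ne' hp2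
            exact Nat.div_dvd_div_left (Nat.ordProj_dvd _ _) (dvd_pow_self p hv2.ne')
          exact ((crt_right hpp hc.ne' u 1).of_dvd e1).trans (hu2.symm.of_dvd e2)
      rwa [char_congr χ₂ this (dvd_refl _)]
    · have hprim := (hA p hpc).resolve_left hθ
      by_cases hty : ¬ p ∣ q₁ ∧ p ∣ q₂
      · rcases hb p hpc hty.1 hty.2 with ⟨h, _⟩ | ⟨_, h | h⟩
        · exact absurd h hθ
        · have hNpos : 0 < p ^ c.factorization p := NeZero.pos _
          have hcpn := cop_pow_sub_one hNpos
          have hw := crt_cop hpp hc.ne' hcpn (Nat.coprime_one_left (c / p ^ c.factorization p))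
          refine ⟨up c p, hw.of_dvd_right hq2c, hw.of_dvd_right hfc, Or.inl (crt_right hpp hc.ne' _ 1), ?_⟩
          rw [up, hcrt1 p hpc _ hcpn, neg_one_cast hNpos (dvd_refl _), mul_comm]
          rw [up] at h
          rw [h]
          norm_num
        · have hw := crt_cop hpp hc.ne' (Nat.coprime_one_left (p ^ c.factorization p)) (Nat.coprime_ordCompl hpp hc.ne')
          refine ⟨wp c p, hw.of_dvd_right hq2c, hw.of_dvd_right hfc, Or.inr (crt_right hpp hc.ne' 1 p), ?_⟩
          rwa [hcrt2 p hpc, mul_comm]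
      · have hq2p : q₂ ∣ c / p := by
          have : p * q₂ ∣ c := by
            by_cases h : p ∣ q₁
            · exact (mul_dvd_mul_right h q₂).trans hqc
            · have h2 : ¬ p ∣ q₂ := fun h2 => hty ⟨h, h2⟩
              exact Nat.Coprime.mul_dvd_of_dvd_of_dvd (hpp.coprime_iff_not_dvd.2 h2) hpdc hq2c
          obtain ⟨k, hk⟩ := this
          exact ⟨k, Nat.div_eq_of_eq_mul_right hpp.pos (by rw [hk]; ring)⟩
        obtain ⟨u, hu1, hu2, hu3⟩ := prim_exists hprim hpp (dvd_pow_self p (hv p hpc).ne')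
        have hw := crt_cop hpp hc.ne' hu1 (Nat.coprime_one_left (c / p ^ c.factorization p))
        refine ⟨crt c p u 1, hw.of_dvd_right hq2c, hw.of_dvd_right hfc, Or.inl (crt_right hpp hc.ne' u 1), ?_⟩
        rw [hcrt1 p hpc u hu1, char_congr χ₂ (crt_one hpp hc.ne' hpdc hu2) hq2p]
        simpa using hu3

end

section
open Complex

lemma faithful {N : ℕ} [NeZero N] (hcyc : IsCyclic (ZMod N)ˣ) :
    ∃ ω : DirichletCharacter ℂ N, ∀ x : ℕ, ω (x : ZMod N) = 1 → x ≡ 1 [MOD N] := by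
  obtain ⟨e⟩ := MulChar.mulEquiv_units (ZMod N) ℂ
  haveI : IsCyclic (MulChar (ZMod N) ℂ) := isCyclic_of_surjective e.symm e.symm.surjective
  obtain ⟨ω, hω⟩ := IsCyclic.exists_generator (α := MulChar (ZMod N) ℂ)
  refine ⟨ω, fun x hx => ?_⟩
  rw [← ZMod.natCast_eq_natCast_iff]
  by_contra hne
  obtain ⟨χ, hχ⟩ := MulChar.exists_apply_ne_one_of_hasEnoughRootsOfUnity (ZMod N) ℂ (a := (x : ZMod N)) (by simpa using hne)
  obtain ⟨n, rfl⟩ := Subgroup.mem_zpowers_iff.1 (hω χ)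
  have hu : IsUnit (x : ZMod N) := by
    by_contra hu
    rw [MulChar.map_nonunit _ hu] at hx
    exact zero_ne_one hx
  apply hχ
  obtain ⟨u, hu⟩ := hu
  rw [← hu] at hx ⊢
  have h1 : ∀ m : ℕ, (ω ^ m) (u : ZMod N) = 1 := by
    intro m
    induction m with
    | zero => simp
    | succ m ih => rw [pow_succ, MulChar.mul_apply, ih, hx, one_mul]
  rcases n with m | m
  · simpa using h1 m
  · rw [zpow_negSucc, MulChar.inv_apply_eq_inv', h1, inv_one]

lemma neg_one_sq_char {N : ℕ} (χ : DirichletCharacter ℂ N) : χ (-1) = 1 ∨ χ (-1) = -1 := by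
  have : χ (-1) * χ (-1) = 1 := by rw [← map_mul]; simp
  exact mul_self_eq_one_iff.1 this

lemma pow_char {N : ℕ} (χ : DirichletCharacter ℂ N) {m : ℕ} (hm : m ≠ 0) (x : ℕ) :
    (χ ^ m) (x : ZMod N) = χ ((x ^ m : ℕ) : ZMod N) := by
  rw [MulChar.pow_apply' _ hm]; simp

lemma prim_pp {p k : ℕ} (hp : p.Prime) (hk : 0 < k) (χ : DirichletCharacter ℂ (p ^ k)) (u : ℕ)
    (hu : Nat.Coprime u p) (h1 : u ≡ 1 [MOD p ^ (k - 1)]) (h2 : χ (u : ZMod (p ^ k)) ≠ 1) : χ.IsPrimitive := by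
  haveI : NeZero (p ^ k) := ⟨(pow_pos hp.pos _).ne'⟩
  refine prim_crit _ fun q hq hqn => ?_
  have : q = p := (Nat.prime_dvd_prime_iff_eq hq hp).1 (hq.dvd_of_dvd_pow hqn)
  subst this
  refine ⟨u, Nat.Coprime.pow_right _ hu, ?_, h2⟩
  rwa [Nat.pow_sub_one hq.ne_zero hk.ne'] at h1

/-- the powers of a faithful character -/
lemma odd_local {p k : ℕ} (hp : p.Prime) (hp2 : p ≠ 2) (hk : 0 < k) :
    ∃ ω : DirichletCharacter ℂ (p ^ k), (∀ x : ℕ, ω (x : ZMod (p ^ k)) = 1 → x ≡ 1 [MOD p ^ k]) ∧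
      ω (-1) = -1 ∧ ω.IsPrimitive ∧ (p ^ k ≠ 3 → (ω ^ 2).IsPrimitive) ∧ (p ≠ 3 → (ω ^ 3).IsPrimitive) := by
  haveI : NeZero (p ^ k) := ⟨(pow_pos hp.pos _).ne'⟩
  obtain ⟨ω, hω⟩ := faithful (ZMod.isCyclic_units_of_prime_pow p hp hp2 k)
  have hp3 : 3 ≤ p := by have := hp.two_le; omega
  have hN3 : 3 ≤ p ^ k := hp3.trans (Nat.le_self_pow hk.ne' p)
  -- the element u
  have key : ∀ j : ℕ, 0 < j → j < p → (∀ v : ℕ, k = 1 → j = 2 → p ≠ 3) → (j = 1 ∨ j = 2 ∨ j = 3) →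
      (ω ^ j).IsPrimitive := by
    intro j hj hjp h23 hj3
    by_cases hk1 : k = 1
    · subst hk1
      have : ∃ u : ℕ, Nat.Coprime u p ∧ ¬ (u ^ j ≡ 1 [MOD p]) := by
        rcases hj3 with rfl | rfl | rfl
        · refine ⟨2, (Nat.coprime_primes Nat.prime_two hp).2 (Ne.symm hp2), ?_⟩
          intro h
          have := (Nat.modEq_iff_dvd' (by norm_num)).1 h.symm
          have := Nat.le_of_dvd (by norm_num) this
          omega
        · have hp3' := h23 0 rfl rfl
          refine ⟨2, (Nat.coprime_primes Nat.prime_two hp).2 (Ne.symm hp2), ?_⟩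
          intro h
          have := (Nat.modEq_iff_dvd' (by norm_num)).1 h.symm
          have := Nat.le_of_dvd (by norm_num) this
          norm_num at this
          omega
        · by_cases h7 : p = 7
          · subst h7
            exact ⟨3, by norm_num, by decide⟩
          · refine ⟨2, (Nat.coprime_primes Nat.prime_two hp).2 (Ne.symm hp2), ?_⟩
            intro h
            have h' := (Nat.modEq_iff_dvd' (by norm_num)).1 h.symm
            norm_num at h'
            exact h7 ((Nat.prime_dvd_prime_iff_eq hp (by norm_num)).1 h')
      obtain ⟨u, hu, hu2⟩ := this
      refine prim_pp hp hk _ u hu ?_ ?_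
      · simp [Nat.modEq_one]
      · rw [pow_char _ hj.ne']
        intro h
        exact hu2 (by simpa using hω _ h)
    · have hk2 : 2 ≤ k := by omega
      have hpk : p ^ k = p ^ (k - 1) * p := by rw [← pow_succ]; congr 1; omega
      have hdvd : p ∣ p ^ (k - 1) := dvd_pow_self p (by omega)
      refine prim_pp hp hk _ (p ^ (k - 1) + 1) ?_ ?_ ?_
      · obtain ⟨e, he⟩ := hdvd
        rw [he]; simp
      · exact Nat.ModEq.symm ((Nat.modEq_iff_dvd' (by omega)).2 (by simp))
      · rw [pow_char _ hj.ne']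
        intro h
        have h' := (Nat.modEq_iff_dvd' (Nat.one_le_pow _ _ (by omega))).1 (hω _ h).symm
        obtain ⟨e, he⟩ := hdvd
        have hpos : 0 < p ^ (k - 1) := pow_pos hp.pos _
        set M := p ^ (k - 1) with hM
        have hjd : p ^ k ∣ M * j := by
          rcases hj3 with rfl | rfl | rfl
          · simpa using h'
          · have : (M + 1) ^ 2 - 1 = M * 2 + (M * p) * e := by
              rw [mul_assoc, ← he]
              have : (M + 1) ^ 2 = M * 2 + M * M + 1 := by ring
              omega
            rw [this, ← hpk] at h'
            exact (Nat.dvd_add_left (Dvd.intro _ rfl)).1 h'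
          · have : (M + 1) ^ 3 - 1 = M * 3 + (M * p) * (e * (3 + M)) := by
              have h0 : M * p * (e * (3 + M)) = M * M * (3 + M) := by
                rw [show M * p * (e * (3 + M)) = M * (p * e) * (3 + M) by ring, ← he]
              rw [h0]
              have : (M + 1) ^ 3 = M * 3 + M * M * (3 + M) + 1 := by ring
              omega
            rw [this, ← hpk] at h'
            exact (Nat.dvd_add_left (Dvd.intro _ rfl)).1 h'
        rw [hpk] at hjd
        have := Nat.le_of_dvd hj (Nat.dvd_of_mul_dvd_mul_left hpos hjd)
        omega
  refine ⟨ω, hω, ?_, ?_, ?_, ?_⟩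
  · refine (neg_one_sq_char ω).resolve_left fun h => ?_
    have h2 := neg_one_cast (c := p ^ k) (N := p ^ k) (by omega) dvd_rfl
    rw [← h2] at h
    have := (Nat.modEq_iff_dvd' (by omega)).1 (hω _ h).symm
    have := Nat.le_of_dvd (by omega) this
    omega
  · have := key 1 one_pos (by omega) (by intros; omega) (by simp)
    simpa using this
  · intro h
    exact key 2 two_pos (by omega) (by rintro _ rfl _ rfl; simp at h) (by simp)
  · intro h
    exact key 3 (by norm_num) (by omega) (by intros; omega) (by simp)

lemma prim_inv {N : ℕ} {χ : DirichletCharacter ℂ N} (h : χ.IsPrimitive) : (χ⁻¹).IsPrimitive := by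
  rw [DirichletCharacter.isPrimitive_def] at *
  rwa [DirichletCharacter.conductor_inv]

end

section
open Complex

lemma char_nz {p k r : ℕ} (hr : Nat.Coprime r p) (χ : DirichletCharacter ℂ (p ^ k)) : χ (r : ZMod (p ^ k)) ≠ 0 :=
  (char_ne_zero_iff χ r).2 (Nat.Coprime.pow_right _ hr)

lemma char_inv_neg_one {N : ℕ} (χ : DirichletCharacter ℂ N) : χ⁻¹ (-1) = χ (-1) := by
  rw [MulChar.inv_apply_eq_inv']
  rcases neg_one_sq_char χ with h | h <;> rw [h] <;> norm_num

lemma pair1 {p k r : ℕ} (hp : p.Prime) (hp2 : p ≠ 2) (hk : 0 < k) (hr : Nat.Coprime r p) (h : ¬ r ^ 2 ≡ 1 [MOD p ^ k]) :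
    ∃ α β : DirichletCharacter ℂ (p ^ k), α.IsPrimitive ∧ β.IsPrimitive ∧ α (-1) = -1 ∧ β (-1) = -1 ∧
      α (r : ZMod (p ^ k)) ≠ β (r : ZMod (p ^ k)) := by
  obtain ⟨ω, h1, h2, h3, -⟩ := odd_local hp hp2 hk
  refine ⟨ω, ω⁻¹, h3, prim_inv h3, h2, by rw [char_inv_neg_one, h2], ?_⟩
  rw [MulChar.inv_apply_eq_inv']
  intro h4
  have h5 : ω (r : ZMod (p ^ k)) * ω (r : ZMod (p ^ k)) = 1 := by
    nth_rewrite 2 [h4]; exact mul_inv_cancel₀ (char_nz hr ω)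
  refine h (h1 _ ?_)
  rw [← h5]; push_cast; rw [map_pow, sq]

lemma pair2 {p k r : ℕ} (hp : p.Prime) (hp2 : p ≠ 2) (hk : 0 < k) (hr : Nat.Coprime r p) (h3 : p ^ k ≠ 3)
    (h : ¬ r ^ 4 ≡ 1 [MOD p ^ k]) :
    ∃ α β : DirichletCharacter ℂ (p ^ k), α.IsPrimitive ∧ β.IsPrimitive ∧ α (-1) = 1 ∧ β (-1) = 1 ∧
      α (r : ZMod (p ^ k)) ≠ β (r : ZMod (p ^ k)) := by
  obtain ⟨ω, h1, h2, h4, h5, -⟩ := odd_local hp hp2 hk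
  have h6 : (ω ^ 2) (-1) = 1 := by rw [MulChar.pow_apply' _ two_ne_zero, h2]; norm_num
  refine ⟨ω ^ 2, (ω ^ 2)⁻¹, h5 h3, prim_inv (h5 h3), h6, by rw [char_inv_neg_one, h6], ?_⟩
  rw [MulChar.inv_apply_eq_inv']
  intro h4
  have h5 : (ω ^ 2) (r : ZMod (p ^ k)) * (ω ^ 2) (r : ZMod (p ^ k)) = 1 := by
    nth_rewrite 2 [h4]; exact mul_inv_cancel₀ (char_nz hr _)
  refine h (h1 _ ?_)
  rw [← h5]; push_cast; rw [MulChar.pow_apply' _ two_ne_zero, map_pow]; ring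

lemma triple {p k : ℕ} (hp : p.Prime) (hp5 : 5 ≤ p) (hk : 0 < k) (h5 : p ^ k ≠ 5) :
    ∃ f : Fin 3 → DirichletCharacter ℂ (p ^ k), (∀ i, (f i).IsPrimitive) ∧ (∀ i, f i (-1) = -1) ∧
      (∀ i j, i ≠ j → f i (2 : ℕ) ≠ f j (2 : ℕ)) ∧ (∀ i j, i ≠ j → f i (3 : ℕ) ≠ f j (3 : ℕ)) := by
  obtain ⟨ω, h1, h2, h4, -, h6⟩ := odd_local hp (by omega) hk
  have hN : 5 ≤ p ^ k := hp5.trans (Nat.le_self_pow hk.ne' p)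
  have c2 : Nat.Coprime 2 p := (Nat.coprime_primes Nat.prime_two hp).2 (by omega)
  have c3 : Nat.Coprime 3 p := (Nat.coprime_primes Nat.prime_three hp).2 (by omega)
  have main : ∀ r : ℕ, Nat.Coprime r p → ¬ r ^ 2 ≡ 1 [MOD p ^ k] → ¬ r ^ 4 ≡ 1 [MOD p ^ k] →
      ω r ≠ ω⁻¹ r ∧ ω r ≠ (ω ^ 3) r ∧ ω⁻¹ r ≠ (ω ^ 3) r := by
    intro r hr ha hb
    rw [MulChar.inv_apply_eq_inv', MulChar.pow_apply' _ three_ne_zero]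
    have hz : ω r ≠ 0 := char_nz hr ω
    have ha' : ω r ^ 2 ≠ 1 := fun h => ha (h1 _ (by push_cast; rw [map_pow, h]))
    have hb' : ω r ^ 4 ≠ 1 := fun h => hb (h1 _ (by push_cast; rw [map_pow, h]))
    refine ⟨fun h => ha' ?_, fun h => ha' ?_, fun h => hb' ?_⟩
    · rw [sq]; nth_rewrite 2 [h]; exact mul_inv_cancel₀ hz
    · apply mul_left_cancel₀ hz; rw [mul_one]; nth_rewrite 3 [h]; ring
    · rw [show ω r ^ 4 = ω r * ω r ^ 3 by ring, ← h]; exact mul_inv_cancel₀ hz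
  have hle : ∀ x : ℕ, 1 ≤ x → x ≡ 1 [MOD p ^ k] → p ^ k ∣ x - 1 := fun x hx h => (Nat.modEq_iff_dvd' hx).1 h.symm
  have hpd : ∀ m, p ^ k ∣ m → p ∣ m := fun m h => (dvd_pow_self p hk.ne').trans h
  -- p^k ∣ 3, 15, 8, 80
  have cop : ∀ m, Nat.Coprime m p → Nat.Coprime (p ^ k) m := fun m h => (Nat.Coprime.pow_right _ h).symm
  have no5 : ¬ p ^ k ∣ 5 := by
    intro h
    rcases (Nat.dvd_prime (by norm_num)).1 h with h | h <;> omega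
  obtain ⟨m1, m2, m3⟩ := main 2 c2
    (fun h => by
      have := Nat.le_of_dvd (by norm_num) (hle _ (by norm_num) h)
      norm_num at this; omega)
    (fun h => by
      have := hle _ (by norm_num) h
      norm_num at this
      rw [show 15 = 3 * 5 by norm_num] at this
      exact no5 ((cop 3 c3).dvd_of_dvd_mul_left this))
  obtain ⟨n1, n2, n3⟩ := main 3 c3
    (fun h => by
      have := hle _ (by norm_num) h
      norm_num at this
      rw [show 8 = 2 ^ 3 * 1 by norm_num] at this
      have := (cop (2 ^ 3) (Nat.Coprime.pow_left 3 c2)).dvd_of_dvd_mul_left this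
      have := Nat.le_of_dvd (by norm_num) this
      omega)
    (fun h => by
      have := hle _ (by norm_num) h
      norm_num at this
      rw [show 80 = 2 ^ 4 * 5 by norm_num] at this
      exact no5 ((cop (2 ^ 4) (Nat.Coprime.pow_left 4 c2)).dvd_of_dvd_mul_left this))
  refine ⟨![ω, ω⁻¹, ω ^ 3], ?_, ?_, ?_, ?_⟩
  · intro i; fin_cases i
    · exact h4
    · exact prim_inv h4
    · exact h6 (by omega)
  · intro i; fin_cases i
    · exact h2
    · show ω⁻¹ (-1) = -1
      rw [char_inv_neg_one, h2]
    · show (ω ^ 3) (-1) = -1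
      rw [MulChar.pow_apply' _ three_ne_zero, h2]; norm_num
  · intro i j hij; fin_cases i <;> fin_cases j <;> first | exact absurd rfl hij | assumption | (apply Ne.symm; assumption)
  · intro i j hij; fin_cases i <;> fin_cases j <;> first | exact absurd rfl hij | assumption | (apply Ne.symm; assumption)

lemma five {p k : ℕ} (hp : p.Prime) (h5 : p ^ k = 5) :
    ∃ ω : DirichletCharacter ℂ (p ^ k), ω.IsPrimitive ∧ (ω ^ 2).IsPrimitive ∧ (ω ^ 3).IsPrimitive ∧ ω (-1) = -1 ∧
      ω (2 : ℕ) ^ 2 = -1 ∧ ω (3 : ℕ) ^ 2 = -1 := by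
  have hk : 0 < k := by
    rcases Nat.eq_zero_or_pos k with rfl | h
    · simp at h5
    · exact h
  have hp5 : p = 5 := by
    have : p ∣ 5 := h5 ▸ dvd_pow_self p hk.ne'
    exact (Nat.prime_dvd_prime_iff_eq hp (by norm_num)).1 this
  obtain ⟨ω, h1, h2, h3, h4, h6⟩ := odd_local hp (by omega) hk
  have e5 : (5 : ZMod (p ^ k)) = 0 := by
    have := ZMod.natCast_self (p ^ k)
    rw [← this]; exact_mod_cast congrArg Nat.cast h5.symm
  refine ⟨ω, h3, h4 (by omega), h6 (by omega), h2, ?_, ?_⟩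
  · rw [← map_pow, ← h2]; congr 1; push_cast; linear_combination e5
  · rw [← map_pow, ← h2]; congr 1; push_cast; linear_combination 2 * e5

lemma sepQ {Q : Type*} [CommGroup Q] [Finite Q] {a : Q} (ha : a ≠ 1) : ∃ φ : Q →* ℂˣ, φ a ≠ 1 := by
  haveI : NeZero (Monoid.exponent Q) := ⟨Monoid.exponent_ne_zero_of_finite⟩
  exact CommGroup.exists_apply_ne_one_of_hasEnoughRootsOfUnity Q ℂ ha

lemma two_even {k : ℕ} (hk : 3 ≤ k) : ∃ ψ : DirichletCharacter ℂ (2 ^ k), ψ (-1) = 1 ∧ ψ ((1 + 2 ^ (k - 1) : ℕ) : ZMod (2 ^ k)) ≠ 1 := by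
  haveI : NeZero (2 ^ k) := ⟨by positivity⟩
  have hpk : 2 ^ k = 2 ^ (k - 1) * 2 := by rw [← pow_succ]; congr 1; omega
  have h4 : 4 ≤ 2 ^ (k - 1) := by
    calc 4 = 2 ^ 2 := by norm_num
      _ ≤ _ := Nat.pow_le_pow_right (by norm_num) (by omega)
  let G := (ZMod (2 ^ k))ˣ
  let H : Subgroup G := Subgroup.zpowers (-1)
  have hev : 2 ∣ 2 ^ (k - 1) := dvd_pow_self 2 (by omega)
  have hcop : Nat.Coprime (1 + 2 ^ (k - 1)) (2 ^ k) := by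
    refine Nat.Coprime.pow_right _ ?_
    rw [Nat.coprime_two_right]
    obtain ⟨e, he⟩ := hev
    rw [he]; exact ⟨e, by ring⟩
  let u : G := ZMod.unitOfCoprime _ hcop
  have hu : u ∉ H := by
    intro h
    obtain ⟨n, hn⟩ := Subgroup.mem_zpowers_iff.1 h
    have hv : (u : ZMod (2 ^ k)) = ((1 + 2 ^ (k - 1) : ℕ) : ZMod (2 ^ k)) := ZMod.coe_unitOfCoprime _ hcop
    rcases Int.even_or_odd n with h | h
    · rw [h.neg_one_zpow] at hn
      rw [← hn] at hv
      have : ((1 : ℕ) : ZMod (2 ^ k)) = ((1 + 2 ^ (k - 1) : ℕ) : ZMod (2 ^ k)) := by simpa using hv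
      rw [ZMod.natCast_eq_natCast_iff] at this
      have := (Nat.modEq_iff_dvd' (by omega)).1 this
      have := Nat.le_of_dvd (by omega) this
      omega
    · rw [h.neg_one_zpow] at hn
      rw [← hn] at hv
      have : ((2 + 2 ^ (k - 1) : ℕ) : ZMod (2 ^ k)) = 0 := by
        have e : (-1 : ZMod (2 ^ k)) = ((1 + 2 ^ (k - 1) : ℕ) : ZMod (2 ^ k)) := by rw [← hv, Units.val_neg, Units.val_one]
        have : ((2 + 2 ^ (k - 1) : ℕ) : ZMod (2 ^ k)) = 1 + ((1 + 2 ^ (k - 1) : ℕ) : ZMod (2 ^ k)) := by push_cast; ring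
        rw [this, ← e]; ring
      rw [ZMod.natCast_eq_zero_iff] at this
      have := Nat.le_of_dvd (by omega) this
      omega
  obtain ⟨φ, hφ⟩ := sepQ (a := (QuotientGroup.mk u : G ⧸ H))
    (by rwa [Ne, QuotientGroup.eq_one_iff])
  refine ⟨MulChar.ofUnitHom (φ.comp (QuotientGroup.mk' H)), ?_, ?_⟩
  · have : (-1 : ZMod (2 ^ k)) = ((-1 : G) : ZMod (2 ^ k)) := by rw [Units.val_neg, Units.val_one]
    rw [this, MulChar.ofUnitHom_coe]
    have : (QuotientGroup.mk' H) (-1) = 1 := (QuotientGroup.eq_one_iff _).2 (Subgroup.mem_zpowers _)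
    rw [MonoidHom.comp_apply, this, map_one, Units.val_one]
  · have : ((1 + 2 ^ (k - 1) : ℕ) : ZMod (2 ^ k)) = (u : ZMod (2 ^ k)) := (ZMod.coe_unitOfCoprime _ hcop).symm
    rw [this, MulChar.ofUnitHom_coe]
    intro h
    apply hφ
    exact Units.ext h

lemma two_prim {k : ℕ} (hk : 2 ≤ k) (ψ : DirichletCharacter ℂ (2 ^ k)) (h : ψ ((1 + 2 ^ (k - 1) : ℕ) : ZMod (2 ^ k)) ≠ 1) :
    ψ.IsPrimitive := by
  refine prim_pp Nat.prime_two (by omega) ψ _ ?_ ?_ h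
  · have hev : 2 ∣ 2 ^ (k - 1) := dvd_pow_self 2 (by omega)
    rw [Nat.coprime_two_right]
    obtain ⟨e, he⟩ := hev
    rw [he]; exact ⟨e, by ring⟩
  · exact Nat.ModEq.symm ((Nat.modEq_iff_dvd' (Nat.le_add_right _ _)).2 (by simp))

lemma odd_exists {n : ℕ} (hn : 2 < n) : ∃ χ : DirichletCharacter ℂ n, χ (-1) = -1 := by
  haveI : NeZero n := ⟨by omega⟩
  haveI : Fact (2 < n) := ⟨hn⟩
  obtain ⟨χ, hχ⟩ := MulChar.exists_apply_ne_one_of_hasEnoughRootsOfUnity (ZMod n) ℂ (a := (-1 : ZMod n)) ZMod.neg_one_ne_one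
  exact ⟨χ, (neg_one_sq_char χ).resolve_left hχ⟩

lemma small_odd {p k : ℕ} (hp : p.Prime) (h : p ^ k = 3 ∨ p ^ k = 4) :
    ∃ χ : DirichletCharacter ℂ (p ^ k), χ.IsPrimitive ∧ χ (-1) = -1 := by
  obtain ⟨χ, hχ⟩ := odd_exists (n := p ^ k) (by omega)
  haveI : NeZero (p ^ k) := ⟨by omega⟩
  refine ⟨χ, prim_crit _ fun q hq hqn => ⟨p ^ k - 1, cop_pow_sub_one (by omega), ?_, ?_⟩, hχ⟩
  · rcases h with h | h
    · rw [h] at hqn ⊢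
      have := (Nat.prime_dvd_prime_iff_eq hq Nat.prime_three).1 hqn
      subst this
      decide
    · rw [h] at hqn ⊢
      have : q ∣ 2 ^ 2 := hqn
      have := (Nat.prime_dvd_prime_iff_eq hq Nat.prime_two).1 (hq.dvd_of_dvd_pow this)
      subst this
      decide
  · rw [neg_one_cast (by omega) dvd_rfl, hχ]; norm_num

lemma cl_nat {d n : ℕ} (hd : d ∣ n) (χ : DirichletCharacter ℂ d) {x : ℕ} (hx : Nat.Coprime x n) :
    DirichletCharacter.changeLevel hd χ (x : ZMod n) = χ (x : ZMod d) := by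
  have hu : IsUnit (x : ZMod n) := (ZMod.isUnit_iff_coprime _ _).2 hx
  obtain ⟨u, hu⟩ := hu
  rw [← hu, DirichletCharacter.changeLevel_eq_cast_of_dvd, hu, ZMod.cast_natCast hd]

lemma cl_neg_one {d n : ℕ} (hn : 0 < n) (hd : d ∣ n) (χ : DirichletCharacter ℂ d) :
    DirichletCharacter.changeLevel hd χ (-1) = χ (-1) := by
  rw [← neg_one_cast hn dvd_rfl, cl_nat hd χ (cop_pow_sub_one hn), neg_one_cast hn hd]

lemma two_odd {k : ℕ} (hk : 3 ≤ k) : ∃ ψ : DirichletCharacter ℂ (2 ^ k), ψ (-1) = -1 ∧ ψ.IsPrimitive := by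
  obtain ⟨ψ, h1, h2⟩ := two_even hk
  obtain ⟨χ, hχ⟩ := odd_exists (n := 4) (by norm_num)
  have h4 : 4 ∣ 2 ^ k := by
    rw [show 4 = 2 ^ 2 by norm_num]; exact pow_dvd_pow 2 (by omega)
  have h4' : 4 ∣ 2 ^ (k - 1) := by
    rw [show 4 = 2 ^ 2 by norm_num]; exact pow_dvd_pow 2 (by omega)
  have hcop : Nat.Coprime (1 + 2 ^ (k - 1)) (2 ^ k) := by
    refine Nat.Coprime.pow_right _ ?_
    rw [Nat.coprime_two_right]
    obtain ⟨e, he⟩ := h4'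
    rw [he]; exact ⟨2 * e, by ring⟩
  refine ⟨ψ * DirichletCharacter.changeLevel h4 χ, ?_, two_prim (by omega) _ ?_⟩
  · rw [MulChar.mul_apply, h1, cl_neg_one (by positivity), hχ, one_mul]
  · rw [MulChar.mul_apply, cl_nat h4 χ hcop, char_congr χ (y := 1) (M := 4) _ dvd_rfl]
    · simpa using h2
    · exact Nat.ModEq.symm ((Nat.modEq_iff_dvd' (Nat.le_add_right _ _)).2 (by simpa using h4'))

lemma two_pair {k : ℕ} (hk : 3 ≤ k) : ∃ α β : DirichletCharacter ℂ (2 ^ k), α.IsPrimitive ∧ (β.IsPrimitive ∨ (k = 3 ∧ β = 1)) ∧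
    α (-1) = β (-1) ∧ α (3 : ℕ) ≠ β (3 : ℕ) := by
  have base : ∀ ψ : DirichletCharacter ℂ (2 ^ 3), ψ (-1) = 1 → ψ ((1 + 2 ^ (3 - 1) : ℕ) : ZMod (2 ^ 3)) ≠ 1 → ψ (3 : ℕ) ≠ 1 := by
    intro ψ h1 h2 h3
    apply h2
    have : ((1 + 2 ^ (3 - 1) : ℕ) : ZMod (2 ^ 3)) = -1 * ((3 : ℕ) : ZMod (2 ^ 3)) := by decide
    rw [this, map_mul, h1, h3, one_mul]
  obtain ⟨φ, f1, f2⟩ := two_even (le_refl 3)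
  have f3 := base φ f1 f2
  by_cases h3 : k = 3
  · subst h3
    refine ⟨φ, 1, two_prim (by norm_num) φ f2, Or.inr ⟨rfl, rfl⟩, ?_, ?_⟩
    · rw [f1, MulChar.one_apply (by simp)]
    · rwa [MulChar.one_apply ((ZMod.isUnit_iff_coprime _ _).2 (by norm_num))]
  · obtain ⟨ψ, h1, h2⟩ := two_even hk
    have h8 : 2 ^ 3 ∣ 2 ^ k := pow_dvd_pow 2 (by omega)
    have h8' : 2 ^ 3 ∣ 2 ^ (k - 1) := pow_dvd_pow 2 (by omega)
    have hcop : Nat.Coprime (1 + 2 ^ (k - 1)) (2 ^ k) := by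
      refine Nat.Coprime.pow_right _ ?_
      rw [Nat.coprime_two_right]
      obtain ⟨e, he⟩ := h8'
      rw [he]; exact ⟨4 * e, by ring⟩
    have c3 : Nat.Coprime 3 (2 ^ k) := Nat.Coprime.pow_right _ (by norm_num)
    refine ⟨ψ, ψ * DirichletCharacter.changeLevel h8 φ, two_prim (by omega) _ h2, Or.inl (two_prim (by omega) _ ?_), ?_, ?_⟩
    · rw [MulChar.mul_apply, cl_nat h8 φ hcop, char_congr φ (y := 1) (M := 2 ^ 3) _ dvd_rfl]
      · simpa using h2
      · exact Nat.ModEq.symm ((Nat.modEq_iff_dvd' (Nat.le_add_right _ _)).2 (by simpa using h8'))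
    · rw [MulChar.mul_apply, h1, cl_neg_one (by positivity), f1, one_mul]
    · rw [MulChar.mul_apply, cl_nat h8 φ c3]
      intro h
      exact f3 (mul_left_cancel₀ (char_nz (p := 2) (r := 3) (by norm_num) ψ) (by rw [mul_one]; exact h.symm))

/-- both signs -/
lemma both_signs {p k : ℕ} (hp : p.Prime) (hk : 0 < k) (h2 : p ^ k ≠ 2) (h3 : p ^ k ≠ 3) (h4 : p ^ k ≠ 4)
    (ε : ℂ) (hε : ε = 1 ∨ ε = -1) : ∃ χ : DirichletCharacter ℂ (p ^ k), χ.IsPrimitive ∧ χ (-1) = ε := by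
  by_cases hp2 : p = 2
  · subst hp2
    have hk3 : 3 ≤ k := by
      by_contra h
      have : k = 1 ∨ k = 2 := by omega
      rcases this with rfl | rfl <;> norm_num at *
    rcases hε with rfl | rfl
    · obtain ⟨ψ, a, b⟩ := two_even hk3
      exact ⟨ψ, two_prim (by omega) ψ b, a⟩
    · obtain ⟨ψ, a, b⟩ := two_odd hk3
      exact ⟨ψ, b, a⟩
  · obtain ⟨ω, h1, h5, h6, h7, -⟩ := odd_local hp hp2 hk
    rcases hε with rfl | rfl
    · exact ⟨ω ^ 2, h7 h3, by rw [MulChar.pow_apply' _ two_ne_zero, h5]; norm_num⟩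
    · exact ⟨ω, h6, h5⟩

lemma odd_prim {p k : ℕ} (hp : p.Prime) (hk : 0 < k) (h2 : p ^ k ≠ 2) :
    ∃ χ : DirichletCharacter ℂ (p ^ k), χ.IsPrimitive ∧ χ (-1) = -1 := by
  by_cases h : p ^ k = 3 ∨ p ^ k = 4
  · exact small_odd hp h
  · push Not at h
    exact both_signs hp hk h2 h.1 h.2 _ (Or.inr rfl)

end

section
open Complex

/-- standing hypotheses -/
structure Ctx (q₁ q₂ c : ℕ) (χ₁ : DirichletCharacter ℂ q₁) (χ₂ : DirichletCharacter ℂ q₂) : Prop where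
  hq1 : 1 < q₁
  hq2 : 1 < q₂
  hc : 0 < c
  hqc : q₁ * q₂ ∣ c
  h₁ : χ₁.IsPrimitive
  h₂ : χ₂.IsPrimitive
  hpar : χ₁ (-1) * χ₂ (-1) = 1

/-- admissible local characters away from the special primes -/
def Al (q₁ : ℕ) {q₂ : ℕ} (c : ℕ) (χ₂ : DirichletCharacter ℂ q₂) (p : ℕ) (f : DirichletCharacter ℂ (p ^ c.factorization p)) : Prop :=
  (f = 1 ∨ f.IsPrimitive) ∧ (p ∣ q₁ → p ∣ q₂ → f ≠ 1) ∧ (¬ p ∣ q₁ → ¬ p ∣ q₂ → f ≠ 1 ∨ p ^ c.factorization p = 2) ∧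
    (¬ p ∣ q₁ → p ∣ q₂ → f ≠ 1 ∧ f (-1) * χ₂ (up c p : ZMod q₂) = -1)

/-- special primes -/
def Sp (q₁ q₂ c p : ℕ) : Prop := ¬ p ∣ q₁ ∧ p ∣ q₂ ∧ (p ^ c.factorization p = 3 ∨ p ^ c.factorization p = 4)

/-- condition at special primes -/
def Cn {q₁ q₂ : ℕ} (c : ℕ) (χ₁ : DirichletCharacter ℂ q₁) (χ₂ : DirichletCharacter ℂ q₂)
    (θ : ∀ p : ℕ, DirichletCharacter ℂ (p ^ c.factorization p)) (r : ℕ) : Prop :=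
  (θ r = 1 ∧ vl c θ r ≠ χ₁ (r : ZMod q₁)) ∨ (θ r ≠ 1 ∧ vl c θ r * χ₂ (wp c r : ZMod q₂) ≠ 1)

section
variable {q₁ q₂ c : ℕ} {χ₁ : DirichletCharacter ℂ q₁} {χ₂ : DirichletCharacter ℂ q₂}

lemma mainIII (X : Ctx q₁ q₂ c χ₁ χ₂)
    (θ : ∀ p : ℕ, DirichletCharacter ℂ (p ^ c.factorization p))
    (hA : ∀ p ∈ c.primeFactors, ¬ Sp q₁ q₂ c p → Al q₁ c χ₂ p (θ p))
    (hS : ∀ p ∈ c.primeFactors, Sp q₁ q₂ c p → (θ p = 1 ∨ (θ p).IsPrimitive) ∧ Cn c χ₁ χ₂ θ p)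
    (hP : χ₂ (-1) * ∏ p ∈ c.primeFactors, θ p (-1) = -1) :
    ∃ a : ℕ, Nat.Coprime a c ∧ ded χ₁ χ₂ a c ≠ 0 := by
  refine mainII (by have := X.hq1; omega) (by have := X.hq2; omega) X.hc X.hqc X.h₁ X.h₂ X.hpar θ ?_ hP ?_ ?_ ?_
  · intro p hp
    by_cases h : Sp q₁ q₂ c p
    · exact (hS p hp h).1
    · exact (hA p hp h).1
  · intro p hp h1 h2
    exact (hA p hp (fun h => h.1 h1)).2.1 h1 h2
  · intro p hp h1 h2
    exact (hA p hp (fun h => h2 h.2.1)).2.2.1 h1 h2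
  · intro p hp h1 h2
    by_cases h : Sp q₁ q₂ c p
    · rcases (hS p hp h).2 with h | h
      · exact Or.inl h
      · exact Or.inr ⟨h.1, Or.inr h.2⟩
    · have := (hA p hp h).2.2.2 h1 h2
      exact Or.inr ⟨this.1, Or.inl this.2⟩

lemma prim_ne_one {N : ℕ} (hN : 1 < N) {χ : DirichletCharacter ℂ N} (h : χ.IsPrimitive) : χ ≠ 1 := by
  rintro rfl
  rw [DirichletCharacter.isPrimitive_def] at h
  haveI : NeZero N := ⟨by omega⟩
  rw [DirichletCharacter.conductor_one] at h
  omega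

lemma four_dvd {q : ℕ} (hq : 0 < q) {χ : DirichletCharacter ℂ q} (h : χ.IsPrimitive) (h2 : 2 ∣ q) : 4 ∣ q := by
  haveI : NeZero q := ⟨hq.ne'⟩
  obtain ⟨u, hu1, hu2, hu3⟩ := prim_exists h Nat.prime_two h2
  by_contra h4
  obtain ⟨m, rfl⟩ := h2
  rw [Nat.mul_div_cancel_left _ two_pos] at hu2
  have hm : Nat.Coprime 2 m := by
    rw [Nat.coprime_two_left, ← Nat.not_even_iff_odd, even_iff_two_dvd]
    rintro ⟨e, rfl⟩
    exact h4 ⟨e, by ring⟩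
  have hodd : u ≡ 1 [MOD 2] := by
    have : Nat.Coprime u 2 := Nat.Coprime.of_dvd_right (Dvd.intro _ rfl) hu1
    rw [Nat.coprime_two_right] at this
    exact Nat.odd_iff.1 this
  have := (Nat.modEq_and_modEq_iff_modEq_mul hm).1 ⟨hodd, hu2⟩
  rw [char_congr χ this dvd_rfl] at hu3
  simp at hu3

lemma Ctx.d1 (X : Ctx q₁ q₂ c χ₁ χ₂) : q₁ ∣ c := (Dvd.intro _ rfl).trans X.hqc
lemma Ctx.d2 (X : Ctx q₁ q₂ c χ₁ χ₂) : q₂ ∣ c := (Dvd.intro_left _ rfl).trans X.hqc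
lemma Ctx.swap_le (X : Ctx q₁ q₂ c χ₁ χ₂) {p : ℕ} (hp : p ∈ c.primeFactors) :
    p.Prime ∧ 0 < c.factorization p ∧ 1 < p ^ c.factorization p := by
  have hpp := Nat.prime_of_mem_primeFactors hp
  have hv := hpp.factorization_pos_of_dvd X.hc.ne' (Nat.dvd_of_mem_primeFactors hp)
  exact ⟨hpp, hv, Nat.one_lt_pow hv.ne' hpp.one_lt⟩

lemma pow_le_v (hc : 0 < c) {p j : ℕ} (hp : p.Prime) (h : p ^ j ∣ c) : p ^ j ∣ p ^ c.factorization p :=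
  pow_dvd_pow p ((hp.pow_dvd_iff_le_factorization hc.ne').1 h)

lemma base_eq {p k m : ℕ} (hp : p.Prime) (hk : 0 < k) {l : ℕ} (hl : l.Prime) (h : p ^ k = l ^ m) : p = l :=
  (Nat.prime_dvd_prime_iff_eq hp hl).1 (hp.dvd_of_dvd_pow (h ▸ dvd_pow_self p hk.ne'))

/-- blocks at primes dividing `q₁` or `q₂` are not `2` -/
lemma Ctx.ne2 (X : Ctx q₁ q₂ c χ₁ χ₂) {p : ℕ} (hp : p ∈ c.primeFactors) (h : p ∣ q₁ ∨ p ∣ q₂) :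
    p ^ c.factorization p ≠ 2 := by
  intro h2
  obtain ⟨hpp, hv, -⟩ := X.swap_le hp
  have : p = 2 := base_eq (m := 1) hpp hv Nat.prime_two (by simpa using h2)
  subst this
  have h4 : 2 ^ 2 ∣ c := by
    rcases h with h | h
    · exact (four_dvd (by have := X.hq1; omega) X.h₁ h).trans X.d1
    · exact (four_dvd (by have := X.hq2; omega) X.h₂ h).trans X.d2
  have := Nat.le_of_dvd (by omega) (pow_le_v X.hc Nat.prime_two h4)
  omega

lemma Ctx.ne234 (X : Ctx q₁ q₂ c χ₁ χ₂) {p : ℕ} (hp : p ∈ c.primeFactors) (h : p ∣ q₁) (h' : p ∣ q₂) :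
    p ^ c.factorization p ≠ 2 ∧ p ^ c.factorization p ≠ 3 ∧ p ^ c.factorization p ≠ 4 ∧ p ^ c.factorization p ≠ 8 := by
  obtain ⟨hpp, hv, -⟩ := X.swap_le hp
  have key : p = 2 → 16 ≤ p ^ c.factorization p := by
    rintro rfl
    have h4 : 2 ^ 4 ∣ c := by
      have := mul_dvd_mul (four_dvd (by have := X.hq1; omega) X.h₁ h) (four_dvd (by have := X.hq2; omega) X.h₂ h')
      exact this.trans X.hqc
    exact Nat.le_of_dvd (by positivity) (pow_le_v X.hc Nat.prime_two h4)
  refine ⟨X.ne2 hp (Or.inl h), fun h2 => ?_, fun h2 => ?_, fun h2 => ?_⟩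
  · have : p = 3 := base_eq (m := 1) hpp hv Nat.prime_three (by simpa using h2)
    subst this
    have h9 : 3 ^ 2 ∣ c := (mul_dvd_mul h h').trans X.hqc
    have := Nat.le_of_dvd (by omega) (pow_le_v X.hc Nat.prime_three h9)
    omega
  · have := key (base_eq (m := 2) hpp hv Nat.prime_two (by simpa using h2))
    omega
  · have := key (base_eq (m := 3) hpp hv Nat.prime_two (by simpa using h2))
    omega

lemma Ctx.up_sign (X : Ctx q₁ q₂ c χ₁ χ₂) {p : ℕ} (hp : p ∈ c.primeFactors) :
    χ₂ (up c p : ZMod q₂) = 1 ∨ χ₂ (up c p : ZMod q₂) = -1 := by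
  obtain ⟨hpp, hv, hN⟩ := X.swap_le hp
  apply mul_self_eq_one_iff.1
  rw [← map_mul, ← Nat.cast_mul]
  have h1 : up c p * up c p ≡ 1 [MOD c] := by
    have e := Nat.ordProj_mul_ordCompl_eq_self c p
    suffices up c p * up c p ≡ 1 [MOD p ^ c.factorization p * (c / p ^ c.factorization p)] by rwa [e] at this
    refine (Nat.modEq_and_modEq_iff_modEq_mul (Nat.Coprime.pow_left _ (Nat.coprime_ordCompl hpp X.hc.ne'))).1 ⟨?_, ?_⟩
    · have := (crt_left hpp X.hc.ne' (p ^ c.factorization p - 1) 1)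
      refine (this.mul this).trans ?_
      generalize p ^ c.factorization p = N at *
      refine Nat.ModEq.symm ((Nat.modEq_iff_dvd' ?_).2 ?_)
      · exact Nat.one_le_iff_ne_zero.2 (by have : 0 < N - 1 := by omega
                                           positivity)
      · obtain ⟨M, rfl⟩ : ∃ M, N = M + 1 := ⟨N - 1, by omega⟩
        refine ⟨M - 1, ?_⟩
        obtain ⟨K, rfl⟩ : ∃ K, M = K + 1 := ⟨M - 1, by omega⟩
        simp only [Nat.add_sub_cancel]
        rw [Nat.sub_eq_iff_eq_add (by nlinarith)]; ring
    · have := (crt_right hpp X.hc.ne' (p ^ c.factorization p - 1) 1)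
      exact this.mul this
  rw [char_congr χ₂ h1 X.d2]; simp

/-- local choices exist -/
lemma Ctx.E1 (X : Ctx q₁ q₂ c χ₁ χ₂) {p : ℕ} (hp : p ∈ c.primeFactors) (hs : ¬ Sp q₁ q₂ c p) :
    ∃ f, Al q₁ c χ₂ p f := by
  obtain ⟨hpp, hv, hN⟩ := X.swap_le hp
  by_cases h2 : p ^ c.factorization p = 2
  · have : ¬ (p ∣ q₁ ∨ p ∣ q₂) := fun h => X.ne2 hp h h2
    push Not at this
    exact ⟨1, Or.inl rfl, fun h => absurd h this.1, fun _ _ => Or.inr h2, fun _ h => absurd h this.2⟩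
  · by_cases hb : ¬ p ∣ q₁ ∧ p ∣ q₂
    · have h34 : ¬ (p ^ c.factorization p = 3 ∨ p ^ c.factorization p = 4) := fun h => hs ⟨hb.1, hb.2, h⟩
      push Not at h34
      obtain ⟨f, hf, hf2⟩ := both_signs hpp hv h2 h34.1 h34.2 (- χ₂ (up c p : ZMod q₂)) (by
        rcases X.up_sign hp with h | h <;> rw [h] <;> norm_num)
      refine ⟨f, Or.inr hf, fun h => absurd h hb.1, fun _ h => absurd hb.2 h, fun _ _ => ⟨prim_ne_one hN hf, ?_⟩⟩
      rw [hf2]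
      rcases X.up_sign hp with h | h <;> rw [h] <;> norm_num
    · obtain ⟨f, hf, -⟩ := odd_prim hpp hv h2
      have := prim_ne_one hN hf
      exact ⟨f, Or.inr hf, fun _ _ => this, fun _ _ => Or.inl this, fun a b => absurd ⟨a, b⟩ hb⟩

/-- primitive characters are admissible away from type b -/
lemma Al_prim (X : Ctx q₁ q₂ c χ₁ χ₂) {p : ℕ} (hp : p ∈ c.primeFactors) (hb : ¬ (¬ p ∣ q₁ ∧ p ∣ q₂))
    {f : DirichletCharacter ℂ (p ^ c.factorization p)} (hf : f.IsPrimitive) : Al q₁ c χ₂ p f := by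
  have := prim_ne_one (X.swap_le hp).2.2 hf
  exact ⟨Or.inr hf, fun _ _ => this, fun _ _ => Or.inl this, fun a b => absurd ⟨a, b⟩ hb⟩

lemma Al_one {p : ℕ} (h1 : p ∣ q₁) (h2 : ¬ p ∣ q₂) : Al q₁ c χ₂ p 1 :=
  ⟨Or.inl rfl, fun _ h => absurd h h2, fun h => absurd h1 h, fun h => absurd h1 h⟩

lemma one_neg_one {N : ℕ} : (1 : DirichletCharacter ℂ N) (-1) = 1 := MulChar.one_apply (by simp)

lemma Ctx.E2 (X : Ctx q₁ q₂ c χ₁ χ₂) {p : ℕ} (hp : p ∈ c.primeFactors) (h1 : p ∣ q₁) {ε : ℂ} (hε : ε = 1 ∨ ε = -1) :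
    ∃ f, Al q₁ c χ₂ p f ∧ f (-1) = ε := by
  obtain ⟨hpp, hv, hN⟩ := X.swap_le hp
  have hb : ¬ (¬ p ∣ q₁ ∧ p ∣ q₂) := fun h => h.1 h1
  by_cases h2 : p ∣ q₂
  · obtain ⟨n2, n3, n4, -⟩ := X.ne234 hp h1 h2
    obtain ⟨f, hf, hf2⟩ := both_signs hpp hv n2 n3 n4 ε hε
    exact ⟨f, Al_prim X hp hb hf, hf2⟩
  · rcases hε with rfl | rfl
    · exact ⟨1, Al_one h1 h2, one_neg_one⟩
    · obtain ⟨f, hf, hf2⟩ := odd_prim hpp hv (X.ne2 hp (Or.inl h1))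
      exact ⟨f, Al_prim X hp hb hf, hf2⟩

/-- at special primes there are characters of both parities -/
lemma Ctx.E3 (X : Ctx q₁ q₂ c χ₁ χ₂) {p : ℕ} (hp : p ∈ c.primeFactors) (hs : Sp q₁ q₂ c p) {ε : ℂ} (hε : ε = 1 ∨ ε = -1) :
    ∃ f : DirichletCharacter ℂ (p ^ c.factorization p), (f = 1 ∨ f.IsPrimitive) ∧ f (-1) = ε := by
  obtain ⟨hpp, hv, hN⟩ := X.swap_le hp
  rcases hε with rfl | rfl
  · exact ⟨1, Or.inl rfl, one_neg_one⟩
  · obtain ⟨f, hf, hf2⟩ := small_odd hpp hs.2.2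
    exact ⟨f, Or.inr hf, hf2⟩

lemma Ctx.default (X : Ctx q₁ q₂ c χ₁ χ₂) : ∃ D : ∀ p : ℕ, DirichletCharacter ℂ (p ^ c.factorization p),
    ∀ p ∈ c.primeFactors, ¬ Sp q₁ q₂ c p → Al q₁ c χ₂ p (D p) := by
  classical
  have : ∀ p : ℕ, ∃ f : DirichletCharacter ℂ (p ^ c.factorization p), p ∈ c.primeFactors → ¬ Sp q₁ q₂ c p → Al q₁ c χ₂ p f := by
    intro p
    by_cases h : p ∈ c.primeFactors ∧ ¬ Sp q₁ q₂ c p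
    · obtain ⟨f, hf⟩ := X.E1 h.1 h.2
      exact ⟨f, fun _ _ => hf⟩
    · exact ⟨1, fun a b => absurd ⟨a, b⟩ h⟩
  choose D hD using this
  exact ⟨D, hD⟩

lemma Ctx.P0 (X : Ctx q₁ q₂ c χ₁ χ₂) : ∃ p ∈ c.primeFactors, p ∣ q₁ := by
  have h := X.hq1
  refine ⟨q₁.minFac, ?_, Nat.minFac_dvd _⟩
  exact Nat.mem_primeFactors.2 ⟨Nat.minFac_prime h.ne', (Nat.minFac_dvd _).trans X.d1, X.hc.ne'⟩

lemma sign_prod {s : Finset ℕ} (N : ℕ → ℕ) (D : ∀ p : ℕ, DirichletCharacter ℂ (N p)) {ε : ℂ} (hε : ε = 1 ∨ ε = -1) :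
    ε * ∏ p ∈ s, D p (-1) = 1 ∨ ε * ∏ p ∈ s, D p (-1) = -1 := by
  classical
  induction s using Finset.induction_on with
  | empty => simpa using hε
  | insert a s ha ih =>
    rw [Finset.prod_insert ha]
    rcases neg_one_sq_char (D a) with h | h <;> rw [h]
    · simpa using ih
    · rcases ih with h | h
      · right; linear_combination -h
      · left; linear_combination -h

lemma par_eq {θ : ∀ p : ℕ, DirichletCharacter ℂ (p ^ c.factorization p)} {P : ℕ} (hP : P ∈ c.primeFactors)
    (h : θ P (-1) = -(χ₂ (-1) * ∏ p ∈ c.primeFactors.erase P, θ p (-1))) :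
    χ₂ (-1) * ∏ p ∈ c.primeFactors, θ p (-1) = -1 := by
  rw [← Finset.mul_prod_erase _ _ hP, h]
  rcases sign_prod (s := c.primeFactors.erase P) _ θ (neg_one_sq_char χ₂) with h | h
  · linear_combination -(χ₂ (-1) * ∏ p ∈ c.primeFactors.erase P, θ p (-1) + 1) * h
  · linear_combination -(χ₂ (-1) * ∏ p ∈ c.primeFactors.erase P, θ p (-1) - 1) * h

lemma prod_update_erase (D : ∀ p : ℕ, DirichletCharacter ℂ (p ^ c.factorization p)) (P : ℕ) (f : DirichletCharacter ℂ (P ^ c.factorization P))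
    (s : Finset ℕ) :
    ∏ p ∈ s.erase P, (Function.update D P f p) (-1) = ∏ p ∈ s.erase P, D p (-1) := by
  refine Finset.prod_congr rfl fun p hp => ?_
  rw [Function.update_of_ne (Finset.ne_of_mem_erase hp)]

lemma Ctx.R0 (X : Ctx q₁ q₂ c χ₁ χ₂) (h : ∀ p ∈ c.primeFactors, ¬ Sp q₁ q₂ c p) :
    ∃ a : ℕ, Nat.Coprime a c ∧ ded χ₁ χ₂ a c ≠ 0 := by
  classical
  obtain ⟨D, hD⟩ := X.default
  obtain ⟨P, hP, hP1⟩ := X.P0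
  have hsg := sign_prod (s := c.primeFactors.erase P) _ D (neg_one_sq_char χ₂)
  obtain ⟨f, hf, hf2⟩ := X.E2 (χ₂ := χ₂) hP hP1 (ε := -(χ₂ (-1) * ∏ p ∈ c.primeFactors.erase P, D p (-1))) (by
    rcases hsg with h | h <;> rw [h] <;> norm_num)
  refine mainIII X (Function.update D P f) ?_ ?_ ?_
  · intro p hp hs
    by_cases hpP : p = P
    · subst hpP; rwa [Function.update_self]
    · rw [Function.update_of_ne hpP]; exact hD p hp hs
  · intro p hp hs; exact absurd hs (h p hp)
  · refine par_eq hP ?_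
    rw [Function.update_self, hf2, prod_update_erase]

end

end

section
open Complex

section
variable {q₁ q₂ c : ℕ} {χ₁ : DirichletCharacter ℂ q₁} {χ₂ : DirichletCharacter ℂ q₂}

lemma prod_nz (X : Ctx q₁ q₂ c χ₁ χ₂) (D : ∀ p : ℕ, DirichletCharacter ℂ (p ^ c.factorization p)) {r : ℕ} (hr : r ∈ c.primeFactors)
    {T : Finset ℕ} (hT : T ⊆ c.primeFactors) (hrT : r ∉ T) : ∏ q ∈ T, D q (r : ZMod (q ^ c.factorization q)) ≠ 0 := by
  refine Finset.prod_ne_zero_iff.2 fun q hq => char_nz ?_ _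
  refine (Nat.coprime_primes (X.swap_le hr).1 (X.swap_le (hT hq)).1).2 ?_
  rintro rfl; exact hrT hq

lemma Ctx.one_pair (X : Ctx q₁ q₂ c χ₁ χ₂) {r : ℕ} (hr : r ∈ c.primeFactors) (hrs : Sp q₁ q₂ c r)
    (huniq : ∀ p ∈ c.primeFactors, Sp q₁ q₂ c p → p = r) {P : ℕ} (hP : P ∈ c.primeFactors) (hPr : P ≠ r)
    {α β : DirichletCharacter ℂ (P ^ c.factorization P)} (hα : Al q₁ c χ₂ P α) (hβ : Al q₁ c χ₂ P β)
    (hs : α (-1) = β (-1)) (hne : α (r : ZMod (P ^ c.factorization P)) ≠ β (r : ZMod (P ^ c.factorization P))) :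
    ∃ a : ℕ, Nat.Coprime a c ∧ ded χ₁ χ₂ a c ≠ 0 := by
  classical
  obtain ⟨D, hD⟩ := X.default
  have hPe : P ∈ c.primeFactors.erase r := Finset.mem_erase.2 ⟨hPr, hP⟩
  set T := ∏ p ∈ (c.primeFactors.erase r).erase P, D p (-1) with hT
  set K := ∏ q ∈ (c.primeFactors.erase r).erase P, D q (r : ZMod (q ^ c.factorization q)) with hK
  have hKne : K ≠ 0 := prod_nz X D hr ((Finset.erase_subset _ _).trans (Finset.erase_subset _ _)) (by simp)
  have hsg := sign_prod (s := (c.primeFactors.erase r).erase P) _ D (neg_one_sq_char χ₂)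
  obtain ⟨g, hg, hg2⟩ := X.E3 hr hrs (ε := -(χ₂ (-1) * (α (-1) * T))) (by
    rcases neg_one_sq_char α with h1 | h1 <;> rcases hsg with h | h
    · right; rw [h1]; linear_combination -h
    · left; rw [h1]; linear_combination -h
    · left; rw [h1]; linear_combination h
    · right; rw [h1]; linear_combination h)
  have solve : ∀ f : DirichletCharacter ℂ (P ^ c.factorization P), Al q₁ c χ₂ P f → f (-1) = α (-1) →
      ((g = 1 ∧ f (r : ZMod (P ^ c.factorization P)) * K ≠ χ₁ (r : ZMod q₁)) ∨
        (g ≠ 1 ∧ f (r : ZMod (P ^ c.factorization P)) * K * χ₂ (wp c r : ZMod q₂) ≠ 1)) →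
      ∃ a : ℕ, Nat.Coprime a c ∧ ded χ₁ χ₂ a c ≠ 0 := by
    intro f hf hf2 hcon
    obtain ⟨θ, t1, t2, t3⟩ : ∃ θ : ∀ p : ℕ, DirichletCharacter ℂ (p ^ c.factorization p), θ r = g ∧ θ P = f ∧
        ∀ p, p ≠ r → p ≠ P → θ p = D p := by
      refine ⟨Function.update (Function.update D P f) r g, Function.update_self .., ?_, ?_⟩
      · rw [Function.update_of_ne hPr, Function.update_self]
      · intro p h1 h2
        rw [Function.update_of_ne h1, Function.update_of_ne h2]
    have t4 : ∀ p ∈ (c.primeFactors.erase r).erase P, θ p = D p := fun p hp => by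
      simp only [Finset.mem_erase] at hp
      exact t3 p hp.2.1 hp.1
    have hvl : vl c θ r = f (r : ZMod (P ^ c.factorization P)) * K := by
      unfold vl
      rw [← Finset.mul_prod_erase _ _ hPe, t2, hK]
      congr 1
      exact Finset.prod_congr rfl fun p hp => by rw [t4 p hp]
    refine mainIII X θ ?_ ?_ ?_
    · intro p hp hps
      have h1 : p ≠ r := by rintro rfl; exact hps hrs
      by_cases h2 : p = P
      · subst h2; rwa [t2]
      · rw [t3 p h1 h2]; exact hD p hp hps
    · intro p hp hps
      obtain rfl := huniq p hp hps
      unfold Cn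
      rw [t1, hvl]
      exact ⟨hg, hcon⟩
    · refine par_eq hr ?_
      rw [t1, hg2, ← Finset.mul_prod_erase _ _ hPe, t2, hf2, hT]
      congr 3
      exact Finset.prod_congr rfl fun p hp => by rw [t4 p hp]
  by_contra hno
  have n1 := mt (solve α hα rfl) hno
  have n2 := mt (solve β hβ hs.symm) hno
  push Not at n1 n2
  by_cases h1 : g = 1
  · exact hne (mul_right_cancel₀ hKne ((n1.1 h1).trans (n2.1 h1).symm))
  · have a1 := n1.2 h1
    have a2 := n2.2 h1
    have hw : χ₂ (wp c r : ZMod q₂) ≠ 0 := by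
      intro h; rw [h, mul_zero] at a1; exact zero_ne_one a1
    exact hne (mul_right_cancel₀ hKne (mul_right_cancel₀ hw (a1.trans a2.symm)))

lemma modEq_pp {q x y : ℕ} (h : ∀ p k : ℕ, p.Prime → 0 < k → p ^ k ∣ q → x ≡ y [MOD p ^ k]) : x ≡ y [MOD q] := by
  rw [Nat.modEq_iff_dvd, Int.natCast_dvd, Nat.dvd_iff_prime_pow_dvd_dvd]
  intro p k hp hk
  rcases Nat.eq_zero_or_pos k with rfl | h0
  · simp
  · have := h p k hp h0 hk
    rwa [Nat.modEq_iff_dvd, Int.natCast_dvd] at this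

lemma small_cop {N u : ℕ} (h : N = 3 ∨ N = 4) (hu : Nat.Coprime u N) : u ≡ 1 [MOD N] ∨ u ≡ N - 1 [MOD N] := by
  rcases h with rfl | rfl
  · have : u % 3 ≠ 0 := fun h => by
      have h3 : 3 ∣ Nat.gcd u 3 := Nat.dvd_gcd (Nat.dvd_of_mod_eq_zero h) dvd_rfl
      rw [hu] at h3; norm_num at h3
    unfold Nat.ModEq; omega
  · have : u % 2 ≠ 0 := fun h => by
      have h3 : 2 ∣ Nat.gcd u 4 := Nat.dvd_gcd (Nat.dvd_of_mod_eq_zero h) (by norm_num)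
      rw [hu] at h3; norm_num at h3
    unfold Nat.ModEq; omega

lemma Ctx.up_special (X : Ctx q₁ q₂ c χ₁ χ₂) {r : ℕ} (hr : r ∈ c.primeFactors) (hrs : Sp q₁ q₂ c r) :
    χ₂ (up c r : ZMod q₂) = -1 := by
  refine (X.up_sign hr).resolve_left fun h1 => ?_
  obtain ⟨hpp, hv, hN⟩ := X.swap_le hr
  haveI : NeZero q₂ := ⟨by have := X.hq2; omega⟩
  obtain ⟨u, u1, u2, u3⟩ := prim_exists X.h₂ hpp hrs.2.1
  have hur : Nat.Coprime u (r ^ c.factorization r) := Nat.Coprime.pow_right _ (Nat.Coprime.of_dvd_right hrs.2.1 u1)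
  have hoth : ∀ p k : ℕ, p.Prime → 0 < k → p ^ k ∣ q₂ → p ≠ r → u ≡ 1 [MOD p ^ k] := by
    intro p k hp hk hpk hpr
    refine u2.of_dvd ?_
    have : p ^ k ∣ r * (q₂ / r) := by rwa [Nat.mul_div_cancel' hrs.2.1]
    exact (Nat.Coprime.pow_left k ((Nat.coprime_primes hp hpp).2 hpr)).dvd_of_dvd_mul_left this
  have hrk : ∀ k : ℕ, r ^ k ∣ q₂ → r ^ k ∣ r ^ c.factorization r := fun k hk => pow_le_v X.hc hpp (hk.trans X.d2)
  rcases small_cop hrs.2.2 hur with h | h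
  · apply u3
    rw [char_congr χ₂ (y := 1) (M := q₂) _ dvd_rfl]
    · simp
    · refine modEq_pp fun p k hp hk hpk => ?_
      by_cases hpr : p = r
      · subst hpr; exact h.of_dvd (hrk k hpk)
      · exact hoth p k hp hk hpk hpr
  · apply u3
    rw [← h1]
    refine char_congr χ₂ (M := q₂) ?_ dvd_rfl
    refine modEq_pp fun p k hp hk hpk => ?_
    by_cases hpr : p = r
    · subst hpr; exact (h.trans (crt_left hpp X.hc.ne' _ 1).symm).of_dvd (hrk k hpk)
    · refine (hoth p k hp hk hpk hpr).trans ?_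
      exact ((crt_right hpp X.hc.ne' _ 1).of_dvd ((pow_le_v X.hc hp (hpk.trans X.d2)).trans (ordProj_dvd_ordCompl hp hpp hpr))).symm

lemma small_prim_odd {q : ℕ} (h : q = 3 ∨ q = 4) {χ : DirichletCharacter ℂ q} (hχ : χ.IsPrimitive) : χ (-1) = -1 := by
  refine (neg_one_sq_char χ).resolve_left fun h1 => prim_ne_one (by omega) hχ ?_
  have key : ∀ a : (ZMod q)ˣ, a = 1 ∨ a = -1 := by
    rcases h with rfl | rfl <;> decide
  refine MulChar.ext fun a => ?_
  rcases key a with rfl | rfl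
  · simp
  · rw [Units.val_neg, Units.val_one, h1, one_neg_one]

/-- orders of 2 and 3 -/
lemma pow_facts {p k r : ℕ} (hp : p.Prime) (hp5 : 5 ≤ p) (hk : 0 < k) (hr : r = 2 ∨ r = 3) :
    Nat.Coprime r p ∧ ¬ r ^ 2 ≡ 1 [MOD p ^ k] ∧ (p ^ k ≠ 5 → ¬ r ^ 4 ≡ 1 [MOD p ^ k]) := by
  have hN : 5 ≤ p ^ k := hp5.trans (Nat.le_self_pow hk.ne' p)
  have c2 : Nat.Coprime 2 p := (Nat.coprime_primes Nat.prime_two hp).2 (by omega)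
  have c3 : Nat.Coprime 3 p := (Nat.coprime_primes Nat.prime_three hp).2 (by omega)
  have hle : ∀ x : ℕ, 1 ≤ x → x ≡ 1 [MOD p ^ k] → p ^ k ∣ x - 1 := fun x hx h => (Nat.modEq_iff_dvd' hx).1 h.symm
  have cop : ∀ m, Nat.Coprime m p → Nat.Coprime (p ^ k) m := fun m h => (Nat.Coprime.pow_right _ h).symm
  have no5 : p ^ k ≠ 5 → ¬ p ^ k ∣ 5 := by
    intro h5 h
    rcases (Nat.dvd_prime (by norm_num)).1 h with h | h <;> omega
  rcases hr with rfl | rfl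
  · refine ⟨c2, fun h => ?_, fun h5 h => ?_⟩
    · have := Nat.le_of_dvd (by norm_num) (hle _ (by norm_num) h)
      norm_num at this; omega
    · have := hle _ (by norm_num) h
      norm_num at this
      rw [show 15 = 3 * 5 by norm_num] at this
      exact no5 h5 ((cop 3 c3).dvd_of_dvd_mul_left this)
  · refine ⟨c3, fun h => ?_, fun h5 h => ?_⟩
    · have := hle _ (by norm_num) h
      norm_num at this
      rw [show 8 = 2 ^ 3 * 1 by norm_num] at this
      have := (cop (2 ^ 3) (Nat.Coprime.pow_left 3 c2)).dvd_of_dvd_mul_left this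
      have := Nat.le_of_dvd (by norm_num) this
      omega
    · have := hle _ (by norm_num) h
      norm_num at this
      rw [show 80 = 2 ^ 4 * 5 by norm_num] at this
      exact no5 h5 ((cop (2 ^ 4) (Nat.Coprime.pow_left 4 c2)).dvd_of_dvd_mul_left this)

lemma Ctx.sp_cases (X : Ctx q₁ q₂ c χ₁ χ₂) {r : ℕ} (hr : r ∈ c.primeFactors) (hrs : Sp q₁ q₂ c r) :
    (r = 2 ∧ r ^ c.factorization r = 4) ∨ (r = 3 ∧ r ^ c.factorization r = 3) := by
  obtain ⟨hpp, hv, hN⟩ := X.swap_le hr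
  rcases hrs.2.2 with h | h
  · exact Or.inr ⟨base_eq (m := 1) hpp hv Nat.prime_three (by simpa using h), h⟩
  · exact Or.inl ⟨base_eq (m := 2) hpp hv Nat.prime_two (by simpa using h), h⟩

end

end

section
open Complex

section
variable {q₁ q₂ c : ℕ} {χ₁ : DirichletCharacter ℂ q₁} {χ₂ : DirichletCharacter ℂ q₂}

lemma Ctx.R1 (X : Ctx q₁ q₂ c χ₁ χ₂) {r : ℕ} (hr : r ∈ c.primeFactors) (hrs : Sp q₁ q₂ c r)
    (huniq : ∀ p ∈ c.primeFactors, Sp q₁ q₂ c p → p = r) :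
    ∃ a : ℕ, Nat.Coprime a c ∧ ded χ₁ χ₂ a c ≠ 0 := by
  classical
  by_contra hno
  have nopair : ∀ P ∈ c.primeFactors, P ≠ r → ∀ α β : DirichletCharacter ℂ (P ^ c.factorization P),
      Al q₁ c χ₂ P α → Al q₁ c χ₂ P β → α (-1) = β (-1) →
      α (r : ZMod (P ^ c.factorization P)) ≠ β (r : ZMod (P ^ c.factorization P)) → False :=
    fun P hP hPr α β hα hβ hs hne => hno (X.one_pair hr hrs huniq hP hPr hα hβ hs hne)
  have hr23 : r = 2 ∨ r = 3 := by rcases X.sp_cases hr hrs with h | h <;> omega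
  have rc := X.sp_cases hr hrs
  have hrp := (X.swap_le hr).1
  -- primes at least 5
  have big : ∀ P ∈ c.primeFactors, 5 ≤ P → P ^ c.factorization P = 5 ∧ ¬ P ∣ q₁ ∧ P ∣ q₂ ∧ χ₂ (up c P : ZMod q₂) = -1 := by
    intro P hP hP5
    obtain ⟨hpp, hv, hN⟩ := X.swap_le hP
    obtain ⟨f1, f2, f3⟩ := pow_facts hpp hP5 hv hr23
    have hPr : P ≠ r := by omega
    obtain ⟨α, β, pa, pb, sa, sb, hne⟩ := pair1 hpp (by omega) hv f1 f2
    have hb : ¬ P ∣ q₁ ∧ P ∣ q₂ := by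
      by_contra hb
      exact nopair P hP hPr α β (Al_prim X hP hb pa) (Al_prim X hP hb pb) (sa.trans sb.symm) hne
    have mk : ∀ f : DirichletCharacter ℂ (P ^ c.factorization P), f.IsPrimitive → f (-1) * χ₂ (up c P : ZMod q₂) = -1 → Al q₁ c χ₂ P f :=
      fun f hf h => ⟨Or.inr hf, fun h => absurd h hb.1, fun _ h => absurd hb.2 h, fun _ _ => ⟨prim_ne_one hN hf, h⟩⟩
    have hup : χ₂ (up c P : ZMod q₂) = -1 := by
      refine (X.up_sign hP).resolve_left fun h => ?_
      exact nopair P hP hPr α β (mk α pa (by rw [sa, h]; norm_num)) (mk β pb (by rw [sb, h]; norm_num)) (sa.trans sb.symm) hne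
    refine ⟨?_, hb.1, hb.2, hup⟩
    by_contra h5
    have : P ≤ P ^ c.factorization P := Nat.le_self_pow hv.ne' P
    obtain ⟨α, β, pa, pb, sa, sb, hne⟩ := pair2 hpp (by omega) hv f1 (by omega) (f3 h5)
    exact nopair P hP hPr α β (mk α pa (by rw [sa, hup]; norm_num)) (mk β pb (by rw [sb, hup]; norm_num)) (sa.trans sb.symm) hne
  -- the prime of q₁
  obtain ⟨s, hs, hs1⟩ := X.P0
  obtain ⟨hsp, hsv, hsN⟩ := X.swap_le hs
  have hsr : s ≠ r := by rintro rfl; exact hrs.1 hs1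
  have hs5 : s < 5 := by
    by_contra h
    exact (big s hs (by omega)).2.1 hs1
  have hs23 : s = 2 ∨ s = 3 := by
    have := hsp.two_le
    rcases (by omega : s = 2 ∨ s = 3 ∨ s = 4) with h | h | h
    · exact Or.inl h
    · exact Or.inr h
    · subst h; exact absurd hsp (by norm_num)
  have hsb : ¬ (¬ s ∣ q₁ ∧ s ∣ q₂) := fun h => h.1 hs1
  have hcase : (s = 3 ∧ r = 2 ∧ s ^ c.factorization s = 3) ∨ (s = 2 ∧ r = 3 ∧ s ^ c.factorization s = 4) := by
    rcases hs23 with h | h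
    · right
      have hr3 : r = 3 := by omega
      refine ⟨h, hr3, ?_⟩
      by_contra h4
      have hk3 : 3 ≤ c.factorization s := by
        by_contra hk
        rcases (by omega : c.factorization s = 1 ∨ c.factorization s = 2) with h' | h'
        · exact X.ne2 hs (Or.inl hs1) (by rw [h', h]; norm_num)
        · exact h4 (by rw [h', h]; norm_num)
      clear big
      subst hr3
      have : ∃ α β : DirichletCharacter ℂ (s ^ c.factorization s), α.IsPrimitive ∧ (β.IsPrimitive ∨ (c.factorization s = 3 ∧ β = 1)) ∧
          α (-1) = β (-1) ∧ α (3 : ℕ) ≠ β (3 : ℕ) := by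
        generalize c.factorization s = k at *
        subst h
        exact two_pair hk3
      obtain ⟨α, β, pa, pb, hsab, hne⟩ := this
      refine nopair s hs hsr α β (Al_prim X hs hsb pa) ?_ hsab hne
      rcases pb with pb | ⟨pb, rfl⟩
      · exact Al_prim X hs hsb pb
      · refine Al_one hs1 fun h2 => ?_
        refine (X.ne234 hs hs1 h2).2.2.2 ?_
        rw [pb, h]; norm_num
    · left
      have hr3 : r = 2 := by omega
      refine ⟨h, hr3, ?_⟩
      by_contra h4
      obtain ⟨α, β, pa, pb, sa, sb, hne⟩ := pair1 (r := r) hsp (by omega) hsv (by rw [hr3, h]; norm_num) (by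
        intro hm
        have hm := (Nat.modEq_iff_dvd' (by rw [hr3]; norm_num)).1 hm.symm
        rw [hr3] at hm
        norm_num at hm
        rcases (Nat.dvd_prime Nat.prime_three).1 hm with h | h
        · omega
        · exact h4 h)
      exact nopair s hs hsr α β (Al_prim X hs hsb pa) (Al_prim X hs hsb pb) (sa.trans sb.symm) hne
  have hNs : s ^ c.factorization s = 3 ∨ s ^ c.factorization s = 4 := by
    rcases hcase with h | h <;> omega
  have hs2 : ¬ s ∣ q₂ := by
    intro h
    have := X.ne234 hs hs1 h
    omega
  have hS : ∀ p ∈ c.primeFactors, p = r ∨ p = s ∨ 5 ≤ p := by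
    intro p hp
    have hpp := (X.swap_le hp).1
    have := hpp.two_le
    by_contra hcon
    have : p = 4 := by omega
    subst this
    exact absurd hpp (by norm_num)
  -- χ₁ is odd
  have hq1s : q₁ ∣ s ^ c.factorization s := by
    rw [Nat.dvd_iff_prime_pow_dvd_dvd]
    intro p k hp hk
    rcases Nat.eq_zero_or_pos k with rfl | h0
    · simp
    have hpq : p ∣ q₁ := (dvd_pow_self p h0.ne').trans hk
    have hpc : p ∈ c.primeFactors := Nat.mem_primeFactors.2 ⟨hp, hpq.trans X.d1, X.hc.ne'⟩
    rcases hS p hpc with rfl | rfl | h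
    · exact absurd hpq hrs.1
    · exact pow_le_v X.hc hp (hk.trans X.d1)
    · exact absurd hpq (big p hpc h).2.1
  have hq1v : q₁ = 3 ∨ q₁ = 4 := by
    have h1 := X.hq1
    rcases hNs with h | h
    · rw [h] at hq1s
      left
      exact ((Nat.dvd_prime Nat.prime_three).1 hq1s).resolve_left (by omega)
    · rw [h] at hq1s
      right
      have h2 : 2 ∣ q₁ := by
        have : s = 2 := by omega
        rwa [this] at hs1
      exact Nat.dvd_antisymm hq1s (four_dvd (by omega) X.h₁ h2)
  have hχ1 := small_prim_odd hq1v X.h₁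
  have hχ2 : χ₂ (-1) = -1 := by
    have := X.hpar
    rw [hχ1] at this
    linear_combination -this
  -- no primes at least 5
  have hS2 : ∀ p ∈ c.primeFactors, p = r ∨ p = s := by
    intro p hp
    by_contra hcon
    have hp5 : 5 ≤ p := by have := hS p hp; omega
    obtain ⟨b1, b2, b3, b4⟩ := big p hp hp5
    have five_eq : ∀ p' ∈ c.primeFactors, 5 ≤ p' → p' = p := by
      intro p' hp' h5
      have h1 := base_eq (m := 1) (X.swap_le hp').1 (X.swap_le hp').2.1 (l := 5) (by norm_num) (by simpa using (big p' hp' h5).1)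
      have h2 := base_eq (m := 1) (X.swap_le hp).1 (X.swap_le hp).2.1 (l := 5) (by norm_num) (by simpa using b1)
      omega
    have hpp := (X.swap_le hp).1
    have hpr : p ≠ r := by omega
    have hc0 := X.hc.ne'
    have hcong : up c r * up c p ≡ c - 1 [MOD q₂] := by
      refine modEq_pp fun l k hl hk hlk => ?_
      have hlq : l ∣ q₂ := (dvd_pow_self l hk.ne').trans hlk
      have hlc : l ∈ c.primeFactors := Nat.mem_primeFactors.2 ⟨hl, hlq.trans X.d2, hc0⟩
      refine Nat.ModEq.of_dvd (pow_le_v X.hc hl (hlk.trans X.d2)) ?_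
      have hN := (X.swap_le hlc).2.2
      have hm1 : l ^ c.factorization l - 1 ≡ c - 1 [MOD l ^ c.factorization l] := by
        rw [← ZMod.natCast_eq_natCast_iff, neg_one_cast X.hc (Nat.ordProj_dvd c l), neg_one_cast (by omega) dvd_rfl]
      have hl' : l = r ∨ l = p := by
        rcases hS l hlc with h | h | h
        · exact Or.inl h
        · exact absurd (h ▸ hlq) hs2
        · exact Or.inr (five_eq l hlc h)
      rcases hl' with h | h
      · have a := crt_left hrp hc0 (r ^ c.factorization r - 1) 1
        have b := (crt_right hpp hc0 (p ^ c.factorization p - 1) 1).of_dvd (ordProj_dvd_ordCompl hrp hpp (Ne.symm hpr))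
        have := a.mul b
        rw [mul_one] at this
        subst h
        exact this.trans hm1
      · have a := (crt_right hrp hc0 (r ^ c.factorization r - 1) 1).of_dvd (ordProj_dvd_ordCompl hpp hrp hpr)
        have b := crt_left hpp hc0 (p ^ c.factorization p - 1) 1
        have := a.mul b
        rw [one_mul] at this
        subst h
        exact this.trans hm1
    have e := char_congr χ₂ hcong dvd_rfl
    rw [neg_one_cast X.hc X.d2, hχ2, Nat.cast_mul, map_mul, X.up_special hr hrs, b4] at e
    norm_num at e
  -- the case of two blocks
  obtain ⟨gr, gr1, gr2⟩ := small_odd hrp hrs.2.2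
  obtain ⟨gs, gs1, gs2⟩ := small_odd hsp hNs
  apply hno
  obtain ⟨θ, t1, t2⟩ : ∃ θ : ∀ p : ℕ, DirichletCharacter ℂ (p ^ c.factorization p), θ r = gr ∧ θ s = gs :=
    ⟨Function.update (Function.update (fun _ => 1) s gs) r gr, Function.update_self .., by
      rw [Function.update_of_ne hsr, Function.update_self]⟩
  have hSe : c.primeFactors.erase r = {s} := by
    ext p
    simp only [Finset.mem_erase, Finset.mem_singleton]
    constructor
    · rintro ⟨h1, h2⟩; exact (hS2 p h2).resolve_left h1
    · rintro rfl; exact ⟨hsr, hs⟩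
  refine mainIII X θ ?_ ?_ ?_
  · intro p hp hps
    have : p = s := (hS2 p hp).resolve_left (by rintro rfl; exact hps hrs)
    subst this
    rw [t2]; exact Al_prim X hp hsb gs1
  · intro p hp hps
    obtain rfl := huniq p hp hps
    unfold Cn
    rw [t1]
    refine ⟨Or.inr gr1, Or.inr ⟨prim_ne_one (X.swap_le hr).2.2 gr1, ?_⟩⟩
    have hvl : vl c θ p = -1 := by
      unfold vl
      rw [hSe, Finset.prod_singleton, t2, ← gs2]
      rw [← neg_one_cast (c := s ^ c.factorization s) (by omega) dvd_rfl]
      congr 2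
      rcases hcase with h | h <;> omega
    have hw : χ₂ (wp c p : ZMod q₂) = 1 := by
      rw [char_congr χ₂ (y := 1) (M := q₂) _ dvd_rfl]
      · simp
      · refine modEq_pp fun l k hl hk hlk => ?_
        have hlq : l ∣ q₂ := (dvd_pow_self l hk.ne').trans hlk
        have hlc : l ∈ c.primeFactors := Nat.mem_primeFactors.2 ⟨hl, hlq.trans X.d2, X.hc.ne'⟩
        have : l = p := (hS2 l hlc).resolve_right (by rintro rfl; exact hs2 hlq)
        subst this
        exact (crt_left hl X.hc.ne' 1 l).of_dvd (pow_le_v X.hc hl (hlk.trans X.d2))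
    rw [hvl, hw]; norm_num
  · refine par_eq hr ?_
    rw [hSe, Finset.prod_singleton, t1, t2, gr2, gs2, hχ2]; norm_num

end

end

section
open Complex

/-- abstract form of the condition at a special prime -/
def Cd (Q : Prop) (A w x : ℂ) : Prop := (Q ∧ A ≠ x) ∨ (¬ Q ∧ A * w ≠ 1)

lemma Cd_uniq {Q : Prop} {A A' w x : ℂ} (h : ¬ Cd Q A w x) (h' : ¬ Cd Q A' w x) : A = A' := by
  unfold Cd at h h'
  push Not at h h'
  by_cases hQ : Q
  · exact (h.1 hQ).trans (h'.1 hQ).symm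
  · have a := h.2 hQ
    have b := h'.2 hQ
    have hw : w ≠ 0 := by rintro rfl; simp at a
    exact mul_right_cancel₀ hw (a.trans b.symm)

section
variable {q₁ q₂ c : ℕ} {χ₁ : DirichletCharacter ℂ q₁} {χ₂ : DirichletCharacter ℂ q₂}

lemma Ctx.R2 (X : Ctx q₁ q₂ c χ₁ χ₂) (hr2 : 2 ∈ c.primeFactors) (hs2 : Sp q₁ q₂ c 2)
    (hr3 : 3 ∈ c.primeFactors) (hs3 : Sp q₁ q₂ c 3) :
    ∃ a : ℕ, Nat.Coprime a c ∧ ded χ₁ χ₂ a c ≠ 0 := by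
  classical
  have hN3 : 3 ^ c.factorization 3 = 3 := by
    rcases X.sp_cases hr3 hs3 with h | h
    · omega
    · exact h.2
  obtain ⟨P, hP, hP1⟩ := X.P0
  obtain ⟨hpp, hv, hN⟩ := X.swap_le hP
  have hP2 : P ≠ 2 := by rintro rfl; exact hs2.1 hP1
  have hP3 : P ≠ 3 := by rintro rfl; exact hs3.1 hP1
  have hP5 : 5 ≤ P := by
    have := hpp.two_le
    by_contra h
    have : P = 4 := by omega
    subst this; exact absurd hpp (by norm_num)
  have hb : ¬ (¬ P ∣ q₁ ∧ P ∣ q₂) := fun h => h.1 hP1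
  obtain ⟨D, hD⟩ := X.default
  set E := ((c.primeFactors.erase 2).erase 3).erase P with hE
  have m3 : 3 ∈ c.primeFactors.erase 2 := Finset.mem_erase.2 ⟨by norm_num, hr3⟩
  have mP : P ∈ (c.primeFactors.erase 2).erase 3 := Finset.mem_erase.2 ⟨hP3, Finset.mem_erase.2 ⟨hP2, hP⟩⟩
  have m2' : 2 ∈ c.primeFactors.erase 3 := Finset.mem_erase.2 ⟨by norm_num, hr2⟩
  have hcomm : (c.primeFactors.erase 3).erase 2 = (c.primeFactors.erase 2).erase 3 := Finset.erase_right_comm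
  have hEs : E ⊆ c.primeFactors := (Finset.erase_subset _ _).trans ((Finset.erase_subset _ _).trans (Finset.erase_subset _ _))
  set T := ∏ p ∈ E, D p (-1) with hT
  set K2 := ∏ q ∈ E, D q ((2 : ℕ) : ZMod (q ^ c.factorization q)) with hK2
  set K3 := ∏ q ∈ E, D q ((3 : ℕ) : ZMod (q ^ c.factorization q)) with hK3
  have hK2ne : K2 ≠ 0 := prod_nz X D hr2 hEs (by simp [hE])
  have hK3ne : K3 ≠ 0 := prod_nz X D hr3 hEs (by simp [hE])
  have hsg := sign_prod (s := E) _ D (neg_one_sq_char χ₂)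
  -- general solution principle
  have solve : ∀ (g2 : DirichletCharacter ℂ (2 ^ c.factorization 2)) (g3 : DirichletCharacter ℂ (3 ^ c.factorization 3))
      (f : DirichletCharacter ℂ (P ^ c.factorization P)), (g2 = 1 ∨ g2.IsPrimitive) → (g3 = 1 ∨ g3.IsPrimitive) →
      Al q₁ c χ₂ P f → g3 (-1) = -(χ₂ (-1) * (g2 (-1) * (f (-1) * T))) →
      Cd (g2 = 1) (g3 (2 : ℕ) * (f (2 : ℕ) * K2)) (χ₂ (wp c 2 : ZMod q₂)) (χ₁ (2 : ℕ)) →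
      Cd (g3 = 1) (g2 (3 : ℕ) * (f (3 : ℕ) * K3)) (χ₂ (wp c 3 : ZMod q₂)) (χ₁ (3 : ℕ)) →
      ∃ a : ℕ, Nat.Coprime a c ∧ ded χ₁ χ₂ a c ≠ 0 := by
    intro g2 g3 f hg2 hg3 hf hpar c2 c3
    obtain ⟨θ, t2, t3, tP, t⟩ : ∃ θ : ∀ p : ℕ, DirichletCharacter ℂ (p ^ c.factorization p), θ 2 = g2 ∧ θ 3 = g3 ∧ θ P = f ∧
        ∀ p, p ≠ 2 → p ≠ 3 → p ≠ P → θ p = D p := by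
      refine ⟨Function.update (Function.update (Function.update D P f) 3 g3) 2 g2, Function.update_self .., ?_, ?_, ?_⟩
      · rw [Function.update_of_ne (by norm_num), Function.update_self]
      · rw [Function.update_of_ne hP2, Function.update_of_ne hP3, Function.update_self]
      · intro p h1 h2 h3
        rw [Function.update_of_ne h1, Function.update_of_ne h2, Function.update_of_ne h3]
    have tE : ∀ p ∈ E, θ p = D p := fun p hp => by
      simp only [hE, Finset.mem_erase] at hp
      exact t p hp.2.2.1 hp.2.1 hp.1
    have v2 : vl c θ 2 = g3 (2 : ℕ) * (f (2 : ℕ) * K2) := by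
      unfold vl
      rw [← Finset.mul_prod_erase _ _ m3, ← Finset.mul_prod_erase _ _ mP, t3, tP, hK2]
      congr 2
      exact Finset.prod_congr rfl fun p hp => by rw [tE p hp]
    have v3 : vl c θ 3 = g2 (3 : ℕ) * (f (3 : ℕ) * K3) := by
      unfold vl
      rw [← Finset.mul_prod_erase _ _ m2', hcomm, ← Finset.mul_prod_erase _ _ mP, t2, tP, hK3]
      congr 2
      exact Finset.prod_congr rfl fun p hp => by rw [tE p hp]
    refine mainIII X θ ?_ ?_ ?_
    · intro p hp hps
      by_cases h2 : p = P
      · subst h2; rwa [tP]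
      · rw [t p (by rintro rfl; exact hps hs2) (by rintro rfl; exact hps hs3) h2]; exact hD p hp hps
    · intro p hp hps
      rcases X.sp_cases hp hps with ⟨rfl, -⟩ | ⟨rfl, -⟩
      · unfold Cn
        rw [t2, v2]
        exact ⟨hg2, c2⟩
      · unfold Cn
        rw [t3, v3]
        exact ⟨hg3, c3⟩
    · refine par_eq hr3 ?_
      rw [t3, hpar, ← Finset.mul_prod_erase _ _ m2', hcomm, ← Finset.mul_prod_erase _ _ mP, t2, tP, hT]
      congr 4
      exact Finset.prod_congr rfl fun p hp => by rw [tE p hp]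
  have sgn : ∀ (g2 : DirichletCharacter ℂ (2 ^ c.factorization 2)) (f : DirichletCharacter ℂ (P ^ c.factorization P)),
      -(χ₂ (-1) * (g2 (-1) * (f (-1) * T))) = 1 ∨ -(χ₂ (-1) * (g2 (-1) * (f (-1) * T))) = -1 := by
    intro g2 f
    rcases neg_one_sq_char g2 with h1 | h1 <;> rcases neg_one_sq_char f with h2 | h2 <;> rw [h1, h2] <;> rcases hsg with h | h
    · right; linear_combination -h
    · left; linear_combination -h
    · left; linear_combination h
    · right; linear_combination h
    · left; linear_combination h
    · right; linear_combination h
    · right; linear_combination -h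
    · left; linear_combination -h
  by_cases h5 : P ^ c.factorization P = 5
  · -- block 5
    have hP2' : ¬ P ∣ q₂ := by
      intro h
      have h25 : P ^ 2 ∣ c := by rw [sq]; exact (mul_dvd_mul hP1 h).trans X.hqc
      have := Nat.le_of_dvd (by omega) (pow_le_v X.hc hpp h25)
      rw [h5] at this
      nlinarith
    obtain ⟨ω, w1, w2, w3, w4, w5, w6⟩ := five hpp h5
    have pairsolve : ∀ (f1 f2 : DirichletCharacter ℂ (P ^ c.factorization P)) (δ : ℂ), Al q₁ c χ₂ P f1 → Al q₁ c χ₂ P f2 →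
        f1 (-1) = f2 (-1) → f1 (3 : ℕ) ≠ f2 (3 : ℕ) → f1 (2 : ℕ) ^ 2 = δ → f2 (2 : ℕ) ^ 2 = δ →
        δ * K2 ^ 2 ≠ χ₁ (2 : ℕ) ^ 2 → ∃ a : ℕ, Nat.Coprime a c ∧ ded χ₁ χ₂ a c ≠ 0 := by
      intro f1 f2 δ a1 a2 hs hne d1 d2 hδ
      obtain ⟨g3, hg3, hg3'⟩ := X.E3 hr3 hs3 (sgn 1 f1)
      have hg32 : g3 (2 : ℕ) ^ 2 = 1 := by
        have : g3 (2 : ℕ) = g3 (-1) := by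
          rw [← neg_one_cast (c := 3 ^ c.factorization 3) (by omega) dvd_rfl]
          congr 2
          omega
        rw [this]
        rcases neg_one_sq_char g3 with h | h <;> rw [h] <;> norm_num
      have C2 : ∀ f : DirichletCharacter ℂ (P ^ c.factorization P), f (2 : ℕ) ^ 2 = δ →
          Cd ((1 : DirichletCharacter ℂ (2 ^ c.factorization 2)) = 1) (g3 (2 : ℕ) * (f (2 : ℕ) * K2)) (χ₂ (wp c 2 : ZMod q₂)) (χ₁ (2 : ℕ)) := by
        intro f hf
        refine Or.inl ⟨rfl, fun h => hδ ?_⟩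
        rw [← h, ← hf]
        linear_combination -(f (2 : ℕ) ^ 2 * K2 ^ 2) * hg32
      by_contra hno
      have n1 := mt (solve 1 g3 f1 (Or.inl rfl) hg3 a1 hg3' (C2 f1 d1)) hno
      have n2 := mt (solve 1 g3 f2 (Or.inl rfl) hg3 a2 (by rw [← hs]; exact hg3') (C2 f2 d2)) hno
      have e := Cd_uniq n1 n2
      have hu : (1 : DirichletCharacter ℂ (2 ^ c.factorization 2)) (3 : ℕ) ≠ 0 := char_nz (p := 2) (r := 3) (by norm_num) _
      exact hne (mul_right_cancel₀ hK3ne (mul_left_cancel₀ hu e))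
    have o3 : (1 : DirichletCharacter ℂ (P ^ c.factorization P)) (3 : ℕ) = 1 :=
      MulChar.one_apply ((ZMod.isUnit_iff_coprime _ _).2 (by rw [h5]; norm_num))
    have o2 : (1 : DirichletCharacter ℂ (P ^ c.factorization P)) (2 : ℕ) = 1 :=
      MulChar.one_apply ((ZMod.isUnit_iff_coprime _ _).2 (by rw [h5]; norm_num))
    by_cases hX : K2 ^ 2 = χ₁ (2 : ℕ) ^ 2
    · refine pairsolve ω (ω ^ 3) (-1) (Al_prim X hP hb w1) (Al_prim X hP hb w3) ?_ ?_ w5 ?_ ?_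
      · rw [MulChar.pow_apply' _ three_ne_zero, w4]; norm_num
      · rw [MulChar.pow_apply' _ three_ne_zero]
        intro h
        have h0 : ω (3 : ℕ) = 0 := by linear_combination (1 / 2 : ℂ) * h + (1 / 2 : ℂ) * ω (3 : ℕ) * w6
        rw [h0] at w6; norm_num at w6
      · rw [MulChar.pow_apply' _ three_ne_zero]
        linear_combination (ω (2 : ℕ) ^ 4 - ω (2 : ℕ) ^ 2 + 1) * w5
      · rw [← hX]
        intro h
        have h0 : K2 ^ 2 = 0 := by linear_combination (-1 / 2 : ℂ) * h
        exact hK2ne (pow_eq_zero_iff two_ne_zero |>.1 h0)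
    · refine pairsolve 1 (ω ^ 2) 1 (Al_one hP1 hP2') (Al_prim X hP hb w2) ?_ ?_ ?_ ?_ ?_
      · rw [one_neg_one, MulChar.pow_apply' _ two_ne_zero, w4]; norm_num
      · rw [o3, MulChar.pow_apply' _ two_ne_zero, w6]; norm_num
      · rw [o2]; norm_num
      · rw [MulChar.pow_apply' _ two_ne_zero, w5]; norm_num
      · rwa [one_mul]
  · obtain ⟨f, p1, p2, p3, p4⟩ := triple hpp hP5 hv h5
    obtain ⟨g2, hg2, hg2'⟩ := small_odd (p := 2) Nat.prime_two hs2.2.2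
    obtain ⟨g3, hg3, hg3'⟩ := X.E3 hr3 hs3 (sgn g2 (f 0))
    by_contra hno
    have n3 : g3 (2 : ℕ) ≠ 0 := char_nz (p := 3) (r := 2) (by norm_num) _
    have n2 : g2 (3 : ℕ) ≠ 0 := char_nz (p := 2) (r := 3) (by norm_num) _
    have bad : ∀ i, ¬ Cd (g2 = 1) (g3 (2 : ℕ) * (f i (2 : ℕ) * K2)) (χ₂ (wp c 2 : ZMod q₂)) (χ₁ (2 : ℕ)) ∨
        ¬ Cd (g3 = 1) (g2 (3 : ℕ) * (f i (3 : ℕ) * K3)) (χ₂ (wp c 3 : ZMod q₂)) (χ₁ (3 : ℕ)) := by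
      intro i
      by_contra h
      push Not at h
      exact hno (solve g2 g3 (f i) (Or.inr hg2) hg3 (Al_prim X hP hb (p1 i)) (by rw [hg3', p2, p2]) h.1 h.2)
    have u2 : ∀ i j, i ≠ j → ¬ Cd (g2 = 1) (g3 (2 : ℕ) * (f i (2 : ℕ) * K2)) (χ₂ (wp c 2 : ZMod q₂)) (χ₁ (2 : ℕ)) →
        ¬ Cd (g2 = 1) (g3 (2 : ℕ) * (f j (2 : ℕ) * K2)) (χ₂ (wp c 2 : ZMod q₂)) (χ₁ (2 : ℕ)) → False := fun i j hij a b =>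
      p3 i j hij (mul_right_cancel₀ hK2ne (mul_left_cancel₀ n3 (Cd_uniq a b)))
    have u3 : ∀ i j, i ≠ j → ¬ Cd (g3 = 1) (g2 (3 : ℕ) * (f i (3 : ℕ) * K3)) (χ₂ (wp c 3 : ZMod q₂)) (χ₁ (3 : ℕ)) →
        ¬ Cd (g3 = 1) (g2 (3 : ℕ) * (f j (3 : ℕ) * K3)) (χ₂ (wp c 3 : ZMod q₂)) (χ₁ (3 : ℕ)) → False := fun i j hij a b =>
      p4 i j hij (mul_right_cancel₀ hK3ne (mul_left_cancel₀ n2 (Cd_uniq a b)))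
    have h01 : (0 : Fin 3) ≠ 1 := by decide
    have h02 : (0 : Fin 3) ≠ 2 := by decide
    have h12 : (1 : Fin 3) ≠ 2 := by decide
    rcases bad 0 with a | a <;> rcases bad 1 with b | b <;> rcases bad 2 with d | d
    · exact u2 0 1 h01 a b
    · exact u2 0 1 h01 a b
    · exact u2 0 2 h02 a d
    · exact u3 1 2 h12 b d
    · exact u2 1 2 h12 b d
    · exact u3 0 2 h02 a d
    · exact u3 0 1 h01 a b
    · exact u3 0 1 h01 a b

lemma Ctx.final (X : Ctx q₁ q₂ c χ₁ χ₂) : ∃ a : ℕ, Nat.Coprime a c ∧ ded χ₁ χ₂ a c ≠ 0 := by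
  by_cases h0 : ∀ p ∈ c.primeFactors, ¬ Sp q₁ q₂ c p
  · exact X.R0 h0
  push Not at h0
  obtain ⟨r, hr, hrs⟩ := h0
  by_cases h1 : ∀ p ∈ c.primeFactors, Sp q₁ q₂ c p → p = r
  · exact X.R1 hr hrs h1
  push Not at h1
  obtain ⟨s, hs, hss, hne⟩ := h1
  rcases X.sp_cases hr hrs with ⟨rfl, -⟩ | ⟨rfl, -⟩ <;> rcases X.sp_cases hs hss with ⟨rfl, -⟩ | ⟨rfl, -⟩
  · exact absurd rfl hne
  · exact X.R2 hr hrs hs hss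
  · exact X.R2 hs hss hr hrs
  · exact absurd rfl hne

end

end

/-- Strong nontriviality: for each `c > 0` with `q₁q₂ ∣ c` there is `a` coprime to `c`
with `S_{χ₁,χ₂}(a, c) ≠ 0`. -/
theorem strong_nontriviality {q₁ q₂ : ℕ} (hq₁ : 1 < q₁) (hq₂ : 1 < q₂)
    (χ₁ : DirichletCharacter ℂ q₁) (χ₂ : DirichletCharacter ℂ q₂)
    (h₁ : χ₁.IsPrimitive) (h₂ : χ₂.IsPrimitive)
    (hpar : χ₁ (-1) * χ₂ (-1) = 1)
    (c : ℤ) (hc : 0 < c) (hdvd : ((q₁ * q₂ : ℕ) : ℤ) ∣ c) :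
    ∃ a : ℤ, IsCoprime a c ∧ ded χ₁ χ₂ a c ≠ 0 := by
  lift c to ℕ using hc.le
  have X : Ctx q₁ q₂ c χ₁ χ₂ :=
    ⟨hq₁, hq₂, by exact_mod_cast hc, by exact_mod_cast hdvd, h₁, h₂, hpar⟩
  obtain ⟨a, ha, hne⟩ := X.final
  exact ⟨a, Nat.isCoprime_iff_coprime.2 ha, hne⟩
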